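/- arXiv:1001.0194 — 2 statements merged into one kernel-verified Lean document; each statement's English description precedes it below -/
import Mathlib

section
/- Let μ be a singular cardinal. Then there is a function D from unordered pairs of ordinals below μ⁺ to μ⁺ × μ⁺ × cf(μ) such that: whenever ⟨t_α : α < μ⁺⟩ is a sequence of pairwise disjoint nonempty subsets of μ⁺, each of cardinality less than cf(μ), there exist stationary subsets S and T of μ⁺ such that for every α* ∈ S, every β* ∈ T with α* < β*, and every δ < cf(μ), there are ordinals α < β < μ⁺ such that D({ξ, ζ}) = ⟨α*, β*, δ⟩ for all ξ ∈ t_α and ζ ∈ t_β. -/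
noncomputable section

open Set

/-- The successor cardinal of `mu`, as an ordinal. -/
def sucOrd (mu : Cardinal) : Ordinal := (Order.succ mu).ord

/-- The cofinality of `mu`, as an ordinal. -/
def cofOrd (mu : Cardinal) : Ordinal := (Ordinal.cof mu.ord).ord

/-- `mu` is a singular cardinal: infinite, with cofinality smaller than itself. -/
def IsSingular (mu : Cardinal) : Prop :=
  Cardinal.aleph0 ≤ mu ∧ Ordinal.cof mu.ord < mu

/-- `C` is unbounded below `lam`. -/
def UnbddIn (C : Set Ordinal) (lam : Ordinal) : Prop :=
  ∀ x < lam, ∃ y ∈ C, x ≤ y ∧ y < lam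

/-- `C` is closed below `lam`: any accumulation point below `lam` belongs to `C`. -/
def ClosedIn (C : Set Ordinal) (lam : Ordinal) : Prop :=
  ∀ δ, δ < lam → 0 < δ → (∀ x < δ, ∃ y ∈ C, x < y ∧ y < δ) → δ ∈ C

/-- `C` is a closed unbounded subset of `lam`. -/
def IsClubIn (C : Set Ordinal) (lam : Ordinal) : Prop :=
  C ⊆ Set.Iio lam ∧ ClosedIn C lam ∧ UnbddIn C lam

/-- `S` is a stationary subset of `lam`: it meets every closed unbounded subset of `lam`. -/
def IsStatIn (S : Set Ordinal) (lam : Ordinal) : Prop :=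
  S ⊆ Set.Iio lam ∧ ∀ C, IsClubIn C lam → (S ∩ C).Nonempty

/-- The set of ordinals `t` has cardinality `< kappa`. -/
def CardLT (t : Set Ordinal) (kappa : Cardinal) : Prop :=
  (Cardinal.mk ↥t : Cardinal.{1}) < Cardinal.lift.{1, 0} kappa

/-- `c` witnesses Shelah's principle `pr₁(μ⁺, μ⁺, σ, cf μ)`: for every sequence
`⟨t_α : α < μ⁺⟩` of pairwise disjoint subsets of `μ⁺`, each of size `< cf μ`, and every
color `ε < σ`, there are `α < β < μ⁺` with `c` constantly `ε` on pairs from `t_α × t_β`. -/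
def Pr1With (mu sigma : Cardinal) (c : Ordinal → Ordinal → Ordinal) : Prop :=
  (∀ a b, a < b → b < sucOrd mu → c a b < sigma.ord) ∧
  ∀ t : Ordinal → Set Ordinal,
    (∀ a, a < sucOrd mu → t a ⊆ Set.Iio (sucOrd mu)) →
    (∀ a b, a < sucOrd mu → b < sucOrd mu → a ≠ b → Disjoint (t a) (t b)) →
    (∀ a, a < sucOrd mu → CardLT (t a) (Ordinal.cof mu.ord)) →
    ∀ ε, ε < sigma.ord →
      ∃ α β, α < β ∧ β < sucOrd mu ∧
        ∀ ξ ∈ t α, ∀ ζ ∈ t β, c (min ξ ζ) (max ξ ζ) = ε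

/-- Shelah's principle `pr₁(μ⁺, μ⁺, σ, cf μ)`. -/
def Pr1 (mu sigma : Cardinal) : Prop := ∃ c, Pr1With mu sigma c

/-- `(mus, f)` is a scale for the singular cardinal `mu`. -/
structure IsScale (mu : Cardinal) (mus : Ordinal → Cardinal)
    (f : Ordinal → Ordinal → Ordinal) : Prop where
  regular : ∀ i, i < cofOrd mu → (mus i).IsRegular
  strictMono : ∀ i j, i < j → j < cofOrd mu → mus i < mus j
  le_mu : ∀ i, i < cofOrd mu → mus i ≤ mu
  unbdd : ∀ θ, θ < mu → ∃ i, i < cofOrd mu ∧ θ < mus i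
  cof_lt : Ordinal.cof mu.ord < mus 0
  f_lt : ∀ α, α < sucOrd mu → ∀ i, i < cofOrd mu → f α i < (mus i).ord
  f_mono : ∀ α β, α < β → β < sucOrd mu →
    ∃ i0, i0 < cofOrd mu ∧ ∀ i, i0 ≤ i → i < cofOrd mu → f α i < f β i
  f_cofinal : ∀ g : Ordinal → Ordinal, (∀ i, i < cofOrd mu → g i < (mus i).ord) →
    ∃ α, α < sucOrd mu ∧ ∃ i0, i0 < cofOrd mu ∧ ∀ i, i0 ≤ i → i < cofOrd mu → g i < f α i

/-- The minimal walk from `b` down to `a` along the C-sequence `e`: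
`walk e a b 0 = b` and `walk e a b (n+1) = min (e (walk e a b n) \ a)`,
staying at `a` once it is reached. -/
def walk (e : Ordinal → Set Ordinal) (a b : Ordinal) : ℕ → Ordinal
  | 0 => b
  | n + 1 => if walk e a b n = a then a else sInf (e (walk e a b n) ∩ Set.Ici a)

/-- `ρ₂(a,b)`: the length of the minimal walk from `b` to `a`, i.e. the least `n`
with `walk e a b n = a`. -/
def rho2 (e : Ordinal → Set Ordinal) (a b : Ordinal) : ℕ :=
  sInf {n : ℕ | walk e a b n = a}

/-- `β_i⁻(a,b)`: zero for `i = 0`, and `sup (e_{β_j(a,b)} ∩ a)` for `i = j+1`. -/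
def walkLow (e : Ordinal → Set Ordinal) (a b : Ordinal) : ℕ → Ordinal
  | 0 => 0
  | j + 1 => sSup (e (walk e a b j) ∩ Set.Iio a)

/-- `γ(a,b) = β_{ρ₂(a,b)-1}(a,b)`, the last step before the walk reaches `a`. -/
def gammaW (e : Ordinal → Set Ordinal) (a b : Ordinal) : Ordinal :=
  walk e a b (rho2 e a b - 1)

/-- `γ⁻(a,b) = max {β_i⁻(a,b) : i < ρ₂(a,b)}`. -/
def gammaMinusW (e : Ordinal → Set Ordinal) (a b : Ordinal) : Ordinal :=
  sSup (walkLow e a b '' {i : ℕ | i < rho2 e a b})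

/-- `η(a,b) = max {β_i⁻(a,b) : i ≤ ρ₂(a,b)}`. -/
def etaW (e : Ordinal → Set Ordinal) (a b : Ordinal) : Ordinal :=
  sSup (walkLow e a b '' {i : ℕ | i ≤ rho2 e a b})

/-- `e` is a C-sequence on `lam`: each `e ξ` is closed unbounded in `ξ`. -/
def IsCSeq (e : Ordinal → Set Ordinal) (lam : Ordinal) : Prop :=
  ∀ ξ, ξ < lam → IsClubIn (e ξ) ξ

/-- `ξ` is an accumulation point of `C`: `ξ = sup (C ∩ ξ) > 0`. -/
def IsAccOf (C : Set Ordinal) (ξ : Ordinal) : Prop :=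
  0 < ξ ∧ sSup (C ∩ Set.Iio ξ) = ξ

/-- The non-accumulation points of `C`. -/
def naccOf (C : Set Ordinal) : Set Ordinal :=
  {ξ ∈ C | sSup (C ∩ Set.Iio ξ) < ξ}

namespace SingularColoring

open Cardinal

/-! ### Cardinalities of sets of ordinals -/

/-- The set of ordinals `A` has cardinality `≤ c`. -/
def CardLE (A : Set Ordinal) (c : Cardinal) : Prop :=
  (Cardinal.mk ↥A : Cardinal.{1}) ≤ Cardinal.lift.{1, 0} c

theorem CardLE.mono {A B : Set Ordinal} {c : Cardinal} (hB : CardLE B c) (h : A ⊆ B) :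
    CardLE A c :=
  (mk_le_mk_of_subset h).trans hB

theorem CardLE.trans {A : Set Ordinal} {c d : Cardinal} (hA : CardLE A c) (h : c ≤ d) :
    CardLE A d :=
  le_trans hA (Cardinal.lift_le.2 h)

theorem CardLE.lt {A : Set Ordinal} {c d : Cardinal} (hA : CardLE A c) (h : c < d) :
    CardLT A d :=
  lt_of_le_of_lt hA (Cardinal.lift_lt.2 h)

theorem cardLT_mono {A B : Set Ordinal} {c : Cardinal} (hB : CardLT B c) (h : A ⊆ B) :
    CardLT A c :=
  (mk_le_mk_of_subset h).trans_lt hB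

theorem cardLT_trans {A : Set Ordinal} {c d : Cardinal} (hA : CardLT A c) (h : c ≤ d) :
    CardLT A d :=
  lt_of_lt_of_le hA (Cardinal.lift_le.2 h)

theorem cardLE_Iio {o : Ordinal} {c : Cardinal} : CardLE (Iio o) c ↔ o.card ≤ c := by
  rw [CardLE, Cardinal.mk_Iio_ordinal, Cardinal.lift_le]

theorem cardLT_Iio {o : Ordinal} {c : Cardinal} : CardLT (Iio o) c ↔ o.card < c := by
  rw [CardLT, Cardinal.mk_Iio_ordinal, Cardinal.lift_lt]

theorem CardLE.image {A : Set Ordinal} {c : Cardinal} (hA : CardLE A c)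
    (f : Ordinal → Ordinal) : CardLE (f '' A) c :=
  mk_image_le.trans hA

theorem cardLT_image {A : Set Ordinal} {c : Cardinal} (hA : CardLT A c)
    (f : Ordinal → Ordinal) : CardLT (f '' A) c :=
  mk_image_le.trans_lt hA

theorem cardLE_singleton (x : Ordinal) {c : Cardinal} (hc : ℵ₀ ≤ c) : CardLE {x} c := by
  rw [CardLE, mk_singleton]
  exact one_le_aleph0.trans (aleph0_le_lift.2 hc)

theorem CardLE.union {A B : Set Ordinal} {c : Cardinal} (hc : ℵ₀ ≤ c) (hA : CardLE A c)
    (hB : CardLE B c) : CardLE (A ∪ B) c :=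
  (mk_union_le A B).trans (add_le_of_le (aleph0_le_lift.2 hc) hA hB)

theorem CardLE.biUnion {I : Set Ordinal} {A : Ordinal → Set Ordinal} {c : Cardinal}
    (hc : ℵ₀ ≤ c) (hI : CardLE I c) (hA : ∀ x ∈ I, CardLE (A x) c) :
    CardLE (⋃ x ∈ I, A x) c := by
  refine (mk_biUnion_le A I).trans ?_
  have h : ⨆ x : I, #↥(A x.1) ≤ Cardinal.lift.{1, 0} c := ciSup_le' fun x => hA x.1 x.2
  refine (mul_le_mul' hI h).trans ?_
  rw [mul_eq_self (aleph0_le_lift.2 hc)]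

theorem CardLE.iUnion_nat {A : ℕ → Set Ordinal} {c : Cardinal}
    (hc : ℵ₀ ≤ c) (hA : ∀ n, CardLE (A n) c) : CardLE (⋃ n, A n) c := by
  have h := mk_iUnion_le_lift A
  simp only [Cardinal.lift_uzero, mk_nat, lift_aleph0] at h
  have h' : ⨆ n, #↥(A n) ≤ Cardinal.lift.{1, 0} c := ciSup_le' fun n => hA n
  refine h.trans ((mul_le_mul' (aleph0_le_lift.2 hc) h').trans ?_)
  rw [mul_eq_self (aleph0_le_lift.2 hc)]

theorem exists_bound {A : Set Ordinal} {o : Ordinal} (hA : CardLT A o.cof)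
    (h : ∀ x ∈ A, x < o) : ∃ b < o, ∀ x ∈ A, x < b := by
  refine ⟨sSup ((· + 1) '' A), ?_, fun x hx => ?_⟩
  · apply Ordinal.sSup_add_one_lt_of_lt_cof _ h
    rw [← Ordinal.lift_cof]
    exact hA
  · have hb : BddAbove ((· + 1) '' A) := by
      refine ⟨o, ?_⟩
      rintro _ ⟨y, hy, rfl⟩
      exact Order.add_one_le_of_lt (h y hy)
    exact lt_of_lt_of_le (Order.lt_add_one_iff.2 le_rfl) (le_csSup hb ⟨x, hx, rfl⟩)

theorem exists_bound_of_forall {I : Set Ordinal} {o : Ordinal} {P : Ordinal → Ordinal → Prop}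
    (hI : CardLT I o.cof) (hmono : ∀ x ∈ I, ∀ b b', b ≤ b' → b' < o → P x b → P x b')
    (h : ∀ x ∈ I, ∃ b < o, P x b) : ∃ b < o, ∀ x ∈ I, P x b := by
  choose! f hf using h
  obtain ⟨b, hb, hfb⟩ := exists_bound (A := f '' I) (cardLT_image hI f)
    (by rintro _ ⟨x, hx, rfl⟩; exact (hf x hx).1)
  exact ⟨b, hb, fun x hx => hmono x hx _ _ (hfb _ ⟨x, hx, rfl⟩).le hb (hf x hx).2⟩

theorem exists_cofinal (o : Ordinal) :
    ∃ c ⊆ Iio o, CardLE c o.cof ∧ ∀ x < o, ∃ y ∈ c, x ≤ y := by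
  obtain ⟨s, hs, hs'⟩ := Order.exists_cof_eq (Iio o)
  refine ⟨Subtype.val '' s, by rintro _ ⟨x, _, rfl⟩; exact x.2, ?_, fun x hx => ?_⟩
  · have : #↥(Subtype.val '' s) ≤ #s := mk_image_le
    rw [CardLE, Ordinal.lift_cof, ← Ordinal.cof_Iio, ← hs']
    exact this
  · obtain ⟨y, hy, hxy⟩ := hs ⟨x, hx⟩
    exact ⟨y, ⟨y, hy, rfl⟩, hxy⟩

theorem cof_le_of_cofinal {A : Set Ordinal} {o : Ordinal} {c : Cardinal} (hA : CardLE A c)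
    (hAo : A ⊆ Iio o) (h : ∀ x < o, ∃ y ∈ A, x ≤ y) : o.cof ≤ c := by
  by_contra! hc
  obtain ⟨b, hb, hb'⟩ := exists_bound (hA.lt hc) hAo
  obtain ⟨y, hy, hby⟩ := h b hb
  exact absurd (hb' y hy) hby.not_gt

theorem add_one_lt_of_cof {o x : Ordinal} (ho : ℵ₀ ≤ o.cof) (h : x < o) : x + 1 < o :=
  (Ordinal.one_lt_cof_iff.1 (Ordinal.aleph0_le_cof_iff.1 ho)).add_one_lt h

/-! ### Closed unbounded sets -/

/-- `L` is a regular uncountable ordinal. -/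
structure RegUnc (L : Ordinal.{0}) : Prop where
  card_lt : ∀ o < L, o.card < L.cof
  aleph0_lt : ℵ₀ < L.cof

theorem regUnc_ord {l : Cardinal} (hl : l.IsRegular) (h : ℵ₀ < l) : RegUnc l.ord where
  card_lt o ho := by rw [hl.cof_ord]; exact lt_ord.1 ho
  aleph0_lt := by rwa [hl.cof_ord]

theorem RegUnc.succ_lt {L : Ordinal} (hL : RegUnc L) {x : Ordinal} (h : x < L) : x + 1 < L :=
  add_one_lt_of_cof hL.aleph0_lt.le h

theorem RegUnc.pos {L : Ordinal} (hL : RegUnc L) : 0 < L :=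
  Ordinal.cof_pos.1 (aleph0_pos.trans hL.aleph0_lt)

theorem RegUnc.bound_Iio {L : Ordinal} (hL : RegUnc L) {G : Ordinal → Ordinal} {z : Ordinal}
    (hz : z < L) (hG : ∀ x < z, G x < L) : ∃ b < L, ∀ x < z, G x < b := by
  obtain ⟨b, hb, h⟩ := exists_bound (o := L) (A := G '' Iio z)
    (cardLT_image (cardLT_Iio.2 (hL.card_lt z hz)) G)
    (by rintro _ ⟨x, hx, rfl⟩; exact hG x hx)
  exact ⟨b, hb, fun x hx => h _ ⟨x, hx, rfl⟩⟩

/-- The set of nonzero closure points of `G` below `L`. -/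
def closurePts (G : Ordinal.{0} → Ordinal.{0}) (L : Ordinal.{0}) : Set Ordinal.{0} :=
  {δ | δ < L ∧ 0 < δ ∧ ∀ x < δ, G x < δ}

theorem isClubIn_closurePts {L : Ordinal} (hL : RegUnc L) {G : Ordinal → Ordinal}
    (hG : ∀ x < L, G x < L) : IsClubIn (closurePts G L) L := by
  refine ⟨fun δ h => h.1, ?_, ?_⟩
  · intro δ hδ h0 h
    refine ⟨hδ, h0, fun x hx => ?_⟩
    obtain ⟨y, hy, hxy, hyδ⟩ := h x hx
    exact (hy.2.2 x hxy).trans hyδ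
  · intro x hx
    have hstep : ∀ z < L, ∃ b < L, z < b ∧ ∀ y < z, G y < b := by
      intro z hz
      obtain ⟨b, hb, h⟩ := hL.bound_Iio hz fun y hy => hG y (hy.trans hz)
      exact ⟨max b (z + 1), max_lt hb (hL.succ_lt hz), lt_max_of_lt_right (Order.lt_add_one_iff.2 le_rfl),
        fun y hy => lt_max_of_lt_left (h y hy)⟩
    choose! s hs using hstep
    have hlt : ∀ n : ℕ, s^[n] x < L := by
      intro n
      induction n with
      | zero => exact hx
      | succ n ih => rw [Function.iterate_succ_apply']; exact (hs _ ih).1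
    have hsucc : ∀ n : ℕ, s^[n + 1] x = s (s^[n] x) := fun n => Function.iterate_succ_apply' ..
    have hle : ∀ n : ℕ, s^[n] x ≤ ⨆ n : ℕ, s^[n] x := fun n => Ordinal.le_iSup _ n
    have h0 : x < ⨆ n : ℕ, s^[n] x :=
      ((hs x hx).2.1).trans_le (hle 1)
    refine ⟨⨆ n : ℕ, s^[n] x, ⟨?_, zero_le.trans_lt h0, ?_⟩, h0.le, ?_⟩
    · exact Ordinal.iSup_lt_of_lt_cof (by rw [mk_nat]; exact hL.aleph0_lt) hlt
    · intro y hy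
      obtain ⟨n, hn⟩ := Ordinal.lt_iSup_iff.1 hy
      refine lt_of_lt_of_le ((hs _ (hlt n)).2.2 y hn) ?_
      rw [← hsucc]
      exact hle _
    · exact Ordinal.iSup_lt_of_lt_cof (by rw [mk_nat]; exact hL.aleph0_lt) hlt

theorem _root_.IsClubIn.exists_gt {L : Ordinal} (hL : RegUnc L) {C : Set Ordinal} (hC : IsClubIn C L)
    {x : Ordinal} (hx : x < L) : ∃ y ∈ C, x < y ∧ y < L := by
  obtain ⟨y, hy, hxy, hyL⟩ := hC.2.2 _ (hL.succ_lt hx)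
  exact ⟨y, hy, Order.add_one_le_iff.1 hxy, hyL⟩

theorem exists_diagonal_club {L : Ordinal} (hL : RegUnc L) {I : Set Ordinal}
    (hI : CardLT I L.cof) {C : Ordinal → Ordinal → Set Ordinal}
    (hC : ∀ i ∈ I, ∀ y < L, IsClubIn (C i y) L) :
    ∃ E, IsClubIn E L ∧ ∀ δ ∈ E, 0 < δ ∧ ∀ i ∈ I, ∀ y < δ, δ ∈ C i y := by
  have h1 : ∀ x < L, ∃ b < L, ∀ i ∈ I, ∀ y < x + 1, ∃ z ∈ C i y, x < z ∧ z < b := by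
    intro x hx
    refine exists_bound_of_forall
      (P := fun i b => ∀ y < x + 1, ∃ z ∈ C i y, x < z ∧ z < b) hI ?_ ?_
    · intro i hi b b' hbb' _ h y hy
      obtain ⟨z, hz, hxz, hzb⟩ := h y hy
      exact ⟨z, hz, hxz, hzb.trans_le hbb'⟩
    · intro i hi
      have := fun y (hy : y < x + 1) => (hC i hi y (hy.trans (hL.succ_lt hx))).exists_gt hL hx
      choose! g hg using this
      obtain ⟨b, hb, h⟩ := hL.bound_Iio (hL.succ_lt hx) fun y hy => (hg y hy).2.2
      exact ⟨b, hb, fun y hy => ⟨g y, (hg y hy).1, (hg y hy).2.1, h y hy⟩⟩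
  choose! G hG using h1
  refine ⟨closurePts G L, isClubIn_closurePts hL fun x hx => (hG x hx).1, ?_⟩
  rintro δ ⟨hδ, h0, hcl⟩
  refine ⟨h0, fun i hi y hy => (hC i hi y (hy.trans hδ)).2.1 δ hδ h0 fun x hx => ?_⟩
  have hm : max x y < δ := max_lt hx hy
  obtain ⟨z, hz, hxz, hzb⟩ := (hG _ (hm.trans hδ)).2 i hi y
    (Order.lt_add_one_iff.2 (le_max_right _ _))
  exact ⟨z, hz, (le_max_left _ _).trans_lt hxz, hzb.trans (hcl _ hm)⟩

theorem isClubIn_biInter {L : Ordinal} (hL : RegUnc L) {I : Set Ordinal}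
    (hI : CardLT I L.cof) {C : Ordinal → Set Ordinal}
    (hC : ∀ i ∈ I, IsClubIn (C i) L) :
    IsClubIn {δ | δ < L ∧ ∀ i ∈ I, δ ∈ C i} L := by
  obtain ⟨E, hE, h⟩ := exists_diagonal_club hL hI (C := fun i _ => C i) fun i hi _ _ => hC i hi
  refine ⟨fun δ h => h.1, ?_, ?_⟩
  · intro δ hδ h0 hx
    refine ⟨hδ, fun i hi => (hC i hi).2.1 δ hδ h0 fun x hxδ => ?_⟩
    obtain ⟨y, hy, hxy⟩ := hx x hxδ
    exact ⟨y, hy.2 i hi, hxy⟩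
  · intro x hx
    obtain ⟨y, hy, hxy, hyL⟩ := hE.2.2 x hx
    exact ⟨y, ⟨hyL, fun i hi => (h y hy).2 i hi 0 (h y hy).1⟩, hxy, hyL⟩

theorem _root_.IsClubIn.inter {L : Ordinal} (hL : RegUnc L) {C D : Set Ordinal}
    (hC : IsClubIn C L) (hD : IsClubIn D L) : IsClubIn (C ∩ D) L := by
  have hI : CardLT ({0, 1} : Set Ordinal) L.cof :=
    (lt_aleph0_of_finite _).trans (aleph0_lt_lift.2 hL.aleph0_lt)
  convert isClubIn_biInter hL hI (C := fun i => if i = 0 then C else D) ?_ using 1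
  · ext δ
    simp only [mem_inter_iff, mem_insert_iff, mem_singleton_iff, forall_eq_or_imp, forall_eq,
      if_true, one_ne_zero, if_false, mem_ofPred_eq]
    exact ⟨fun h => ⟨hC.1 h.1, h⟩, fun h => h.2⟩
  · intro i _
    split_ifs
    exacts [hC, hD]

theorem _root_.IsClubIn.insert_zero {L : Ordinal} (hL : RegUnc L) {C : Set Ordinal}
    (hC : IsClubIn C L) : IsClubIn (insert 0 C) L := by
  refine ⟨insert_subset hL.pos hC.1, ?_, ?_⟩
  · intro δ hδ h0 h
    refine Or.inr (hC.2.1 δ hδ h0 fun x hx => ?_)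
    obtain ⟨y, hy, hxy, hyδ⟩ := h x hx
    rcases hy with rfl | hy
    · exact absurd hxy (not_lt.2 zero_le)
    · exact ⟨y, hy, hxy, hyδ⟩
  · intro x hx
    obtain ⟨y, hy, h⟩ := hC.2.2 x hx
    exact ⟨y, Or.inr hy, h⟩

theorem isClubIn_Ioo {L : Ordinal} (hL : RegUnc L) {b : Ordinal} (hb : b < L) :
    IsClubIn (Ioo b L) L := by
  refine ⟨fun x h => h.2, ?_, ?_⟩
  · intro δ hδ h0 h
    obtain ⟨y, hy, -, hyδ⟩ := h 0 h0
    exact ⟨hy.1.trans hyδ, hδ⟩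
  · intro x hx
    have : max x (b + 1) < L := max_lt hx (hL.succ_lt hb)
    exact ⟨_, ⟨lt_max_of_lt_right (Order.lt_add_one_iff.2 le_rfl), this⟩, le_max_left _ _, this⟩

theorem _root_.IsStatIn.inter_club {L : Ordinal} (hL : RegUnc L) {S C : Set Ordinal}
    (hS : IsStatIn S L) (hC : IsClubIn C L) : IsStatIn (S ∩ C) L := by
  refine ⟨fun x h => hS.1 h.1, fun D hD => ?_⟩
  rw [inter_assoc]
  exact hS.2 _ (hC.inter hL hD)

/-! ### Transfinite recursion -/

theorem exists_rec {X : Type*} [Nonempty X] (R : Ordinal.{0} → (Ordinal.{0} → X) → X → Prop)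
    (τ : Ordinal.{0})
    (hcongr : ∀ i a a' y, (∀ j < i, a j = a' j) → R i a y → R i a' y)
    (hstep : ∀ i < τ, ∀ a, (∀ j < i, R j a (a j)) → ∃ y, R i a y) :
    ∃ a : Ordinal.{0} → X, ∀ i < τ, R i a (a i) := by
  classical
  obtain ⟨x0⟩ := ‹Nonempty X›
  let F : (i : Ordinal.{0}) → ((j : Ordinal.{0}) → j < i → X) → X := fun i r =>
    Classical.epsilon (h := ⟨x0⟩) fun y => R i (fun j => if h : j < i then r j h else x0) y
  let a : Ordinal.{0} → X := WellFounded.fix Ordinal.lt_wf F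
  have ha : ∀ i, a i = F i fun j _ => a j := fun i => WellFounded.fix_eq _ _ _
  refine ⟨a, fun i => ?_⟩
  induction i using WellFoundedLT.induction with
  | ind i ih =>
    intro hi
    obtain ⟨y, hy⟩ := hstep i hi a fun j hj => ih j hj (hj.trans hi)
    have h1 : ∀ j < i, a j = (fun j => if h : j < i then a j else x0) j := by
      intro j hj; simp [hj]
    have h2 : ∃ y, R i (fun j => if h : j < i then a j else x0) y := ⟨y, hcongr i _ _ y h1 hy⟩
    have h3 := Classical.epsilon_spec h2
    rw [ha]
    exact hcongr i _ _ _ (fun j hj => (h1 j hj).symm) h3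

theorem _root_.IsClubIn.exists_mem_cof {L : Ordinal} (hL : RegUnc L) {E : Set Ordinal}
    (hE : IsClubIn E L) {χ : Cardinal} (hχ : χ.IsRegular) (hχL : χ < L.cof) {x : Ordinal}
    (hx : x < L) : ∃ δ ∈ E, x < δ ∧ δ.cof = χ := by
  obtain ⟨a, ha⟩ := exists_rec
    (fun i (a : Ordinal → Ordinal) y => y ∈ E ∧ x < y ∧ ∀ j < i, a j < y) χ.ord
    (by
      rintro i a a' y h ⟨h1, h2, h3⟩
      exact ⟨h1, h2, fun j hj => h j hj ▸ h3 j hj⟩)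
    (by
      intro i hi a h
      obtain ⟨b, hb, hb'⟩ := exists_bound (o := L) (A := a '' Iio i)
        (cardLT_image (cardLT_Iio.2 ((lt_ord.1 hi).trans hχL)) a)
        (by rintro _ ⟨j, hj, rfl⟩; exact hE.1 (h j hj).1)
      obtain ⟨y, hy, hby, -⟩ := hE.exists_gt hL (max_lt hb hx)
      refine ⟨y, hy, (le_max_right _ _).trans_lt hby, fun j hj => ?_⟩
      exact (hb' _ ⟨j, hj, rfl⟩).trans ((le_max_left _ _).trans_lt hby))
  have hlim : Order.IsSuccLimit χ.ord := isSuccLimit_ord hχ.aleph0_le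
  have hmono : StrictMono fun i : Iio χ.ord => a i := fun i j hij => (ha j j.2).2.2 i hij
  have hle : ∀ i : Iio χ.ord, a i ≤ ⨆ i : Iio χ.ord, a i := fun i => Ordinal.le_iSup _ i
  have hxδ : x < ⨆ i : Iio χ.ord, a i := (ha 0 hlim.bot_lt).2.1.trans_le (hle ⟨0, hlim.bot_lt⟩)
  have hδL : ⨆ i : Iio χ.ord, a i < L := by
    apply Ordinal.lift_iSup_lt_of_lt_cof
    · rw [Cardinal.mk_Iio_ordinal, ← Ordinal.lift_cof, card_ord]
      simpa using Cardinal.lift_lt.{0, 1}.2 hχL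
    · exact fun i => hE.1 (ha i i.2).1
  refine ⟨⨆ i : Iio χ.ord, a i, hE.2.1 _ hδL (zero_le.trans_lt hxδ) fun y hy => ?_, hxδ, ?_⟩
  · obtain ⟨i, hi⟩ := Ordinal.lt_iSup_iff.1 hy
    have hi1 : (i : Ordinal) + 1 < χ.ord := hlim.add_one_lt i.2
    exact ⟨a i, (ha i i.2).1, hi, (hmono (a := i) (b := ⟨i + 1, hi1⟩)
      (Subtype.mk_lt_mk.2 (Order.lt_add_one_iff.2 le_rfl))).trans_le (hle ⟨i + 1, hi1⟩)⟩
  · rw [Ordinal.cof_iSup_Iio hmono hlim.isSuccPrelimit, hχ.cof_ord]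

/-! ### Iterated shrinking of clubs -/

/-- The largest element of `E` that is at most `x`. -/
def flr (E : Set Ordinal.{0}) (x : Ordinal.{0}) : Ordinal.{0} := sSup (E ∩ Iic x)

theorem bddAbove_inter_Iic (E : Set Ordinal.{0}) (x : Ordinal) : BddAbove (E ∩ Iic x) :=
  ⟨x, fun _ h => h.2⟩

theorem flr_le (E : Set Ordinal.{0}) (x : Ordinal) : flr E x ≤ x :=
  csSup_le' fun _ h => h.2

theorem le_flr {E : Set Ordinal.{0}} {x y : Ordinal} (hy : y ∈ E) (h : y ≤ x) : y ≤ flr E x :=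
  le_csSup (bddAbove_inter_Iic E x) ⟨hy, h⟩

theorem flr_anti {E E' : Set Ordinal.{0}} (h : E' ⊆ E) (x : Ordinal) : flr E' x ≤ flr E x :=
  csSup_le' fun _ hy => le_flr (h hy.1) hy.2

theorem flr_mem {L : Ordinal} {E : Set Ordinal} (hE : IsClubIn E L) (h0 : (0 : Ordinal) ∈ E)
    {x : Ordinal} (hx : x < L) : flr E x ∈ E := by
  by_contra hne
  apply hne
  have hpos : 0 < flr E x := by
    rcases eq_or_ne (flr E x) 0 with h | h
    · rw [h] at hne; exact absurd h0 hne
    · exact pos_iff_ne_zero.2 h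
  refine hE.2.1 _ ((flr_le E x).trans_lt hx) hpos fun z hz => ?_
  obtain ⟨y, hy, hzy⟩ := exists_lt_of_lt_csSup (s := E ∩ Iic x) ⟨0, h0, mem_Iic.2 zero_le⟩ hz
  refine ⟨y, hy.1, hzy, lt_of_le_of_ne (le_flr hy.1 hy.2) ?_⟩
  rintro rfl
  exact hne hy.1

/-- A transfinite decreasing iteration of a shrinking operation on clubs, along which every value
of `flr` stabilizes. -/
theorem exists_stable_clubs {L : Ordinal} (hL : RegUnc L) {τ : Cardinal} (hτ : ℵ₀ ≤ τ)
    (hτL : τ < L.cof) (Q : Set Ordinal.{0} → Set Ordinal.{0} → Prop)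
    (hQ : ∀ E, IsClubIn E L → (0 : Ordinal) ∈ E →
      ∃ E' ⊆ E, IsClubIn E' L ∧ (0 : Ordinal) ∈ E' ∧ Q E E') :
    ∃ (E : Ordinal → Set Ordinal) (F : Set Ordinal), IsClubIn F L ∧ (0 : Ordinal) ∈ F ∧
      (∀ ε < τ.ord, IsClubIn (E ε) L ∧ (0 : Ordinal) ∈ E ε ∧ F ⊆ E ε ∧
        ∃ E', F ⊆ E' ∧ Q (E ε) E') ∧
      ∀ x < L, ∃ y ∈ F, y ≤ x ∧ (∀ z ∈ F, z ≤ x → z ≤ y) ∧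
        ∃ ε₀ < τ.ord, ∀ ε < τ.ord, ε₀ ≤ ε → flr (E ε) x = y := by
  obtain ⟨E, hE⟩ := exists_rec
    (fun ε (E : Ordinal → Set Ordinal) A => IsClubIn A L ∧ (0 : Ordinal) ∈ A ∧
      ∀ ε' < ε, ∃ E', A ⊆ E' ∧ E' ⊆ E ε' ∧ Q (E ε') E') τ.ord
    (by
      rintro i a a' y h ⟨h1, h2, h3⟩
      exact ⟨h1, h2, fun j hj => h j hj ▸ h3 j hj⟩)
    (by
      intro ε hε E ih
      have := fun ε' (h : ε' < ε) => hQ (E ε') (ih ε' h).1 (ih ε' h).2.1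
      choose! E' hE' using this
      refine ⟨{δ | δ < L ∧ ∀ i ∈ Iio ε, δ ∈ E' i}, ?_, ?_, ?_⟩
      · exact isClubIn_biInter hL (cardLT_Iio.2 ((lt_ord.1 hε).trans hτL))
          fun i hi => (hE' i hi).2.1
      · exact ⟨hL.pos, fun i hi => (hE' i hi).2.2.1⟩
      · exact fun i hi => ⟨E' i, fun δ hδ => hδ.2 i hi, (hE' i hi).1, (hE' i hi).2.2.2⟩)
  have hanti : ∀ ε < τ.ord, ∀ ε' < τ.ord, ε ≤ ε' → E ε' ⊆ E ε := by
    intro ε _ ε' hε' h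
    rcases h.eq_or_lt with rfl | h
    · exact subset_rfl
    · obtain ⟨E', h1, h2, -⟩ := (hE ε' hε').2.2 ε h
      exact h1.trans h2
  have hlim : Order.IsSuccLimit τ.ord := isSuccLimit_ord hτ
  refine ⟨E, {δ | δ < L ∧ ∀ i ∈ Iio τ.ord, δ ∈ E i}, ?_, ?_, ?_, ?_⟩
  · exact isClubIn_biInter hL (cardLT_Iio.2 (by rwa [card_ord])) fun i hi => (hE i hi).1
  · exact ⟨hL.pos, fun i hi => (hE i hi).2.1⟩
  · intro ε hε
    have hε1 : ε + 1 < τ.ord := hlim.add_one_lt hε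
    obtain ⟨E', h1, h2, h3⟩ := (hE _ hε1).2.2 ε (Order.lt_add_one_iff.2 le_rfl)
    exact ⟨(hE ε hε).1, (hE ε hε).2.1, fun δ h => h.2 ε hε, E', fun δ h => h1 (h.2 _ hε1), h3⟩
  · intro x hx
    let V : Set Ordinal := (fun ε => flr (E ε) x) '' Iio τ.ord
    have hV : V.Nonempty := ⟨_, 0, hlim.bot_lt, rfl⟩
    obtain ⟨ε₀, hε₀, h⟩ := csInf_mem hV
    have hst : ∀ ε < τ.ord, ε₀ ≤ ε → flr (E ε) x = sInf V := by
      intro ε hε hle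
      apply le_antisymm
      · rw [← h]; exact flr_anti (hanti _ hε₀ _ hε hle) x
      · exact csInf_le' ⟨ε, hε, rfl⟩
    refine ⟨sInf V, ⟨?_, ?_⟩, ?_, ?_, ε₀, hε₀, hst⟩
    · rw [← h]; exact (flr_le _ x).trans_lt hx
    · intro i hi
      have hm : max i ε₀ < τ.ord := max_lt hi hε₀
      rw [← hst _ hm (le_max_right _ _)]
      exact hanti i hi _ hm (le_max_left _ _) (flr_mem (hE _ hm).1 (hE _ hm).2.1 hx)
    · rw [← h]; exact flr_le _ x
    · intro z hz hzx
      rw [← h]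
      exact le_flr (hz.2 _ hε₀) hzx

theorem CardLE.exists_surj {A : Set Ordinal} {c : Cardinal} (hA : CardLE A c) :
    ∃ g : Ordinal → Ordinal, ∀ x ∈ A, ∃ i < c.ord, g i = x := by
  classical
  have h1 : #↥A ≤ #↥(Iio c.ord) := by
    rw [Cardinal.mk_Iio_ordinal, card_ord]
    exact hA
  obtain ⟨f⟩ := Cardinal.le_def _ _ |>.1 h1
  refine ⟨fun i => if h : ∃ x : A, (f x : Ordinal) = i then (h.choose : Ordinal) else 0,
    fun x hx => ⟨f ⟨x, hx⟩, (f ⟨x, hx⟩).2, ?_⟩⟩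
  have hex : ∃ y : A, (f y : Ordinal) = f ⟨x, hx⟩ := ⟨⟨x, hx⟩, rfl⟩
  dsimp only
  rw [dif_pos hex, f.injective (Subtype.ext hex.choose_spec)]

/-! ### Cardinals below a singular cardinal -/

/-- `ν` is a weakly increasing sequence of length `κ`, cofinal in the limit cardinal `mu`. -/
structure CofinalCards (mu κ : Cardinal.{0}) (ν : Ordinal.{0} → Cardinal.{0}) : Prop where
  regular : κ.IsRegular
  lt : κ < mu
  succ_lt : ∀ θ < mu, Order.succ θ < mu
  le : ∀ i < κ.ord, κ ≤ ν i
  lt_mu : ∀ i < κ.ord, ν i < mu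
  mono : ∀ i j, i ≤ j → j < κ.ord → ν i ≤ ν j
  cofinal : ∀ θ < mu, ∃ i < κ.ord, θ ≤ ν i

theorem exists_cofinalCards {mu : Cardinal.{0}} (hmu : ℵ₀ ≤ mu) (h : mu.ord.cof < mu) :
    ∃ ν, CofinalCards mu mu.ord.cof ν := by
  have hlim : Order.IsSuccLimit mu.ord := isSuccLimit_ord hmu
  have hreg : (mu.ord.cof).IsRegular := isRegular_cof hlim
  have hsucc : ∀ θ < mu, Order.succ θ < mu := by
    intro θ hθ
    refine lt_of_le_of_ne (Order.succ_le_of_lt hθ) ?_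
    rintro rfl
    rcases lt_or_ge θ ℵ₀ with h' | h'
    · exact absurd (hmu.trans_lt (isSuccLimit_aleph0.succ_lt h')) (lt_irrefl _)
    · rw [(isRegular_succ h').cof_ord] at h
      exact lt_irrefl _ h
  obtain ⟨c, hc, hcard, hcof⟩ := exists_cofinal mu.ord
  obtain ⟨g, hg⟩ := hcard.exists_surj
  let g' : Ordinal → Ordinal := fun i => if g i < mu.ord then g i else 0
  have hg'lt : ∀ i, g' i < mu.ord := by
    intro i
    dsimp only [g']
    split_ifs with h
    exacts [h, hlim.bot_lt]
  have hbd : ∀ i, BddAbove ((fun j => (g' j).card) '' Iic i) := fun i =>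
    ⟨mu, by rintro _ ⟨j, -, rfl⟩; exact (lt_ord.1 (hg'lt j)).le⟩
  refine ⟨fun i => max mu.ord.cof (sSup ((fun j => (g' j).card) '' Iic i)), hreg, h, hsucc,
    fun _ _ => le_max_left _ _, ?_, ?_, ?_⟩
  · intro i hi
    refine max_lt h ?_
    obtain ⟨b, hb, hb'⟩ := exists_bound (o := mu.ord) (A := g' '' Iic i)
      (by
        refine cardLT_image (cardLT_mono (cardLT_Iio (o := i + 1).2 ?_) ?_) g'
        · exact lt_ord.1 ((isSuccLimit_ord hreg.aleph0_le).add_one_lt hi)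
        · exact fun x hx => mem_Iio.2 (Order.lt_add_one_iff.2 hx))
      (by rintro _ ⟨j, -, rfl⟩; exact hg'lt j)
    refine lt_of_le_of_lt (csSup_le' ?_) (lt_ord.1 hb)
    rintro _ ⟨j, hj, rfl⟩
    exact Ordinal.card_le_card (hb' _ ⟨j, hj, rfl⟩).le
  · intro i j hij _
    exact max_le_max le_rfl (csSup_le_csSup (hbd j) ⟨_, i, mem_Iic.2 le_rfl, rfl⟩
      (image_mono (Iic_subset_Iic.2 hij)))
  · intro θ hθ
    obtain ⟨y, hy, hθy⟩ := hcof θ.ord (ord_lt_ord.2 hθ)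
    obtain ⟨i, hi, rfl⟩ := hg y hy
    refine ⟨i, hi, le_max_of_le_right (le_csSup_of_le (hbd i) ⟨i, mem_Iic.2 le_rfl, rfl⟩ ?_)⟩
    have : g' i = g i := if_pos (hc hy)
    dsimp only
    rw [this]
    exact ord_le.1 hθy

theorem cof_sucOrd {mu : Cardinal.{0}} (h : ℵ₀ ≤ mu) : (sucOrd mu).cof = Order.succ mu :=
  (isRegular_succ h).cof_ord

theorem card_lt_sucOrd {mu : Cardinal.{0}} {o : Ordinal} : o < sucOrd mu ↔ o.card ≤ mu := by
  rw [sucOrd, lt_ord, Order.lt_succ_iff]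

theorem regUnc_sucOrd {mu : Cardinal.{0}} (h : ℵ₀ ≤ mu) : RegUnc (sucOrd mu) :=
  regUnc_ord (isRegular_succ h) (h.trans_lt (Order.lt_succ mu))

section

variable {mu κ : Cardinal.{0}} {ν : Ordinal.{0} → Cardinal.{0}}

theorem CofinalCards.aleph0_le_mu (h : CofinalCards mu κ ν) : ℵ₀ ≤ mu :=
  h.regular.aleph0_le.trans h.lt.le

theorem CofinalCards.regUnc (h : CofinalCards mu κ ν) : RegUnc (sucOrd mu) :=
  regUnc_sucOrd h.aleph0_le_mu

theorem CofinalCards.cof (h : CofinalCards mu κ ν) : (sucOrd mu).cof = Order.succ mu :=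
  cof_sucOrd h.aleph0_le_mu

theorem CofinalCards.aleph0_le (h : CofinalCards mu κ ν) {i : Ordinal} (hi : i < κ.ord) :
    ℵ₀ ≤ ν i :=
  h.regular.aleph0_le.trans (h.le i hi)

theorem CofinalCards.isSuccLimit (h : CofinalCards mu κ ν) : Order.IsSuccLimit κ.ord :=
  isSuccLimit_ord h.regular.aleph0_le

theorem CofinalCards.cardLT_index (h : CofinalCards mu κ ν) :
    CardLT (Iio κ.ord) (sucOrd mu).cof := by
  rw [cardLT_Iio, card_ord, h.cof]
  exact h.lt.trans (Order.lt_succ mu)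

theorem CofinalCards.bound (h : CofinalCards mu κ ν) {A : Set Ordinal} (hA : CardLE A mu)
    (hAL : ∀ x ∈ A, x < sucOrd mu) : ∃ b < sucOrd mu, ∀ x ∈ A, x < b :=
  exists_bound (by rw [h.cof]; exact hA.lt (Order.lt_succ mu)) hAL

end

/-! ### Guessing clubs along descents -/

/-- A ladder system: `c ν` is a cofinal subset of `ν` of size at most `cof ν`. -/
structure IsLadder (c : Ordinal.{0} → Set Ordinal.{0}) : Prop where
  subset : ∀ ν, c ν ⊆ Iio ν
  cardLE : ∀ ν, CardLE (c ν) ν.cof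
  cofinal : ∀ ν, ∀ x < ν, ∃ y ∈ c ν, x ≤ y

theorem exists_isLadder : ∃ c, IsLadder c := by
  choose c h1 h2 h3 using exists_cofinal
  exact ⟨c, h1, h2, h3⟩

/-- The ordinals reached from `δ` by descending along a ladder system at points of cofinality at
most `θ`, rounding down to `E` at each step. -/
inductive Desc (c : Ordinal.{0} → Set Ordinal.{0}) (E : Set Ordinal.{0}) (θ : Cardinal.{0})
    (δ : Ordinal.{0}) : Ordinal.{0} → Prop
  | base : Desc c E θ δ δ
  | step {ν α : Ordinal.{0}} : Desc c E θ δ ν → ν.cof ≤ θ → α ∈ c ν → Desc c E θ δ (flr E α)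

theorem desc_le {c : Ordinal → Set Ordinal} (hc : IsLadder c) {E : Set Ordinal} {θ : Cardinal}
    {δ x : Ordinal} (h : Desc c E θ δ x) : x ≤ δ := by
  induction h with
  | base => exact le_rfl
  | step _ _ hα ih => exact (flr_le _ _).trans ((le_of_lt (hc.subset _ hα)).trans ih)

theorem cardLE_desc {c : Ordinal → Set Ordinal} (hc : IsLadder c) (E : Set Ordinal) {θ : Cardinal}
    (hθ : ℵ₀ ≤ θ) (δ : Ordinal) : CardLE {x | Desc c E θ δ x} θ := by
  let A : ℕ → Set Ordinal := fun n => n.rec {δ} fun _ B =>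
    ⋃ x ∈ {x ∈ B | x.cof ≤ θ}, flr E '' c x
  have hA : ∀ n, A (n + 1) = ⋃ x ∈ {x ∈ A n | x.cof ≤ θ}, flr E '' c x := fun n => rfl
  refine (CardLE.iUnion_nat hθ (A := A) fun n => ?_).mono fun x hx => ?_
  · induction n with
    | zero => exact cardLE_singleton δ hθ
    | succ n ih =>
      rw [hA]
      refine CardLE.biUnion hθ (ih.mono fun x hx => hx.1) fun x hx => ?_
      exact ((hc.cardLE x).trans hx.2).image _
  · rw [mem_iUnion]
    induction hx with
    | base => exact ⟨0, rfl⟩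
    | step _ h2 h3 ih =>
      obtain ⟨n, hn⟩ := ih
      refine ⟨n + 1, ?_⟩
      rw [hA]
      exact mem_biUnion ⟨hn, h2⟩ ⟨_, h3, rfl⟩

theorem exists_guessing_club {mu κ : Cardinal} {ν : Ordinal → Cardinal}
    (hν : CofinalCards mu κ ν) {c : Ordinal → Set Ordinal} (hc : IsLadder c) :
    ∃ E : Set Ordinal, ∀ E', IsClubIn E' (sucOrd mu) →
      ∃ δ < sucOrd mu, ∀ i < κ.ord, ∃ x ∈ E', Desc c E (ν i) δ x ∧ ν i < x.cof := by
  by_contra! hcon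
  have hL := hν.regUnc
  have hκ := hν.regular.aleph0_le
  have hτL : Order.succ κ < (sucOrd mu).cof := by
    rw [hν.cof]
    exact (hν.succ_lt κ hν.lt).trans (Order.lt_succ mu)
  obtain ⟨E, F, hF, hF0, hE, hst⟩ := exists_stable_clubs hL (τ := Order.succ κ)
    (hκ.trans (Order.le_succ κ)) hτL
    (fun E E' => ∀ δ < sucOrd mu, ∃ i < κ.ord, ∀ x ∈ E', Desc c E (ν i) δ x → x.cof ≤ ν i)
    (by
      intro E hE hE0
      obtain ⟨E', hE', h⟩ := hcon E
      refine ⟨insert 0 (E ∩ E'), insert_subset hE0 inter_subset_left,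
        (hE.inter hL hE').insert_zero hL, mem_insert _ _, fun δ hδ => ?_⟩
      obtain ⟨i, hi, h⟩ := h δ hδ
      refine ⟨i, hi, fun x hx hd => ?_⟩
      rcases hx with rfl | hx
      · simp
      · exact h x hx.2 hd)
  have hρ : ∀ i < κ.ord, ∃ ρ ∈ F, ρ.cof = Order.succ (ν i) := by
    intro i hi
    obtain ⟨ρ, h1, -, h2⟩ := hF.exists_mem_cof hL (χ := Order.succ (ν i))
      (isRegular_succ (hν.aleph0_le hi)) (by
        rw [hν.cof]
        exact (hν.succ_lt _ (hν.lt_mu i hi)).trans (Order.lt_succ mu)) hL.pos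
    exact ⟨ρ, h1, h2⟩
  choose! ρ hρF hρcof using hρ
  obtain ⟨b, hb, hρb⟩ := exists_bound (A := ρ '' Iio κ.ord) (cardLT_image hν.cardLT_index ρ)
    (by rintro _ ⟨i, hi, rfl⟩; exact hF.1 (hρF i hi))
  obtain ⟨δ, hδF, hbδ, hδ⟩ := hF.2.2 b hb
  have hdesc : ∀ i < κ.ord, ∀ x ∈ F, ρ i ≤ x →
      (∃ ε₀ < (Order.succ κ).ord, ∀ ε < (Order.succ κ).ord, ε₀ ≤ ε → Desc c (E ε) (ν i) δ x) →
      ∃ ε₀ < (Order.succ κ).ord, ∃ y ∈ F, ν i < y.cof ∧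
        ∀ ε < (Order.succ κ).ord, ε₀ ≤ ε → Desc c (E ε) (ν i) δ y := by
    intro i hi x
    induction x using WellFoundedLT.induction with
    | ind x ih =>
      rintro hxF hρx ⟨ε₀, hε₀, hx⟩
      rcases lt_or_ge (ν i) x.cof with h | h
      · exact ⟨ε₀, hε₀, x, hxF, h, hx⟩
      have hne : ρ i ≠ x := by
        rintro rfl
        rw [hρcof i hi] at h
        exact (Order.lt_succ (ν i)).not_ge h
      obtain ⟨α, hα, hρα⟩ := hc.cofinal x _ (lt_of_le_of_ne hρx hne)
      have hαx : α < x := hc.subset x hα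
      obtain ⟨y, hyF, hyα, hy, ε₁, hε₁, hstab⟩ := hst α (hαx.trans (hF.1 hxF))
      refine ih y (hyα.trans_lt hαx) hyF (hy _ (hρF i hi) hρα)
        ⟨max ε₀ ε₁, max_lt hε₀ hε₁, fun ε hε hle => ?_⟩
      rw [← hstab ε hε ((le_max_right _ _).trans hle)]
      exact .step (hx ε hε ((le_max_left _ _).trans hle)) h hα
  obtain ⟨ε, hε, hεd⟩ := exists_bound_of_forall (I := Iio κ.ord) (o := (Order.succ κ).ord)
    (P := fun i ε₀ => ∃ y ∈ F, ν i < y.cof ∧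
        ∀ ε < (Order.succ κ).ord, ε₀ ≤ ε → Desc c (E ε) (ν i) δ y)
    (by
      rw [cardLT_Iio, (isRegular_succ hκ).cof_ord, card_ord]
      exact Order.lt_succ κ)
    (by
      rintro i hi b b' hbb' _ ⟨y, h1, h2, h3⟩
      exact ⟨y, h1, h2, fun ε hε hle => h3 ε hε (hbb'.trans hle)⟩)
    (fun i hi => hdesc i hi δ hδF ((hρb _ ⟨i, hi, rfl⟩).le.trans hbδ)
      ⟨0, (isSuccLimit_ord (hκ.trans (Order.le_succ κ))).bot_lt, fun _ _ _ => .base⟩)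
  obtain ⟨-, -, -, E', hFE', hQ⟩ := hE ε hε
  obtain ⟨i, hi, hQi⟩ := hQ δ hδ
  obtain ⟨y, hyF, hcof, hy⟩ := hεd i hi
  exact (hQi y (hFE' hyF) (hy ε hε le_rfl)).not_gt hcof

/-! ### Families of disjoint small sets -/

/-- A family of pairwise disjoint subsets of `L`, each of cardinality less than `κ`. -/
structure DisjFam (t : Ordinal.{0} → Set Ordinal.{0}) (L : Ordinal.{0}) (κ : Cardinal.{0}) :
    Prop where
  subset : ∀ a < L, t a ⊆ Iio L
  disjoint : ∀ a b, a < L → b < L → a ≠ b → Disjoint (t a) (t b)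
  cardLT : ∀ a < L, CardLT (t a) κ

theorem DisjFam.eventually_above {t : Ordinal → Set Ordinal} {L : Ordinal} {κ : Cardinal}
    (ht : DisjFam t L κ) (hL : RegUnc L) {b : Ordinal} (hb : b < L) :
    ∃ b' < L, ∀ β < L, b' ≤ β → ∀ ζ ∈ t β, b < ζ := by
  classical
  obtain ⟨b', hb', h⟩ := hL.bound_Iio
    (G := fun x => if h : ∃ β < L, x ∈ t β then h.choose else 0) (hL.succ_lt hb)
    (by
      intro x _
      split_ifs with h
      exacts [h.choose_spec.1, hL.pos])
  refine ⟨b', hb', fun β hβ hle ζ hζ => ?_⟩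
  by_contra! hζb
  have h1 := h ζ (Order.lt_add_one_iff.2 hζb)
  have hex : ∃ β < L, ζ ∈ t β := ⟨β, hβ, hζ⟩
  rw [dif_pos hex] at h1
  have h2 : hex.choose = β := by
    by_contra hne
    exact disjoint_left.1 (ht.disjoint _ _ hex.choose_spec.1 hβ hne) hex.choose_spec.2 hζ
  exact (h2 ▸ h1).not_ge hle

/-! ### Filtrations of ordinals below the successor -/

/-- `Q ζ` is an increasing filtration of `ζ` by sets with `#(Q ζ i) ≤ ν i`. -/
structure IsFiltration (mu κ : Cardinal.{0}) (ν : Ordinal.{0} → Cardinal.{0})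
    (Q : Ordinal.{0} → Ordinal.{0} → Set Ordinal.{0}) : Prop where
  subset : ∀ ζ i, Q ζ i ⊆ Iio ζ
  cardLE : ∀ ζ, ∀ i, CardLE (Q ζ i) (ν i)
  mono : ∀ ζ i j, i ≤ j → j < κ.ord → Q ζ i ⊆ Q ζ j
  exists_mem : ∀ ζ < sucOrd mu, ∀ x < ζ, ∃ i < κ.ord, x ∈ Q ζ i

theorem exists_isFiltration {mu κ : Cardinal.{0}} {ν : Ordinal.{0} → Cardinal.{0}}
    (hν : CofinalCards mu κ ν) : ∃ Q, IsFiltration mu κ ν Q := by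
  have h : ∀ ζ < sucOrd mu, ∃ g : Ordinal → Ordinal, ∀ x < ζ, ∃ i < mu.ord, g i = x :=
    fun ζ hζ => (cardLE_Iio.2 (card_lt_sucOrd.1 hζ)).exists_surj
  choose! g hg using h
  refine ⟨fun ζ i => {x | x < ζ ∧ x ∈ g ζ '' Iio (ν i).ord}, fun ζ i x h => h.1, fun ζ i => ?_,
    ?_, ?_⟩
  · refine CardLE.mono ((cardLE_Iio (o := (ν i).ord).2 ?_).image (g ζ)) fun x h => h.2
    rw [card_ord]
  · rintro ζ i j hij hj x ⟨hx, y, hy, rfl⟩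
    exact ⟨hx, y, lt_of_lt_of_le hy (ord_le_ord.2 (hν.mono i j hij hj)), rfl⟩
  · intro ζ hζ x hx
    obtain ⟨y, hy, hyx⟩ := hg ζ hζ x hx
    obtain ⟨i, hi, hyi⟩ := hν.cofinal _ (hν.succ_lt _ (lt_ord.1 hy))
    exact ⟨i, hi, hx, y, lt_ord.2 ((Order.lt_succ _).trans_le hyi), hyx⟩

/-- A system of sets `P ζ i ⊆ ζ` such that for every disjoint family, stationarily many points
`x` are uniformly isolated from below in `P ζ i` for all `ζ` in cofinally many members. -/
theorem exists_isolating_system {mu κ : Cardinal.{0}} {ν : Ordinal.{0} → Cardinal.{0}}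
    (hν : CofinalCards mu κ ν) :
    ∃ P : Ordinal → Ordinal → Set Ordinal, (∀ ζ i, P ζ i ⊆ Iio ζ) ∧
      ∀ t, DisjFam t (sucOrd mu) κ → ∀ y₀ < sucOrd mu,
        ∃ i < κ.ord, ∃ y < sucOrd mu, ∃ S, IsStatIn S (sucOrd mu) ∧
          ∀ x ∈ S, y₀ < x ∧ y < x ∧ ∀ b < sucOrd mu, ∃ β < sucOrd mu, b < β ∧
            ∀ ζ ∈ t β, x ∈ P ζ i ∧ y₀ ∈ P ζ i ∧ ∀ z ∈ P ζ i, z < x → z < y := by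
  obtain ⟨Q, hQ⟩ := exists_isFiltration hν
  obtain ⟨c, hc⟩ := exists_isLadder
  obtain ⟨E, hE⟩ := exists_guessing_club hν hc
  have hL := hν.regUnc
  refine ⟨fun ζ i => ⋃ δ ∈ Q ζ i, {x | Desc c E (ν i) δ x}, ?_, ?_⟩
  · intro ζ i x hx
    obtain ⟨δ, hδ, hx⟩ := mem_iUnion₂.1 hx
    exact (desc_le hc hx).trans_lt (hQ.subset ζ i hδ)
  intro t ht y₀ hy₀
  by_contra! hcon
  let S : Ordinal → Ordinal → Set Ordinal := fun i y =>
    {x | x < sucOrd mu ∧ y₀ < x ∧ y < x ∧ ∀ b < sucOrd mu, ∃ β < sucOrd mu, b < β ∧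
      ∀ ζ ∈ t β, x ∈ (⋃ δ ∈ Q ζ i, {x | Desc c E (ν i) δ x}) ∧
        y₀ ∈ (⋃ δ ∈ Q ζ i, {x | Desc c E (ν i) δ x}) ∧
        ∀ z ∈ (⋃ δ ∈ Q ζ i, {x | Desc c E (ν i) δ x}), z < x → z < y}
  have hC : ∀ i ∈ Iio κ.ord, ∀ y < sucOrd mu, ∃ C, IsClubIn C (sucOrd mu) ∧ S i y ∩ C = ∅ := by
    intro i hi y hy
    by_contra! hS
    obtain ⟨x, hx, h⟩ := hcon i hi y hy (S i y)
      ⟨fun x hx => hx.1, fun C hC => hS C hC⟩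
    obtain ⟨b, hb, h⟩ := h hx.2.1 hx.2.2.1
    obtain ⟨β, hβ, hbβ, h'⟩ := hx.2.2.2 b hb
    obtain ⟨ζ, hζ, h⟩ := h β hβ hbβ
    obtain ⟨h1, h2, h3⟩ := h' ζ hζ
    obtain ⟨z, hz, hzx, hyz⟩ := h h1 h2
    exact (h3 z hz hzx).not_ge hyz
  choose! C hC hSC using hC
  obtain ⟨D, hD, hDC⟩ := exists_diagonal_club hL hν.cardLT_index hC
  obtain ⟨δ, hδ, hx⟩ := hE _ (hD.inter hL (isClubIn_Ioo hL hy₀))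
  choose! x hxD hdesc hcof using hx
  have hxL : ∀ i < κ.ord, x i < sucOrd mu := fun i hi => hD.1 (hxD i hi).1
  have hb : ∀ i < κ.ord, ∀ y < x i, ∃ b < sucOrd mu, ∀ β < sucOrd mu, b < β →
      ¬ ∀ ζ ∈ t β, x i ∈ (⋃ δ ∈ Q ζ i, {x | Desc c E (ν i) δ x}) ∧
        y₀ ∈ (⋃ δ ∈ Q ζ i, {x | Desc c E (ν i) δ x}) ∧
        ∀ z ∈ (⋃ δ ∈ Q ζ i, {x | Desc c E (ν i) δ x}), z < x i → z < y := by
    intro i hi y hy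
    have h1 : x i ∉ S i y := fun h =>
      eq_empty_iff_forall_notMem.1 (hSC i hi y (hy.trans (hxL i hi))) (x i)
        ⟨h, (hDC _ (hxD i hi).1).2 i hi y hy⟩
    by_contra! h2
    refine h1 ⟨hxL i hi, (hxD i hi).2.1, hy, fun b hb => ?_⟩
    obtain ⟨β, hβ, hbβ, h⟩ := h2 b hb
    exact ⟨β, hβ, hbβ, h⟩
  choose! b hb hbβ using hb
  obtain ⟨B, hB, hbB⟩ := hν.bound (A := ⋃ i ∈ Iio κ.ord, b i '' Iio (x i))
    (CardLE.biUnion hν.aleph0_le_mu (cardLE_Iio.2 (by rw [card_ord]; exact hν.lt.le))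
      fun i hi => (cardLE_Iio.2 (card_lt_sucOrd.1 (hxL i hi))).image _)
    (by
      intro z hz
      obtain ⟨i, hi, y, hy, rfl⟩ := mem_iUnion₂.1 hz
      exact hb i hi y hy)
  obtain ⟨b', hb', hbt⟩ := ht.eventually_above hL (max_lt hδ hy₀)
  have hβ : max B b' < sucOrd mu := max_lt hB hb'
  set β := max B b'
  have htβ := hbt β hβ (le_max_right _ _)
  obtain ⟨i, hi, hiζ⟩ := exists_bound_of_forall (I := t β) (o := κ.ord)
    (P := fun ζ i => δ ∈ Q ζ i ∧ y₀ ∈ Q ζ i)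
    (by rw [hν.regular.cof_ord]; exact ht.cardLT β hβ)
    (fun ζ _ i j hij hj h => ⟨hQ.mono ζ i j hij hj h.1, hQ.mono ζ i j hij hj h.2⟩)
    (by
      intro ζ hζ
      have hζL : ζ < sucOrd mu := ht.subset β hβ hζ
      obtain ⟨i, hi, h1⟩ := hQ.exists_mem ζ hζL δ ((le_max_left _ _).trans_lt (htβ ζ hζ))
      obtain ⟨j, hj, h2⟩ := hQ.exists_mem ζ hζL y₀ ((le_max_right _ _).trans_lt (htβ ζ hζ))
      exact ⟨max i j, max_lt hi hj, hQ.mono ζ _ _ (le_max_left _ _) (max_lt hi hj) h1,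
        hQ.mono ζ _ _ (le_max_right _ _) (max_lt hi hj) h2⟩)
  have hcard : CardLE (⋃ ζ ∈ t β, ⋃ δ ∈ Q ζ i, {x | Desc c E (ν i) δ x}) (ν i) :=
    CardLE.biUnion (hν.aleph0_le hi)
      (le_of_lt (cardLT_trans (ht.cardLT β hβ) (hν.le i hi)))
      fun ζ _ => CardLE.biUnion (hν.aleph0_le hi) (hQ.cardLE ζ i)
        fun δ _ => cardLE_desc hc E (hν.aleph0_le hi) δ
  obtain ⟨y, hy, hyz⟩ := exists_bound
    (A := (⋃ ζ ∈ t β, ⋃ δ ∈ Q ζ i, {x | Desc c E (ν i) δ x}) ∩ Iio (x i))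
    ((hcard.mono inter_subset_left).lt (hcof i hi)) fun z hz => hz.2
  refine hbβ i hi y hy β hβ ((hbB _ (mem_biUnion (x := i) hi ⟨y, hy, rfl⟩)).trans_le
    (le_max_left _ _)) fun ζ hζ => ⟨?_, ?_, fun z hz hzx => ?_⟩
  · exact mem_biUnion (hiζ ζ hζ).1 (hdesc i hi)
  · exact mem_biUnion (hiζ ζ hζ).2 .base
  · exact hyz z ⟨mem_biUnion hζ hz, hzx⟩

/-! ### Eventual statements along an ordinal -/

/-- `P i` holds for all sufficiently large `i < K`. -/
def Ev (K : Ordinal.{0}) (P : Ordinal.{0} → Prop) : Prop :=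
  ∃ i₀ < K, ∀ i < K, i₀ ≤ i → P i

theorem Ev.mono {K : Ordinal} {P Q : Ordinal → Prop} (h : Ev K P) (hPQ : ∀ i < K, P i → Q i) :
    Ev K Q := by
  obtain ⟨i₀, h₀, h⟩ := h
  exact ⟨i₀, h₀, fun i hi hle => hPQ i hi (h i hi hle)⟩

theorem Ev.and {K : Ordinal} {P Q : Ordinal → Prop} (hP : Ev K P) (hQ : Ev K Q) :
    Ev K fun i => P i ∧ Q i := by
  obtain ⟨i₀, h₀, h⟩ := hP
  obtain ⟨i₁, h₁, h'⟩ := hQ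
  exact ⟨max i₀ i₁, max_lt h₀ h₁, fun i hi hle =>
    ⟨h i hi ((le_max_left _ _).trans hle), h' i hi ((le_max_right _ _).trans hle)⟩⟩

theorem not_ev {K : Ordinal} {P : Ordinal → Prop} :
    ¬ Ev K P ↔ ∀ i₀ < K, ∃ i < K, i₀ ≤ i ∧ ¬ P i := by
  simp only [Ev]
  push Not
  rfl

theorem Ev.exists_of_not {K : Ordinal} {P Q : Ordinal → Prop} (hP : Ev K P) (hQ : ¬ Ev K Q) :
    ∃ i < K, P i ∧ ¬ Q i := by
  obtain ⟨i₀, h₀, h⟩ := hP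
  obtain ⟨i, hi, hle, hQ⟩ := not_ev.1 hQ i₀ h₀
  exact ⟨i, hi, h i hi hle, hQ⟩

theorem Ev.ball {K : Ordinal} {I : Set Ordinal} (hI : CardLT I K.cof)
    {P : Ordinal → Ordinal → Prop} (h : ∀ x ∈ I, Ev K (P x)) :
    Ev K fun i => ∀ x ∈ I, P x i := by
  obtain ⟨i₀, h₀, h⟩ := exists_bound_of_forall (P := fun x i₀ => ∀ i < K, i₀ ≤ i → P x i) hI
    (fun x _ b b' hbb' _ h i hi hle => h i hi (hbb'.trans hle)) h
  exact ⟨i₀, h₀, fun i hi hle x hx => h x hx i hi hle⟩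

theorem exists_cofinal_fiber {a : Ordinal} {A I : Set Ordinal} (hI : CardLT I a.cof)
    {F : Ordinal → Ordinal} (hA : ∀ x < a, ∃ y ∈ A, x < y) (hF : ∀ y ∈ A, F y ∈ I) :
    ∃ j ∈ I, ∀ x < a, ∃ y ∈ A, x < y ∧ F y = j := by
  by_contra! hcon
  obtain ⟨b, hb, h⟩ := exists_bound_of_forall (P := fun j x => ∀ y ∈ A, x < y → F y ≠ j) hI
    (fun j _ b b' hbb' _ h y hy hby => h y hy (hbb'.trans_lt hby)) hcon
  obtain ⟨y, hy, hby⟩ := hA b hb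
  exact h _ (hF y hy) y hy hby rfl

/-! ### Suprema of initial segments of sequences -/

/-- The least strict upper bound of `a j`, `j < i`. -/
def ssup (a : Ordinal.{0} → Ordinal.{0}) (i : Ordinal.{0}) : Ordinal.{0} :=
  sInf {x | ∀ j < i, a j < x}

theorem ssup_congr {a a' : Ordinal → Ordinal} {i : Ordinal} (h : ∀ j < i, a j = a' j) :
    ssup a i = ssup a' i := by
  have : {x | ∀ j < i, a j < x} = {x | ∀ j < i, a' j < x} := by
    ext x
    exact forall₂_congr fun j hj => by rw [h j hj]
  rw [ssup, this, ssup]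

theorem ssup_le {a : Ordinal → Ordinal} {i x : Ordinal} (h : ∀ j < i, a j < x) :
    ssup a i ≤ x :=
  csInf_le' h

theorem lt_ssup {a : Ordinal → Ordinal} {i j : Ordinal} (h : j < i) : a j < ssup a i := by
  have hne : {x | ∀ j < i, a j < x}.Nonempty := by
    refine ⟨sSup ((fun j => a j + 1) '' Iio i), fun j hj => ?_⟩
    have hb : BddAbove ((fun j => a j + 1) '' Iio i) := Ordinal.bddAbove_of_small
    exact (Order.lt_add_one_iff.2 le_rfl).trans_le (le_csSup hb ⟨j, hj, rfl⟩)
  exact csInf_mem hne j h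

theorem exists_le_of_lt_ssup {a : Ordinal → Ordinal} {i x : Ordinal} (h : x < ssup a i) :
    ∃ j < i, x ≤ a j := by
  by_contra! hc
  exact (ssup_le hc).not_gt h

theorem ssup_mono {a : Ordinal → Ordinal} {i j : Ordinal} (h : i ≤ j) : ssup a i ≤ ssup a j :=
  ssup_le fun _ hk => lt_ssup (hk.trans_le h)

theorem exists_small_club {δ : Ordinal.{0}} (hδ : Order.IsSuccLimit δ) :
    ∃ C, IsClubIn C δ ∧ CardLE C δ.cof := by
  have h0 : ℵ₀ ≤ δ.cof := Ordinal.aleph0_le_cof_iff.2 (Ordinal.one_lt_cof_iff.2 hδ)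
  obtain ⟨c, hc, hcard, hcof⟩ := exists_cofinal δ
  obtain ⟨g, hg⟩ := hcard.exists_surj
  have hbd : ∀ i < δ.cof.ord, ∀ a : Ordinal → Ordinal, (∀ j < i, a j < δ) →
      ∃ b < δ, ∀ j < i, a j < b := by
    intro i hi a h
    obtain ⟨b, hb, hb'⟩ := exists_bound (o := δ) (A := a '' Iio i)
      (cardLT_image (cardLT_Iio.2 (lt_ord.1 hi)) a) (by rintro _ ⟨j, hj, rfl⟩; exact h j hj)
    exact ⟨b, hb, fun j hj => hb' _ ⟨j, hj, rfl⟩⟩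
  obtain ⟨a, ha⟩ := exists_rec
    (fun i (a : Ordinal → Ordinal) y => y < δ ∧ (g i < δ → g i ≤ y) ∧ ∀ j < i, a j < y) δ.cof.ord
    (by
      rintro i a a' y h ⟨h1, h2, h3⟩
      exact ⟨h1, h2, fun j hj => h j hj ▸ h3 j hj⟩)
    (by
      intro i hi a h
      obtain ⟨b, hb, hb'⟩ := hbd i hi a fun j hj => (h j hj).1
      by_cases hgi : g i < δ
      · exact ⟨max b (g i), max_lt hb hgi, fun _ => le_max_right _ _,
          fun j hj => (hb' j hj).trans_le (le_max_left _ _)⟩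
      · exact ⟨b, hb, fun h => absurd h hgi, hb'⟩)
  have hs : ∀ i < δ.cof.ord, ssup a i < δ := by
    intro i hi
    obtain ⟨b, hb, hb'⟩ := hbd i hi a fun j hj => (ha j (hj.trans hi)).1
    exact (ssup_le hb').trans_lt hb
  have hunb : ∀ x < δ, ∃ i < δ.cof.ord, x < ssup a i := by
    intro x hx
    obtain ⟨y, hy, hxy⟩ := hcof x hx
    obtain ⟨i, hi, rfl⟩ := hg y hy
    exact ⟨i + 1, (isSuccLimit_ord h0).add_one_lt hi,
      (hxy.trans ((ha i hi).2.1 (hc hy))).trans_lt (lt_ssup (Order.lt_add_one_iff.2 le_rfl))⟩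
  refine ⟨ssup a '' Iio δ.cof.ord, ⟨?_, ?_, ?_⟩, ?_⟩
  · rintro _ ⟨i, hi, rfl⟩
    exact hs i hi
  · intro ε hε hε0 hacc
    have hne : {i | i < δ.cof.ord ∧ ε ≤ ssup a i}.Nonempty := by
      obtain ⟨i, hi, h⟩ := hunb ε hε
      exact ⟨i, hi, h.le⟩
    obtain ⟨hi, hεi⟩ := csInf_mem hne
    set i := sInf {i | i < δ.cof.ord ∧ ε ≤ ssup a i}
    have hlt : ∀ j < i, ssup a j < ε := by
      intro j hj
      by_contra! hcon
      exact notMem_of_lt_csInf' hj ⟨hj.trans hi, hcon⟩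
    refine ⟨i, hi, le_antisymm (ssup_le fun j hj => ?_) hεi⟩
    obtain ⟨_, ⟨j', hj', rfl⟩, h1, h2⟩ := hacc _ (hlt j hj)
    have hjj' : j < j' := by
      by_contra! hcon
      exact (ssup_mono hcon).not_gt h1
    exact (lt_ssup hjj').trans h2
  · intro x hx
    obtain ⟨i, hi, h⟩ := hunb x hx
    exact ⟨_, ⟨i, hi, rfl⟩, h.le, hs i hi⟩
  · exact (cardLE_Iio.2 (by rw [card_ord])).image _

/-! ### Increasing sequences of functions -/

/-- A sequence of functions on `κ` which is increasing modulo bounded sets, and uniformly so along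
clubs of points of small cofinality. -/
structure ClubIncreasing (mu κ : Cardinal.{0}) (f : Ordinal.{0} → Ordinal.{0} → Ordinal.{0}) :
    Prop where
  incr : ∀ β < sucOrd mu, ∀ α < β, Ev κ.ord fun k => f α k < f β k
  club : ∀ δ < sucOrd mu, Order.IsSuccLimit δ → δ.cof < mu →
    ∃ C, IsClubIn C δ ∧ Ev κ.ord fun k => ∀ α ∈ C, f α k < f δ k

theorem exists_clubIncreasing {mu κ : Cardinal.{0}} {ν : Ordinal.{0} → Cardinal.{0}}
    (hν : CofinalCards mu κ ν) :
    ∃ f, ClubIncreasing mu κ f ∧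
      ∀ α < sucOrd mu, ∀ k < κ.ord, f α k < (Order.succ (ν k)).ord := by
  obtain ⟨Q, hQ⟩ := exists_isFiltration hν
  have hcl := fun δ (hδ : Order.IsSuccLimit δ) => exists_small_club hδ
  choose! cl hcl hclcard using hcl
  let B : Ordinal → Ordinal → Set Ordinal := fun δ k =>
    Q δ k ∪ {α | α ∈ cl δ ∧ Order.IsSuccLimit δ ∧ δ.cof ≤ ν k}
  have hBsub : ∀ δ k, B δ k ⊆ Iio δ := by
    rintro δ k α (h | h)
    · exact hQ.subset δ k h
    · exact (hcl δ h.2.1).1 h.1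
  have hBcard : ∀ δ, ∀ k < κ.ord, CardLE (B δ k) (ν k) := by
    intro δ k hk
    refine (hQ.cardLE δ k).union (hν.aleph0_le hk) ?_
    by_cases h : Order.IsSuccLimit δ ∧ δ.cof ≤ ν k
    · exact ((hclcard δ h.1).trans h.2).mono fun α hα => hα.1
    · refine (cardLE_singleton 0 (hν.aleph0_le hk)).mono fun α hα => absurd hα.2 h
  obtain ⟨f, hf⟩ := exists_rec
    (fun δ (f : Ordinal → Ordinal → Ordinal) y => ∀ k < κ.ord, y k < (Order.succ (ν k)).ord ∧
      ∀ α ∈ B δ k, f α k < y k) (sucOrd mu)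
    (by
      intro δ f f' y h hy k hk
      refine ⟨(hy k hk).1, fun α hα => ?_⟩
      rw [← h α (hBsub δ k hα)]
      exact (hy k hk).2 α hα)
    (by
      intro δ hδ f ih
      have : ∀ k < κ.ord, ∃ y < (Order.succ (ν k)).ord, ∀ α ∈ B δ k, f α k < y := by
        intro k hk
        have hcof : (Order.succ (ν k)).ord.cof = Order.succ (ν k) :=
          (isRegular_succ (hν.aleph0_le hk)).cof_ord
        obtain ⟨b, hb, h⟩ := exists_bound (o := (Order.succ (ν k)).ord)
          (A := (fun α => f α k) '' B δ k)
          (by rw [hcof]; exact ((hBcard δ k hk).image _).lt (Order.lt_succ _))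
          (by rintro _ ⟨α, hα, rfl⟩; exact (ih α (hBsub δ k hα) k hk).1)
        exact ⟨b, hb, fun α hα => h _ ⟨α, hα, rfl⟩⟩
      choose! y hy using this
      exact ⟨y, hy⟩)
  refine ⟨f, ⟨?_, ?_⟩, fun α hα k hk => (hf α hα k hk).1⟩
  · intro β hβ α hα
    obtain ⟨i, hi, hmem⟩ := hQ.exists_mem β hβ α hα
    exact ⟨i, hi, fun k hk hle => (hf β hβ k hk).2 α (Or.inl (hQ.mono β i k hle hk hmem))⟩
  · intro δ hδ hlim hcof
    obtain ⟨i, hi, hle⟩ := hν.cofinal _ hcof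
    exact ⟨cl δ, hcl δ hlim, i, hi, fun k hk hik α hα =>
      (hf δ hδ k hk).2 α (Or.inr ⟨hα, hlim, hle.trans (hν.mono i k hik hk)⟩)⟩

theorem ClubIncreasing.ev_le {mu κ : Cardinal.{0}} {f : Ordinal.{0} → Ordinal.{0} → Ordinal.{0}}
    (hf : ClubIncreasing mu κ f) (hκ : 0 < κ.ord) {α β : Ordinal} (hβ : β < sucOrd mu)
    (h : α ≤ β) : Ev κ.ord fun k => f α k ≤ f β k := by
  rcases h.eq_or_lt with rfl | h
  · exact ⟨0, hκ, fun _ _ _ => le_rfl⟩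
  · exact (hf.incr β hβ α h).mono fun _ _ h => h.le

/-! ### Club guessing at small cofinalities -/

theorem exists_club_guessing {τ χ : Cardinal.{0}} (hτ : τ.IsRegular) (hχ : χ.IsRegular)
    (hτχ : Order.succ τ < χ) :
    ∃ C : Ordinal → Set Ordinal, ∀ D, IsClubIn D χ.ord → ∃ a < χ.ord, a.cof = τ ∧
      C a ⊆ Iio a ∧ C a ⊆ D ∧ ∀ x < a, ∃ y ∈ C a, x < y := by
  have hL : RegUnc χ.ord := regUnc_ord hχ (hτ.aleph0_le.trans_lt ((Order.lt_succ τ).trans hτχ))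
  have hτ' : ℵ₀ ≤ Order.succ τ := hτ.aleph0_le.trans (Order.le_succ τ)
  obtain ⟨c, hc⟩ := exists_isLadder
  suffices h : ∃ E, ∀ D, IsClubIn D χ.ord → ∃ a < χ.ord, a.cof = τ ∧
      flr E '' c a \ {0} ⊆ D ∧ ∀ x < a, ∃ y ∈ flr E '' c a \ {0}, x < y by
    obtain ⟨E, hE⟩ := h
    refine ⟨fun a => flr E '' c a \ {0}, fun D hD => ?_⟩
    obtain ⟨a, h1, h2, h3, h4⟩ := hE D hD
    refine ⟨a, h1, h2, ?_, h3, h4⟩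
    rintro _ ⟨⟨x, hx, rfl⟩, -⟩
    exact (flr_le _ _).trans_lt (hc.subset a hx)
  by_contra! hcon
  obtain ⟨E, F, hF, hF0, hE, hst⟩ := exists_stable_clubs hL hτ' (by rwa [hχ.cof_ord])
    (fun E E' => ∀ a < χ.ord, a.cof = τ → flr E '' c a ⊆ E' →
      ∃ x < a, ∀ y ∈ flr E '' c a \ {0}, y ≤ x)
    (by
      intro E hE hE0
      obtain ⟨D, hD, h⟩ := hcon E
      refine ⟨insert 0 (E ∩ D), insert_subset hE0 inter_subset_left,
        (hE.inter hL hD).insert_zero hL, mem_insert _ _, fun a ha hcof hsub => ?_⟩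
      refine h a ha hcof fun y hy => ?_
      rcases hsub hy.1 with h0 | hy'
      · exact absurd h0 hy.2
      · exact hy'.2)
  have hn := fun x (hx : x < χ.ord) => hF.exists_gt hL hx
  choose! n hnF hn hnL using hn
  obtain ⟨a, ⟨haL, ha0, han⟩, -, hcof⟩ :=
    (isClubIn_closurePts hL hnL).exists_mem_cof hL hτ
      (by rw [hχ.cof_ord]; exact (Order.lt_succ τ).trans hτχ) hL.pos
  obtain ⟨ε, hε, hεst⟩ := exists_bound_of_forall (I := c a) (o := (Order.succ τ).ord)
    (P := fun x ε₀ => ∀ ε < (Order.succ τ).ord, ε₀ ≤ ε → flr (E ε) x ∈ F)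
    (by
      rw [(isRegular_succ hτ.aleph0_le).cof_ord]
      exact (hc.cardLE a).lt (hcof ▸ Order.lt_succ τ))
    (fun x _ b b' hbb' _ h ε hε hle => h ε hε (hbb'.trans hle))
    (by
      intro x hx
      obtain ⟨y, hy, -, -, ε₀, hε₀, h⟩ := hst x ((hc.subset a hx).trans haL)
      exact ⟨ε₀, hε₀, fun ε hε hle => (h ε hε hle).symm ▸ hy⟩)
  obtain ⟨-, -, hFE, E', hFE', hQ⟩ := hE ε hε
  obtain ⟨x, hxa, hx⟩ := hQ a haL hcof (by
    rintro _ ⟨y, hy, rfl⟩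
    exact hFE' (hεst y hy ε hε le_rfl))
  have hxL := hxa.trans haL
  obtain ⟨y, hy, hny⟩ := hc.cofinal a (n x) (han x hxa)
  have h1 : x < flr (E ε) y := (hn x hxL).trans_le (le_flr (hFE (hnF x hxL)) hny)
  exact (hx _ ⟨⟨y, hy, rfl⟩, (zero_le.trans_lt h1).ne'⟩).not_gt h1

/-! ### Existence of a scale -/

/-- The least element of `S k` which is at least `f α k`. -/
def proj (f : Ordinal.{0} → Ordinal.{0} → Ordinal.{0}) (S : Ordinal.{0} → Set Ordinal.{0})
    (α k : Ordinal.{0}) : Ordinal.{0} :=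
  sInf (S k ∩ Ici (f α k))

theorem proj_mono {f : Ordinal → Ordinal → Ordinal} {S : Ordinal → Set Ordinal}
    {α β k : Ordinal} (hne : (S k ∩ Ici (f β k)).Nonempty) (h : f α k ≤ f β k) :
    proj f S α k ≤ proj f S β k :=
  csInf_le' ⟨(csInf_mem hne).1, h.trans (csInf_mem hne).2⟩

theorem ClubIncreasing.exists_forall_ev_le_proj {mu κ : Cardinal.{0}}
    {ν : Ordinal.{0} → Cardinal.{0}} (hν : CofinalCards mu κ ν)
    {f : Ordinal.{0} → Ordinal.{0} → Ordinal.{0}} (hf : ClubIncreasing mu κ f) {θ : Cardinal.{0}}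
    (hκθ : κ ≤ θ) (hθ : θ < mu) {S : Ordinal.{0} → Set Ordinal.{0}}
    (hS : ∀ k < κ.ord, CardLE (S k) θ)
    (hne : ∀ α < sucOrd mu, ∀ k < κ.ord, (S k ∩ Ici (f α k)).Nonempty) :
    ∃ α < sucOrd mu, ∀ β < sucOrd mu, Ev κ.ord fun k => f β k ≤ proj f S α k := by
  by_contra! hcon
  choose! b hbL hb using hcon
  have hκ0 : 0 < κ.ord := hν.isSuccLimit.bot_lt
  have hb' : ∀ α < sucOrd mu, ∀ β < sucOrd mu, b α ≤ β →
      ¬ Ev κ.ord fun k => f β k ≤ proj f S α k := fun α hα β hβ hle h =>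
    hb α hα (((hf.ev_le hκ0 hβ hle).and h).mono fun _ _ h => h.1.trans h.2)
  have hθ0 : ℵ₀ ≤ θ := hν.regular.aleph0_le.trans hκθ
  set τ := Order.succ θ
  have hτ : τ.IsRegular := isRegular_succ hθ0
  set χ := Order.succ (Order.succ τ)
  have hχ : χ.IsRegular := isRegular_succ (hτ.aleph0_le.trans (Order.le_succ τ))
  have hχmu : χ < mu := hν.succ_lt _ (hν.succ_lt _ (hν.succ_lt _ hθ))
  obtain ⟨C, hC⟩ := exists_club_guessing hτ hχ (Order.lt_succ _)
  let W : Set Ordinal → Ordinal → Ordinal → (Ordinal → Ordinal) → Prop := fun c i σ s =>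
    Ev κ.ord fun k => ∀ l ∈ c, l ≤ i → f (ssup s l) k ≤ f σ k
  have hWmono : ∀ c i s, ∀ σ, ∀ σ' < sucOrd mu, σ ≤ σ' → W c i σ s → W c i σ' s :=
    fun c i s σ σ' hσ' hle h => (h.and (hf.ev_le hκ0 hσ' hle)).mono
      fun _ _ h l hl hli => (h.1 l hl hli).trans h.2
  have hχcard : CardLE (Iio χ.ord) mu := cardLE_Iio.2 (by rw [card_ord]; exact hχmu.le)
  obtain ⟨s, hs⟩ := exists_rec
    (fun i (s : Ordinal → Ordinal) y => y < sucOrd mu ∧ (∀ j < i, s j < y ∧ b (s j) ≤ y) ∧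
      ∀ a < χ.ord, (∃ σ < sucOrd mu, W (C a) i σ s) → W (C a) i y s) χ.ord
    (by
      rintro i s s' y h ⟨h1, h2, h3⟩
      have hW : ∀ c σ, W c i σ s = W c i σ s' := by
        intro c σ
        have : ∀ l ≤ i, ssup s l = ssup s' l :=
          fun l hl => ssup_congr fun j hj => h j (hj.trans_le hl)
        simp only [W]
        congr 1
        ext k
        exact forall₂_congr fun l _ => forall_congr' fun hl => by rw [this l hl]
      refine ⟨h1, fun j hj => h j hj ▸ h2 j hj, fun a ha => ?_⟩
      simp only [← hW]
      exact h3 a ha)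
    (by
      intro i hi s ih
      have hicard : CardLE (Iio i) mu := hχcard.mono (Iio_subset_Iio hi.le)
      obtain ⟨y₁, hy₁, h₁⟩ := hν.bound (hicard.image s) (by
        rintro _ ⟨j, hj, rfl⟩
        exact (ih j hj).1)
      obtain ⟨y₂, hy₂, h₂⟩ := hν.bound (hicard.image fun j => b (s j)) (by
        rintro _ ⟨j, hj, rfl⟩
        exact hbL _ (ih j hj).1)
      have : ∀ a, ∃ σ < sucOrd mu, (∃ σ < sucOrd mu, W (C a) i σ s) → W (C a) i σ s := by
        intro a
        by_cases h : ∃ σ < sucOrd mu, W (C a) i σ s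
        · obtain ⟨σ, hσ, h⟩ := h
          exact ⟨σ, hσ, fun _ => h⟩
        · exact ⟨0, hν.regUnc.pos, fun h' => absurd h' h⟩
      choose σ hσ hW using this
      obtain ⟨y₃, hy₃, h₃⟩ := hν.bound (hχcard.image σ) (by
        rintro _ ⟨j, hj, rfl⟩
        exact hσ j)
      have hyL : max y₁ (max y₂ y₃) < sucOrd mu := max_lt hy₁ (max_lt hy₂ hy₃)
      refine ⟨max y₁ (max y₂ y₃), hyL, fun j hj => ⟨?_, ?_⟩, fun a ha h => ?_⟩
      · exact (h₁ _ ⟨j, hj, rfl⟩).trans_le (le_max_left _ _)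
      · exact (h₂ _ ⟨j, hj, rfl⟩).le.trans ((le_max_left _ _).trans (le_max_right _ _))
      · refine hWmono _ _ _ (σ a) _ hyL ?_ (hW a h)
        exact (h₃ _ ⟨a, ha, rfl⟩).le.trans ((le_max_right _ _).trans (le_max_right _ _)))
  have hlt : ∀ i < χ.ord, ∀ j < i, s j < s i := fun i hi j hj => ((hs i hi).2.1 j hj).1
  have hχlim := isSuccLimit_ord hχ.aleph0_le
  set δ := ssup s χ.ord
  have hsδ : ∀ i < χ.ord, s i < δ := fun i hi => lt_ssup hi
  have hδL : δ < sucOrd mu := by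
    obtain ⟨y, hy, h⟩ := hν.bound (hχcard.image s) (by
      rintro _ ⟨j, hj, rfl⟩
      exact (hs j hj).1)
    exact (ssup_le fun j hj => h _ ⟨j, hj, rfl⟩).trans_lt hy
  have hsucc : ∀ x < δ, ∃ j < χ.ord, x < s j := by
    intro x hx
    obtain ⟨j, hj, hxj⟩ := exists_le_of_lt_ssup hx
    have hj' := hχlim.add_one_lt hj
    exact ⟨j + 1, hj', hxj.trans_lt (hlt _ hj' j (Order.lt_add_one_iff.2 le_rfl))⟩
  have hδ0 : 0 < δ := zero_le.trans_lt (hsδ 0 hχlim.bot_lt)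
  have hδlim : Order.IsSuccLimit δ := by
    refine ⟨not_isMin_of_lt hδ0, ?_⟩
    refine Order.isSuccPrelimit_of_succ_lt fun x hx => ?_
    obtain ⟨j, hj, hxj⟩ := hsucc x hx
    exact (Order.succ_le_of_lt hxj).trans_lt (hsδ j hj)
  have hδcof : δ.cof < mu := by
    refine (cof_le_of_cofinal (A := s '' Iio χ.ord) (c := χ)
      ((cardLE_Iio.2 (by rw [card_ord])).image s) ?_ ?_).trans_lt hχmu
    · rintro _ ⟨j, hj, rfl⟩
      exact hsδ j hj
    · intro x hx
      obtain ⟨j, hj, h⟩ := exists_le_of_lt_ssup hx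
      exact ⟨_, ⟨j, hj, rfl⟩, h⟩
  obtain ⟨cδ, hcδ, hclub⟩ := hf.club δ hδL hδlim hδcof
  have hG : ∀ x < χ.ord, ∃ y < χ.ord, ∃ c ∈ cδ, s x < c ∧ c ≤ s y := by
    intro x hx
    obtain ⟨c, hc, hxc, hcδ'⟩ := hcδ.2.2 _ (hδlim.add_one_lt (hsδ x hx))
    obtain ⟨y, hy, h⟩ := exists_le_of_lt_ssup hcδ'
    exact ⟨y, hy, c, hc, (Order.lt_add_one_iff.2 le_rfl).trans_le hxc, h⟩
  choose! G hGχ hG using hG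
  have hχunc : RegUnc χ.ord := regUnc_ord hχ
    (hθ0.trans_lt ((Order.lt_succ θ).trans ((Order.lt_succ τ).trans (Order.lt_succ _))))
  have hmem : ∀ i ∈ closurePts G χ.ord, ssup s i ∈ cδ := by
    rintro i ⟨hi, hi0, hiG⟩
    refine hcδ.2.1 _ ((ssup_le fun j hj => hlt i hi j hj).trans_lt (hsδ i hi))
      (zero_le.trans_lt (lt_ssup hi0)) fun x hx => ?_
    obtain ⟨j, hj, hxj⟩ := exists_le_of_lt_ssup hx
    obtain ⟨c, hc, h1, h2⟩ := hG j (hj.trans hi)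
    exact ⟨c, hc, hxj.trans_lt h1, h2.trans_lt (lt_ssup (hiG j hj))⟩
  obtain ⟨a, haχ, hacof, hCa, hCG, hCun⟩ := hC _ (isClubIn_closurePts hχunc hGχ)
  have hWs : ∀ i ∈ C a, W (C a) i (s i) s := fun i hi =>
    (hs i ((hCa hi).trans haχ)).2.2 a haχ
      ⟨δ, hδL, hclub.mono fun k _ h l hl _ => (h _ (hmem l (hCG hl))).le⟩
  have hnext : ∀ i ∈ C a, ∃ n ∈ C a, i < n ∧ ∀ l ∈ C a, i < l → n ≤ l := by
    intro i hi
    obtain ⟨y, hy, hiy⟩ := hCun i (hCa hi)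
    have hne : (C a ∩ Ioi i).Nonempty := ⟨y, hy, hiy⟩
    exact ⟨_, (csInf_mem hne).1, (csInf_mem hne).2, fun l hl hil => csInf_le' ⟨hl, hil⟩⟩
  choose! n hnC hin hnle using hnext
  have hthr : ∀ i ∈ C a, Ev κ.ord fun k => (∀ l ∈ C a, l ≤ i → f (ssup s l) k ≤ f (s i) k) ∧
      f (s i) k ≤ f (ssup s (n i)) k := by
    intro i hi
    refine (hWs i hi).and (hf.ev_le hκ0 ?_ (lt_ssup (hin i hi)).le)
    exact ((ssup_mono ((hCa (hnC i hi)).trans haχ).le).trans_lt hδL)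
  choose! F hFκ hF using hthr
  have hacof' : κ < a.cof := by rw [hacof]; exact hκθ.trans_lt (Order.lt_succ θ)
  have hIκ : CardLT (Iio κ.ord) a.cof := cardLT_Iio.2 (by rwa [card_ord])
  obtain ⟨k₀, hk₀, hfib⟩ := exists_cofinal_fiber hIκ hCun hFκ
  set A := {y | y ∈ C a ∧ F y = k₀}
  have hAun : ∀ x < a, ∃ y ∈ A, x < y := fun x hx => by
    obtain ⟨y, hy, h1, h2⟩ := hfib x hx
    exact ⟨y, ⟨hy, h2⟩, h1⟩
  have hsL : ∀ y ∈ A, s y < sucOrd mu := fun y hy => (hs y ((hCa hy.1).trans haχ)).1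
  have hmono : ∀ y ∈ A, ∀ y' ∈ A, y ≤ y' → ∀ k < κ.ord, k₀ ≤ k → f (s y) k ≤ f (s y') k := by
    intro y hy y' hy' hle k hk hk0
    rcases hle.eq_or_lt with rfl | hlt'
    · exact le_rfl
    · exact (hF y hy.1 k hk (hy.2.trans_le hk0)).2.trans
        ((hF y' hy'.1 k hk (hy'.2.trans_le hk0)).1 _ (hnC y hy.1) (hnle y hy.1 y' hy'.1 hlt'))
  have hpm : ∀ y ∈ A, ∀ y' ∈ A, y ≤ y' → ∀ k < κ.ord, k₀ ≤ k →
      proj f S (s y) k ≤ proj f S (s y') k := fun y hy y' hy' hle k hk hk0 =>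
    proj_mono (hne _ (hsL y' hy') k hk) (hmono y hy y' hy' hle k hk hk0)
  obtain ⟨x, hxa, hx⟩ := exists_bound_of_forall (I := Iio κ.ord) (o := a)
    (P := fun k x => k₀ ≤ k → ∀ y ∈ A, ∀ y' ∈ A, x < y → x < y' →
      proj f S (s y) k = proj f S (s y') k) hIκ
    (fun k _ b b' hbb' _ h hk y hy y' hy' h1 h2 =>
      h hk y hy y' hy' (hbb'.trans_lt h1) (hbb'.trans_lt h2))
    (by
      intro k hk
      by_cases hk0 : k₀ ≤ k
      swap
      · exact ⟨0, pos_iff_ne_zero.2 (by rintro rfl; simp at hacof'),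
          fun h => absurd h hk0⟩
      obtain ⟨v, -, hv⟩ := exists_cofinal_fiber (F := fun y => proj f S (s y) k)
        (I := S k) ((hS k hk).lt (hacof ▸ Order.lt_succ θ)) hAun
        (fun y hy => (csInf_mem (hne _ (hsL y hy) k hk)).1)
      obtain ⟨y₀, hy₀, -, hv₀⟩ := hv 0 (pos_iff_ne_zero.2 (by rintro rfl; simp at hacof'))
      have hval : ∀ y ∈ A, y₀ < y → proj f S (s y) k = v := by
        intro y hy hlt'
        obtain ⟨y₁, hy₁, hyy₁, hv₁⟩ := hv y (hCa hy.1)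
        exact le_antisymm (hv₁ ▸ hpm y hy y₁ hy₁ hyy₁.le k hk hk0)
          (hv₀ ▸ hpm y₀ hy₀ y hy hlt'.le k hk hk0)
      exact ⟨y₀, hCa hy₀.1, fun _ y hy y' hy' h1 h2 => (hval y hy h1).trans (hval y' hy' h2).symm⟩)
  obtain ⟨y, hy, hxy⟩ := hAun x hxa
  obtain ⟨y', hy', hyy'⟩ := hAun y (hCa hy.1)
  refine hb' (s y) (hsL y hy) (s y') (hsL y' hy')
    ((hs y' ((hCa hy'.1).trans haχ)).2.1 y hyy').2 ⟨k₀, hk₀, fun k hk hk0 => ?_⟩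
  beta_reduce
  rw [hx k hk hk0 y hy y' hy' hxy (hxy.trans hyy')]
  exact (csInf_mem (hne _ (hsL y' hy') k hk)).2

theorem ClubIncreasing.exists_eub {mu κ : Cardinal.{0}} {ν : Ordinal.{0} → Cardinal.{0}}
    (hν : CofinalCards mu κ ν) {f : Ordinal.{0} → Ordinal.{0} → Ordinal.{0}}
    (hf : ClubIncreasing mu κ f)
    (hfν : ∀ α < sucOrd mu, ∀ k < κ.ord, f α k < (Order.succ (ν k)).ord) :
    ∃ g : Ordinal.{0} → Ordinal.{0}, (∀ k < κ.ord, g k ≤ (Order.succ (ν k)).ord) ∧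
      (∀ α < sucOrd mu, Ev κ.ord fun k => f α k < g k) ∧
      ∀ h : Ordinal.{0} → Ordinal.{0}, (Ev κ.ord fun k => h k < g k) →
        ∃ α < sucOrd mu, Ev κ.ord fun k => h k ≤ f α k := by
  by_contra! hcon
  have hκ0 : 0 < κ.ord := hν.isSuccLimit.bot_lt
  have hκ := hν.regular.aleph0_le
  let S : (Ordinal → Ordinal → Ordinal) → Ordinal → Ordinal → Set Ordinal := fun h ξ k =>
    {(Order.succ (ν k)).ord} ∪ (fun η => h η k) '' Iio ξ
  have hSne : ∀ h ξ, ∀ α < sucOrd mu, ∀ k < κ.ord, (S h ξ k ∩ Ici (f α k)).Nonempty :=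
    fun h ξ α hα k hk => ⟨_, Or.inl rfl, (hfν α hα k hk).le⟩
  set χ := (Order.succ κ).ord
  have hχcof : χ.cof = Order.succ κ := (isRegular_succ hκ).cof_ord
  obtain ⟨h, hh⟩ := exists_rec
    (fun ξ (h : Ordinal → Ordinal → Ordinal) y => ∃ α < sucOrd mu,
      (Ev κ.ord fun k => y k < proj f (S h ξ) α k) ∧
      ∀ β < sucOrd mu, ¬ Ev κ.ord fun k => y k ≤ f β k) χ
    (by
      intro ξ h h' y hhh'
      have : S h ξ = S h' ξ := by
        ext1 k
        simp only [S]
        congr 1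
        exact image_congr fun η hη => by rw [hhh' η hη]
      rw [this]
      exact id)
    (by
      intro ξ hξ h _
      obtain ⟨α, hα, hproj⟩ := hf.exists_forall_ev_le_proj hν le_rfl hν.lt (S := S h ξ)
        (fun k hk => (cardLE_singleton _ hκ).union hκ
          ((cardLE_Iio.2 (Order.lt_succ_iff.1 (lt_ord.1 hξ))).image _)) (hSne h ξ)
      obtain ⟨y, hy, hy'⟩ := hcon (proj f (S h ξ) α)
        (fun k hk => csInf_le' ⟨Or.inl rfl, (hfν α hα k hk).le⟩)
        (fun β hβ => by
          have hβ' := hν.regUnc.succ_lt hβ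
          exact ((hf.incr _ hβ' β (Order.lt_add_one_iff.2 le_rfl)).and (hproj _ hβ')).mono
            fun k _ h => h.1.trans_le h.2)
      exact ⟨y, α, hα, hy, hy'⟩)
  choose! α hα hlt hnle using hh
  obtain ⟨αs, hαs, hle⟩ := hν.bound (A := α '' Iio χ)
    ((cardLE_Iio.2 (by rw [card_ord]; exact Order.succ_le_of_lt hν.lt)).image α)
    (by rintro _ ⟨ξ, hξ, rfl⟩; exact hα ξ hξ)
  have hanti : ∀ ξ ξ', ξ ≤ ξ' → ∀ k < κ.ord, proj f (S h ξ') αs k ≤ proj f (S h ξ) αs k := by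
    intro ξ ξ' hξ k hk
    obtain ⟨h1, h2⟩ := csInf_mem (hSne h ξ αs hαs k hk)
    refine csInf_le' ⟨h1.imp id fun h1 => ?_, h2⟩
    exact image_mono (Iio_subset_Iio hξ) h1
  obtain ⟨ξ, hξ, hst⟩ := exists_bound_of_forall (I := Iio κ.ord) (o := χ)
    (P := fun k x => ∀ ξ, x ≤ ξ → ξ < χ → proj f (S h x) αs k ≤ proj f (S h ξ) αs k)
    (by rw [cardLT_Iio, card_ord, hχcof]; exact Order.lt_succ κ)
    (fun k hk b b' hbb' _ h ξ hξ hξ' => (hanti b b' hbb' k hk).trans (h ξ (hbb'.trans hξ) hξ'))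
    (by
      intro k hk
      have hχ0 : 0 < χ := (isSuccLimit_ord (hκ.trans (Order.le_succ κ))).bot_lt
      have hne : {v | ∃ ξ < χ, proj f (S h ξ) αs k = v}.Nonempty := ⟨_, 0, hχ0, rfl⟩
      obtain ⟨ξ, hξ, heq⟩ := csInf_mem hne
      refine ⟨ξ, hξ, fun ξ' _ hξ' => ?_⟩
      rw [heq]
      exact csInf_le' ⟨ξ', hξ', rfl⟩)
  have hξ' : ξ + 1 < χ := (isSuccLimit_ord (hκ.trans (Order.le_succ κ))).add_one_lt hξ
  obtain ⟨k, hk, ⟨h1, h2⟩, h3⟩ := ((hlt ξ hξ).and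
    (hf.ev_le hκ0 hαs (hle _ ⟨ξ, hξ, rfl⟩).le)).exists_of_not (hnle ξ hξ αs hαs)
  have h4 : proj f (S h (ξ + 1)) αs k ≤ h ξ k :=
    csInf_le' ⟨Or.inr ⟨ξ, mem_Iio.2 (Order.lt_add_one_iff.2 le_rfl), rfl⟩, (not_le.1 h3).le⟩
  have h5 := h1.trans_le (proj_mono (hSne h ξ αs hαs k hk) h2)
  exact ((hst k hk (ξ + 1) (Order.lt_add_one_iff.2 le_rfl).le hξ').trans h4).not_gt h5

theorem ClubIncreasing.ev_lt_cof {mu κ : Cardinal.{0}} {ν : Ordinal.{0} → Cardinal.{0}}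
    (hν : CofinalCards mu κ ν) {f : Ordinal.{0} → Ordinal.{0} → Ordinal.{0}}
    (hf : ClubIncreasing mu κ f)
    (hfν : ∀ α < sucOrd mu, ∀ k < κ.ord, f α k < (Order.succ (ν k)).ord)
    {g : Ordinal.{0} → Ordinal.{0}}
    (hfg : ∀ α < sucOrd mu, Ev κ.ord fun k => f α k < g k)
    (hg : ∀ h : Ordinal.{0} → Ordinal.{0}, (Ev κ.ord fun k => h k < g k) →
      ∃ α < sucOrd mu, Ev κ.ord fun k => h k ≤ f α k)
    {θ : Cardinal.{0}} (hκθ : κ ≤ θ) (hθ : θ < mu) : Ev κ.ord fun k => θ < (g k).cof := by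
  by_contra hcon
  have hθ0 : ℵ₀ ≤ θ := hν.regular.aleph0_le.trans hκθ
  choose c hc hccard hcof using exists_cofinal
  let S : Ordinal → Set Ordinal := fun k =>
    {(Order.succ (ν k)).ord} ∪ {x | x ∈ c (g k) ∧ (g k).cof ≤ θ}
  obtain ⟨α₀, hα₀, hproj⟩ := hf.exists_forall_ev_le_proj hν hκθ hθ (S := S)
    (fun k hk => (cardLE_singleton _ hθ0).union hθ0 (by
      by_cases h : (g k).cof ≤ θ
      · exact ((hccard (g k)).trans h).mono fun x hx => hx.1
      · exact (cardLE_singleton 0 hθ0).mono fun x hx => absurd hx.2 h))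
    (fun α hα k hk => ⟨_, Or.inl rfl, (hfν α hα k hk).le⟩)
  classical
  obtain ⟨α, hα, hle⟩ := hg (fun k => if proj f S α₀ k < g k then proj f S α₀ k else 0)
    ((hfg 0 hν.regUnc.pos).mono fun k _ h => by
      split_ifs with hif
      · exact hif
      · exact zero_le.trans_lt h)
  have hα' := hν.regUnc.succ_lt hα
  obtain ⟨k, hk, ⟨⟨h1, h2⟩, h3, h4⟩, h5⟩ := ((hle.and (hproj _ hα')).and
    ((hf.incr _ hα' α (Order.lt_add_one_iff.2 le_rfl)).and (hfg α₀ hα₀))).exists_of_not hcon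
  obtain ⟨y, hy, hle⟩ := hcof (g k) _ h4
  have hpy : proj f S α₀ k ≤ y := csInf_le' ⟨Or.inr ⟨hy, not_lt.1 h5⟩, hle⟩
  rw [if_pos (hpy.trans_lt (hc (g k) hy))] at h1
  exact (h2.trans h1).not_gt h3

/-- A scale of length `mu⁺` in a product of `κ` ordinals whose cofinalities increase strictly. -/
structure Scale (mu κ : Cardinal.{0}) (f : Ordinal.{0} → Ordinal.{0} → Ordinal.{0})
    (g : Ordinal.{0} → Ordinal.{0}) : Prop where
  lt : ∀ α < sucOrd mu, ∀ i < κ.ord, f α i < g i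
  incr : ∀ β < sucOrd mu, ∀ α < β, Ev κ.ord fun i => f α i < f β i
  cofinal : ∀ h : Ordinal.{0} → Ordinal.{0}, (∀ i < κ.ord, h i < g i) →
    ∃ α < sucOrd mu, Ev κ.ord fun i => h i ≤ f α i
  lt_cof : ∀ i < κ.ord, κ < (g i).cof
  cof_le : ∀ i < κ.ord, (g i).cof ≤ mu
  cof_strictMono : ∀ i < κ.ord, ∀ j < i, (g j).cof < (g i).cof

theorem exists_strictMono_cof {mu κ : Cardinal.{0}} {ν : Ordinal.{0} → Cardinal.{0}}
    (hν : CofinalCards mu κ ν) {g : Ordinal.{0} → Ordinal.{0}}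
    (hgmu : ∀ k < κ.ord, (g k).cof < mu)
    (hg : ∀ θ, κ ≤ θ → θ < mu → Ev κ.ord fun k => θ < (g k).cof) :
    ∃ p : Ordinal.{0} → Ordinal.{0}, ∀ i < κ.ord, p i < κ.ord ∧ i ≤ p i ∧ κ < (g (p i)).cof ∧
      ∀ j < i, p j < p i ∧ (g (p j)).cof < (g (p i)).cof := by
  refine exists_rec (fun i (p : Ordinal → Ordinal) y => y < κ.ord ∧ i ≤ y ∧ κ < (g y).cof ∧
      ∀ j < i, p j < y ∧ (g (p j)).cof < (g y).cof) κ.ord ?_ ?_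
  · rintro i p p' y h ⟨h1, h2, h3, h4⟩
    exact ⟨h1, h2, h3, fun j hj => h j hj ▸ h4 j hj⟩
  · intro i hi p ih
    obtain ⟨b, hb, hpb⟩ := exists_bound_of_forall (I := Iio i) (o := κ.ord)
      (P := fun j b => p j < b ∧ (g (p j)).cof ≤ ν b)
      (by rw [hν.regular.cof_ord, cardLT_Iio]; exact lt_ord.1 hi)
      (fun j _ b b' hbb' hb' h => ⟨h.1.trans_le hbb', h.2.trans (hν.mono b b' hbb' hb')⟩)
      (by
        intro j hj
        have hpj := (ih j hj).1
        obtain ⟨b, hb, hle⟩ := hν.cofinal _ (hgmu _ hpj)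
        refine ⟨max (p j + 1) b, max_lt (hν.isSuccLimit.add_one_lt hpj) hb,
          (Order.lt_add_one_iff.2 le_rfl).trans_le (le_max_left _ _), hle.trans ?_⟩
        exact hν.mono _ _ (le_max_right _ _) (max_lt (hν.isSuccLimit.add_one_lt hpj) hb))
    obtain ⟨k, hk, hkg⟩ := hg (ν b) (hν.le b hb) (hν.lt_mu b hb)
    have hy : max i (max b k) < κ.ord := max_lt hi (max_lt hb hk)
    have hlt := hkg _ hy ((le_max_right _ _).trans (le_max_right _ _))
    refine ⟨max i (max b k), hy, le_max_left _ _, (hν.le b hb).trans_lt hlt, fun j hj => ⟨?_, ?_⟩⟩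
    · exact (hpb j hj).1.trans_le ((le_max_left _ _).trans (le_max_right _ _))
    · exact (hpb j hj).2.trans_lt hlt

theorem exists_scale {mu κ : Cardinal.{0}} {ν : Ordinal.{0} → Cardinal.{0}}
    (hν : CofinalCards mu κ ν) : ∃ f g, Scale mu κ f g := by
  classical
  obtain ⟨f, hf, hfν⟩ := exists_clubIncreasing hν
  obtain ⟨g, hgν, hfg, hg⟩ := hf.exists_eub hν hfν
  have hgmu : ∀ k < κ.ord, (g k).cof < mu := fun k hk =>
    ((Ordinal.cof_le_card _).trans (card_le_of_le_ord (hgν k hk))).trans_lt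
      (hν.succ_lt _ (hν.lt_mu k hk))
  obtain ⟨p, hp⟩ := exists_strictMono_cof hν hgmu
    fun θ h1 h2 => hf.ev_lt_cof hν hfν hfg hg h1 h2
  have hev : ∀ P : Ordinal → Prop, Ev κ.ord P → Ev κ.ord fun i => P (p i) := by
    rintro P ⟨i₀, h₀, h⟩
    exact ⟨i₀, h₀, fun i hi hle => h _ (hp i hi).1 (hle.trans (hp i hi).2.1)⟩
  have hinj : InjOn p (Iio κ.ord) := by
    have : StrictMonoOn p (Iio κ.ord) := fun i _ j hj hij => ((hp j hj).2.2.2 i hij).1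
    exact this.injOn
  have hpos : ∀ i < κ.ord, 0 < g (p i) := fun i hi => pos_iff_ne_zero.2 fun h => by
    have := (hp i hi).2.2.1
    simp [h] at this
  refine ⟨fun α i => if f α (p i) < g (p i) then f α (p i) else 0, fun i => g (p i),
    ?_, ?_, ?_, fun i hi => (hp i hi).2.2.1, fun i hi => (hgmu _ (hp i hi).1).le,
    fun i hi j hj => ((hp i hi).2.2.2 j hj).2⟩
  · intro α _ i hi
    split_ifs with h
    · exact h
    · exact hpos i hi
  · intro β hβ α hα
    refine (hev _ ((hf.incr β hβ α hα).and
      ((hfg α (hα.trans hβ)).and (hfg β hβ)))).mono fun i _ h => ?_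
    rw [if_pos h.2.1, if_pos h.2.2]
    exact h.1
  · intro h hh
    obtain ⟨α, hα, hle⟩ := hg
      (fun k => if k ∈ p '' Iio κ.ord then h (Function.invFunOn p (Iio κ.ord) k) else 0)
      ((hfg 0 hν.regUnc.pos).mono fun k _ hk => by
        split_ifs with hif
        · have := hh _ (mem_Iio.1 (Function.invFunOn_mem hif))
          rwa [Function.invFunOn_eq hif] at this
        · exact zero_le.trans_lt hk)
    refine ⟨α, hα, (hev _ (hle.and (hfg α hα))).mono fun i hi ⟨h1, h2⟩ => ?_⟩
    rw [if_pos h2]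
    rwa [if_pos (mem_image_of_mem p (mem_Iio.2 hi)), hinj.leftInvOn_invFunOn (mem_Iio.2 hi)] at h1

/-! ### The rectangle lemma -/

/-- The last coordinate at which `f ξ` is at least `f ζ`. -/
def lastCross (f : Ordinal.{0} → Ordinal.{0} → Ordinal.{0}) (K ξ ζ : Ordinal.{0}) : Ordinal.{0} :=
  sInf {j | ∀ j' < K, j < j' → f ξ j' < f ζ j'}

theorem lastCross_eq {f : Ordinal → Ordinal → Ordinal} {K ξ ζ j : Ordinal} (hj : j < K)
    (h : f ζ j ≤ f ξ j) (h' : ∀ j' < K, j < j' → f ξ j' < f ζ j') : lastCross f K ξ ζ = j := by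
  refine le_antisymm (csInf_le' h') (le_csInf ⟨j, h'⟩ fun i hi => ?_)
  by_contra! hij
  exact (hi j hj hij).not_ge h

section

variable {mu κ : Cardinal.{0}} {ν : Ordinal.{0} → Cardinal.{0}}
  {f : Ordinal.{0} → Ordinal.{0} → Ordinal.{0}} {g : Ordinal.{0} → Ordinal.{0}}
  {t : Ordinal.{0} → Set Ordinal.{0}} {A : Set Ordinal.{0}}

theorem Scale.ev_forall_lt (hν : CofinalCards mu κ ν) (hs : Scale mu κ f g)
    (ht : DisjFam t (sucOrd mu) κ) {γ β : Ordinal} (hβ : β < sucOrd mu) (h : ∀ ζ ∈ t β, γ < ζ) :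
    Ev κ.ord fun j => ∀ ζ ∈ t β, f γ j < f ζ j :=
  Ev.ball (P := fun ζ j => f γ j < f ζ j) (by rw [hν.regular.cof_ord]; exact ht.cardLT β hβ)
    fun ζ hζ => hs.incr ζ (ht.subset β hβ hζ) γ (h ζ hζ)

theorem Scale.ev_exists_forall_lt (hν : CofinalCards mu κ ν) (hs : Scale mu κ f g)
    (ht : DisjFam t (sucOrd mu) κ) (hA : A ⊆ Iio (sucOrd mu))
    (hAun : ∀ b < sucOrd mu, ∃ α ∈ A, b < α) :
    Ev κ.ord fun j => ∀ η < g j, ∃ α ∈ A, ∀ ξ ∈ t α, η < f ξ j := by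
  by_contra hcon
  have : ∀ j < κ.ord, ∃ y < g j, (¬ ∀ η < g j, ∃ α ∈ A, ∀ ξ ∈ t α, η < f ξ j) →
      ∀ α ∈ A, ∃ ξ ∈ t α, f ξ j ≤ y := by
    intro j hj
    by_cases h : ∀ η < g j, ∃ α ∈ A, ∀ ξ ∈ t α, η < f ξ j
    · exact ⟨f 0 j, hs.lt 0 hν.regUnc.pos j hj, fun h' => absurd h h'⟩
    · have h' := h
      push Not at h'
      obtain ⟨y, hy, h'⟩ := h'
      exact ⟨y, hy, fun _ => h'⟩
  choose! y hy hyA using this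
  obtain ⟨γ, hγ, hle⟩ := hs.cofinal y hy
  obtain ⟨b, hb, hab⟩ := ht.eventually_above hν.regUnc hγ
  obtain ⟨α, hα, hbα⟩ := hAun b hb
  obtain ⟨j, hj, ⟨h1, h2⟩, h3⟩ := (hle.and
    (hs.ev_forall_lt hν ht (hA hα) (hab α (hA hα) hbα.le))).exists_of_not hcon
  obtain ⟨ξ, hξ, h4⟩ := hyA j hj h3 α hα
  exact (h4.trans h1).not_gt (h2 ξ hξ)

theorem Scale.exists_rectangle (hν : CofinalCards mu κ ν) (hs : Scale mu κ f g)
    (ht : DisjFam t (sucOrd mu) κ) (hA : A ⊆ Iio (sucOrd mu))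
    (hAun : ∀ b < sucOrd mu, ∃ α ∈ A, b < α) :
    ∃ θ < sucOrd mu, ∀ B ⊆ Iio (sucOrd mu), (∀ b < sucOrd mu, ∃ β ∈ B, b < β) →
      ∀ b < sucOrd mu, ∃ j₀ < κ.ord, ∀ j < κ.ord, j₀ ≤ j →
        ∃ α ∈ A, α < θ ∧ t α ⊆ Iio θ ∧ ∃ β ∈ B, b < β ∧ (∀ ζ ∈ t β, b < ζ) ∧
          ∀ ξ ∈ t α, ∀ ζ ∈ t β, lastCross f κ.ord ξ ζ = j := by
  choose c hc hccard hcof using exists_cofinal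
  obtain ⟨jA, hjA, hAj⟩ := hs.ev_exists_forall_lt hν ht hA hAun
  have hAj' : ∀ j < κ.ord, jA ≤ j → ∀ η ∈ c (g j), ∃ α ∈ A, ∀ ξ ∈ t α, η < f ξ j :=
    fun j hj hle η hη => hAj j hj hle η (hc _ hη)
  choose! a haA ha using hAj'
  have hκcof : ∀ j < κ.ord, ∀ {s : Set Ordinal}, CardLT s κ → CardLT s (g j).cof :=
    fun j hj s h => cardLT_trans h (hs.lt_cof j hj).le
  obtain ⟨θ, hθ, hθa⟩ := exists_bound_of_forall (I := Iio κ.ord) (o := sucOrd mu)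
    (P := fun j θ => jA ≤ j → ∀ η ∈ c (g j), a j η < θ ∧ ∀ ξ ∈ t (a j η), ξ < θ)
    hν.cardLT_index
    (fun j _ b b' hbb' _ h hj η hη => ⟨(h hj η hη).1.trans_le hbb',
      fun ξ hξ => ((h hj η hη).2 ξ hξ).trans_le hbb'⟩)
    (by
      intro j hj
      by_cases hle : jA ≤ j
      swap
      · exact ⟨0, hν.regUnc.pos, fun h => absurd h hle⟩
      obtain ⟨θ, hθ, h⟩ := exists_bound_of_forall (I := c (g j)) (o := sucOrd mu)
        (P := fun η θ => a j η < θ ∧ ∀ ξ ∈ t (a j η), ξ < θ)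
        (by
          rw [hν.cof]
          exact ((hccard _).trans (hs.cof_le j hj)).lt (Order.lt_succ mu))
        (fun η _ b b' hbb' _ h => ⟨h.1.trans_le hbb', fun ξ hξ => (h.2 ξ hξ).trans_le hbb'⟩)
        (by
          intro η hη
          have haL := hA (haA j hj hle η hη)
          obtain ⟨b, hb, h⟩ := exists_bound (o := sucOrd mu) (A := t (a j η))
            (by
              rw [hν.cof]
              exact cardLT_trans (ht.cardLT _ haL) (hν.lt.le.trans (Order.le_succ mu)))
            (fun ξ hξ => ht.subset _ haL hξ)
          refine ⟨max (a j η + 1) b, max_lt (hν.regUnc.succ_lt haL) hb,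
            (Order.lt_add_one_iff.2 le_rfl).trans_le (le_max_left _ _),
            fun ξ hξ => (h ξ hξ).trans_le (le_max_right _ _)⟩)
      exact ⟨θ, hθ, fun _ => h⟩)
  refine ⟨θ, hθ, fun B hB hBun b hb => ?_⟩
  have hh : ∀ j < κ.ord, ∃ y < g j, ∀ j' ∈ Iio j, jA ≤ j' → ∀ η ∈ c (g j'),
      ∀ ξ ∈ t (a j' η), f ξ j < y := by
    intro j hj
    have hpos : 0 < g j := zero_le.trans_lt (hs.lt 0 hν.regUnc.pos j hj)
    refine exists_bound_of_forall (I := Iio j) (o := g j)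
      (P := fun j' y => jA ≤ j' → ∀ η ∈ c (g j'), ∀ ξ ∈ t (a j' η), f ξ j < y)
      (hκcof j hj (cardLT_Iio.2 (lt_ord.1 hj)))
      (fun j' _ b b' hbb' _ h hj' η hη ξ hξ => (h hj' η hη ξ hξ).trans_le hbb') fun j' hj' => ?_
    by_cases hle : jA ≤ j'
    swap
    · exact ⟨0, hpos, fun h => absurd h hle⟩
    obtain ⟨y, hy, h⟩ := exists_bound_of_forall (I := c (g j')) (o := g j)
      (P := fun η y => ∀ ξ ∈ t (a j' η), f ξ j < y)
      ((hccard _).lt (hs.cof_strictMono j hj j' hj'))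
      (fun η _ b b' hbb' _ h ξ hξ => (h ξ hξ).trans_le hbb')
      (by
        intro η hη
        have haL := hA (haA j' (hj'.trans hj) hle η hη)
        obtain ⟨y, hy, h⟩ := exists_bound (o := g j) (A := (fun ξ => f ξ j) '' t (a j' η))
          (hκcof j hj (cardLT_image (ht.cardLT _ haL) _))
          (by rintro _ ⟨ξ, hξ, rfl⟩; exact hs.lt ξ (ht.subset _ haL hξ) j hj)
        exact ⟨y, hy, fun ξ hξ => h _ ⟨ξ, hξ, rfl⟩⟩)
    exact ⟨y, hy, fun _ => h⟩
  choose! h hhg hh using hh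
  obtain ⟨γ, hγ, hle⟩ := hs.cofinal h hhg
  obtain ⟨b', hb', hab⟩ := ht.eventually_above hν.regUnc (max_lt hγ hb)
  obtain ⟨β, hβ, hbβ⟩ := hBun _ (max_lt hb hb')
  have htβ := hab β (hB hβ) ((le_max_right _ _).trans hbβ.le)
  obtain ⟨j₁, hj₁, hj₁β⟩ := hle.and
    (hs.ev_forall_lt hν ht (hB hβ) fun ζ hζ => (le_max_left _ _).trans_lt (htβ ζ hζ))
  refine ⟨max jA j₁, max_lt hjA hj₁, fun j hj hle => ?_⟩
  have hjAj := (le_max_left _ _).trans hle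
  obtain ⟨y, hy, hyβ⟩ := exists_bound (o := g j) (A := (fun ζ => f ζ j) '' t β)
    (hκcof j hj (cardLT_image (ht.cardLT β (hB hβ)) _))
    (by rintro _ ⟨ζ, hζ, rfl⟩; exact hs.lt ζ (ht.subset β (hB hβ) hζ) j hj)
  obtain ⟨η, hη, hyη⟩ := hcof _ y hy
  refine ⟨a j η, haA j hj hjAj η hη, (hθa j hj hjAj η hη).1, (hθa j hj hjAj η hη).2, β, hβ,
    (le_max_left _ _).trans_lt hbβ, fun ζ hζ => (le_max_right _ _).trans_lt (htβ ζ hζ),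
    fun ξ hξ ζ hζ => lastCross_eq hj ?_ fun j' hj' hjj' => ?_⟩
  · exact ((hyβ _ ⟨ζ, hζ, rfl⟩).trans_le (hyη.trans (ha j hj hjAj η hη ξ hξ).le)).le
  · obtain ⟨h1, h2⟩ := hj₁β j' hj' ((le_max_right _ _).trans (hle.trans hjj'.le))
    exact ((hh j' hj' j hjj' hjAj η hη ξ hξ).trans_le h1).trans (h2 ζ hζ)

end

/-! ### The coloring -/

theorem exists_triple_coding {κ : Cardinal.{0}} (hκ : ℵ₀ ≤ κ) :
    ∃ p q r : Ordinal.{0} → Ordinal.{0}, (∀ j, r j < κ.ord) ∧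
      ∀ a < κ.ord, ∀ b < κ.ord, ∀ c < κ.ord, ∀ j₀ < κ.ord,
        ∃ j < κ.ord, j₀ ≤ j ∧ p j = a ∧ q j = b ∧ r j = c := by
  classical
  have hmk : #(Iio κ.ord) = Cardinal.lift.{1, 0} κ := by rw [mk_Iio_ordinal, card_ord]
  have h0 : ℵ₀ ≤ #(Iio κ.ord) := by rw [hmk]; exact aleph0_le_lift.2 hκ
  obtain ⟨e⟩ : Nonempty (Iio κ.ord ≃ (Iio κ.ord × Iio κ.ord) × (Iio κ.ord × Iio κ.ord)) := by
    refine Cardinal.eq.1 ?_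
    rw [mk_prod, mk_prod, Cardinal.lift_id, Cardinal.lift_id, mul_eq_self h0, mul_eq_self h0]
  have hpos : 0 < κ.ord := (isSuccLimit_ord hκ).bot_lt
  refine ⟨fun j => if h : j ∈ Iio κ.ord then (e ⟨j, h⟩).1.1 else 0,
    fun j => if h : j ∈ Iio κ.ord then (e ⟨j, h⟩).1.2 else 0,
    fun j => if h : j ∈ Iio κ.ord then (e ⟨j, h⟩).2.1 else 0, fun j => ?_,
    fun a ha b hb c hc j₀ hj₀ => ?_⟩
  · beta_reduce
    split_ifs with h
    · exact (e ⟨j, h⟩).2.1.2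
    · exact hpos
  · let w : Iio κ.ord → Iio κ.ord := fun x => e.symm ((⟨a, ha⟩, ⟨b, hb⟩), (⟨c, hc⟩, x))
    have hw : ∃ x, j₀ ≤ w x := by
      by_contra! hcon
      have hle : #(Iio κ.ord) ≤ #(Iio j₀) := by
        refine mk_le_of_injective (f := fun x => (⟨w x, hcon x⟩ : Iio j₀)) fun x y hxy => ?_
        have hxy' : (⟨w x, hcon x⟩ : Iio j₀) = ⟨w y, hcon y⟩ := hxy
        have := e.symm.injective (Subtype.ext (Subtype.mk.inj hxy'))
        exact congrArg (fun z => z.2.2) this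
      rw [hmk, mk_Iio_ordinal, Cardinal.lift_le] at hle
      exact hle.not_gt (lt_ord.1 hj₀)
    obtain ⟨x, hx⟩ := hw
    have hex : e ⟨w x, (w x).2⟩ = ((⟨a, ha⟩, ⟨b, hb⟩), (⟨c, hc⟩, x)) := e.apply_symm_apply _
    refine ⟨w x, (w x).2, hx, ?_, ?_, ?_⟩ <;> simp only [(w x).2, dif_pos, hex]

theorem sInf_inter_Ici_eq {A : Set Ordinal.{0}} {x y : Ordinal.{0}} (hx : x ∈ A) (hyx : y ≤ x)
    (h : ∀ z ∈ A, z < x → z < y) : sInf (A ∩ Ici y) = x := by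
  refine le_antisymm (csInf_le' ⟨hx, hyx⟩) (le_csInf ⟨x, hx, hyx⟩ fun z hz => ?_)
  by_contra! hzx
  exact (h z hz.1 hzx).not_ge hz.2

theorem sInf_inter_lt {A B : Set Ordinal.{0}} {x y : Ordinal.{0}} (hA : A ⊆ Iio x) (hxy : x < y) :
    sInf (A ∩ B) < y := by
  rcases (A ∩ B).eq_empty_or_nonempty with h | h
  · rw [h, Ordinal.sInf_empty]
    exact zero_le.trans_lt hxy
  · exact (hA (csInf_mem h).1).trans hxy

/-- The coloring of pairs `ξ < ζ`: the last crossing `j` of `f ξ` and `f ζ` codes a color and two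
indices, with which `ζ`, and then `ξ`, select an ordinal from the sets `P ζ i` and `P ξ i`. -/
def coloring (f : Ordinal.{0} → Ordinal.{0} → Ordinal.{0}) (K : Ordinal.{0})
    (P : Ordinal.{0} → Ordinal.{0} → Set Ordinal.{0}) (p q r : Ordinal.{0} → Ordinal.{0})
    (ξ ζ : Ordinal.{0}) : Ordinal.{0} × Ordinal.{0} × Ordinal.{0} :=
  let j := lastCross f K ξ ζ
  (sInf (P ξ (p j) ∩ Ici (sSup (P ζ (q j) ∩ Iio ξ))), sInf (P ζ (q j) ∩ Ici ξ), r j)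

theorem coloring_eq {f : Ordinal.{0} → Ordinal.{0} → Ordinal.{0}}
    {P : Ordinal.{0} → Ordinal.{0} → Set Ordinal.{0}} {p q r : Ordinal.{0} → Ordinal.{0}}
    {K ξ ζ j x x' y y' : Ordinal.{0}} (hj : lastCross f K ξ ζ = j)
    (hx : x ∈ P ξ (p j)) (hxy : ∀ z ∈ P ξ (p j), z < x → z < y)
    (hx' : x' ∈ P ζ (q j)) (hxy' : ∀ z ∈ P ζ (q j), z < x' → z < y')
    (hy : y ∈ P ζ (q j)) (hyx' : y < x') (hy'x : y' < x) (hy'ξ : y' < ξ) (hξx' : ξ < x') :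
    coloring f K P p q r ξ ζ = (x, x', r j) := by
  have hyξ : y < ξ := (hxy' y hy hyx').trans hy'ξ
  have h1 : y ≤ sSup (P ζ (q j) ∩ Iio ξ) :=
    le_csSup ⟨ξ, fun z hz => (mem_Iio.1 hz.2).le⟩ ⟨hy, hyξ⟩
  have h2 : sSup (P ζ (q j) ∩ Iio ξ) ≤ y' :=
    csSup_le ⟨y, hy, hyξ⟩ fun z hz => (hxy' z hz.1 ((mem_Iio.1 hz.2).trans hξx')).le
  simp only [coloring, hj]
  rw [sInf_inter_Ici_eq hx' hξx'.le fun z hz hzx => (hxy' z hz hzx).trans hy'ξ,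
    sInf_inter_Ici_eq hx (h2.trans hy'x.le) fun z hz hzx => (hxy z hz hzx).trans_le h1]

theorem exists_coloring {mu κ : Cardinal.{0}} {ν : Ordinal.{0} → Cardinal.{0}}
    (hν : CofinalCards mu κ ν) :
    ∃ D : Ordinal.{0} → Ordinal.{0} → Ordinal.{0} × Ordinal.{0} × Ordinal.{0},
      (∀ a b, a < b → b < sucOrd mu →
        (D a b).1 < sucOrd mu ∧ (D a b).2.1 < sucOrd mu ∧ (D a b).2.2 < κ.ord) ∧
      ∀ t, DisjFam t (sucOrd mu) κ →
        ∃ S T : Set Ordinal, IsStatIn S (sucOrd mu) ∧ IsStatIn T (sucOrd mu) ∧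
          ∀ x ∈ S, ∀ x' ∈ T, x < x' → ∀ δ < κ.ord, ∃ α β, α < β ∧ β < sucOrd mu ∧
            ∀ ξ ∈ t α, ∀ ζ ∈ t β, D (min ξ ζ) (max ξ ζ) = (x, x', δ) := by
  have hL := hν.regUnc
  obtain ⟨P, hP, hiso⟩ := exists_isolating_system hν
  obtain ⟨f, g, hs⟩ := exists_scale hν
  obtain ⟨p, q, r, hr, hpqr⟩ := exists_triple_coding hν.regular.aleph0_le
  refine ⟨coloring f κ.ord P p q r, fun a b hab hb =>
    ⟨sInf_inter_lt (hP _ _) (hab.trans hb), sInf_inter_lt (hP _ _) hb, hr _⟩, fun t ht => ?_⟩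
  obtain ⟨i, hi, y, hy, S, hS, hSi⟩ := hiso t ht 0 hL.pos
  obtain ⟨i', hi', y', hy', T, hT, hTi⟩ := hiso t ht y hy
  have hθ : ∀ x < sucOrd mu, ∃ θ < sucOrd mu, x ∈ S → ∀ B ⊆ Iio (sucOrd mu),
      (∀ b < sucOrd mu, ∃ β ∈ B, b < β) → ∀ b < sucOrd mu, ∃ j₀ < κ.ord, ∀ j < κ.ord, j₀ ≤ j →
        ∃ α ∈ {α | α < sucOrd mu ∧ ∀ ξ ∈ t α, y' < ξ ∧ x ∈ P ξ i ∧ ∀ z ∈ P ξ i, z < x → z < y},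
          α < θ ∧ t α ⊆ Iio θ ∧ ∃ β ∈ B, b < β ∧ (∀ ζ ∈ t β, b < ζ) ∧
            ∀ ξ ∈ t α, ∀ ζ ∈ t β, lastCross f κ.ord ξ ζ = j := by
    intro x hx
    by_cases hxS : x ∈ S
    swap
    · exact ⟨0, hL.pos, fun h => absurd h hxS⟩
    obtain ⟨θ, hθ, h⟩ := hs.exists_rectangle hν ht
      (A := {α | α < sucOrd mu ∧ ∀ ξ ∈ t α, y' < ξ ∧ x ∈ P ξ i ∧ ∀ z ∈ P ξ i, z < x → z < y})
      (fun α hα => hα.1)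
      (by
        intro b hb
        obtain ⟨b', hb', hab⟩ := ht.eventually_above hL hy'
        obtain ⟨α, hα, hbα, h⟩ := (hSi x hxS).2.2 _ (max_lt hb hb')
        exact ⟨α, ⟨hα, fun ξ hξ => ⟨hab α hα ((le_max_right _ _).trans hbα.le) ξ hξ, (h ξ hξ).1,
          (h ξ hξ).2.2⟩⟩, (le_max_left _ _).trans_lt hbα⟩)
    exact ⟨θ, hθ, fun _ => h⟩
  choose! θ hθL hθ using hθ
  refine ⟨S ∩ Ioo y' (sucOrd mu), T ∩ closurePts θ (sucOrd mu),
    hS.inter_club hL (isClubIn_Ioo hL hy'), hT.inter_club hL (isClubIn_closurePts hL hθL),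
    fun x hx x' hx' hxx' δ hδ => ?_⟩
  have hx'L := hT.1 hx'.1
  obtain ⟨j₀, hj₀, h⟩ := hθ x hx.2.2 hx.1
    {β | β < sucOrd mu ∧ ∀ ζ ∈ t β, x' ∈ P ζ i' ∧ y ∈ P ζ i' ∧ ∀ z ∈ P ζ i', z < x' → z < y'}
    (fun β hβ => hβ.1)
    (by
      intro b hb
      obtain ⟨β, hβ, hbβ, h⟩ := (hTi x' hx'.1).2.2 b hb
      exact ⟨β, ⟨hβ, h⟩, hbβ⟩) x' hx'L
  obtain ⟨j, hj, hle, rfl, rfl, rfl⟩ := hpqr i hi i' hi' δ hδ j₀ hj₀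
  obtain ⟨α, ⟨-, hα⟩, hαθ, htα, β, ⟨hβL, hβ⟩, hx'β, htβ, hcross⟩ := h j hj hle
  have hθx' : θ x < x' := hx'.2.2.2 x hxx'
  refine ⟨α, β, (hαθ.trans hθx').trans hx'β, hβL, fun ξ hξ ζ hζ => ?_⟩
  have hξx' : ξ < x' := (htα hξ).trans hθx'
  have hξζ : ξ < ζ := hξx'.trans (htβ ζ hζ)
  rw [min_eq_left hξζ.le, max_eq_right hξζ.le]
  obtain ⟨h1, h2, h3⟩ := hα ξ hξ
  obtain ⟨h4, h5, h6⟩ := hβ ζ hζ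
  exact coloring_eq (hcross ξ hξ ζ hζ) h2 h3 h4 h6 h5 (hTi x' hx'.1).1 hx.2.1 h1 hξx'

end SingularColoring

/-- Main Theorem: for singular `μ` there is a coloring `D` of pairs below `μ⁺` with values in
`μ⁺ × μ⁺ × cf(μ)` such that every pairwise disjoint family `⟨t_α : α < μ⁺⟩` of nonempty sets of
size `< cf(μ)` admits stationary `S, T ⊆ μ⁺` so that every value `⟨α*, β*, δ⟩ ∈ S ⊛ T × cf(μ)`
is attained constantly on some rectangle `t_α × t_β` with `α < β`. -/
theorem stmt0 (mu : Cardinal) (hsing : IsSingular mu) :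
    ∃ D : Ordinal → Ordinal → Ordinal × Ordinal × Ordinal,
      (∀ a b, a < b → b < sucOrd mu →
        (D a b).1 < sucOrd mu ∧ (D a b).2.1 < sucOrd mu ∧ (D a b).2.2 < cofOrd mu) ∧
      ∀ t : Ordinal → Set Ordinal,
        (∀ a, a < sucOrd mu → (t a).Nonempty) →
        (∀ a, a < sucOrd mu → t a ⊆ Set.Iio (sucOrd mu)) →
        (∀ a b, a < sucOrd mu → b < sucOrd mu → a ≠ b → Disjoint (t a) (t b)) →
        (∀ a, a < sucOrd mu → CardLT (t a) (Ordinal.cof mu.ord)) →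
        ∃ S T : Set Ordinal, IsStatIn S (sucOrd mu) ∧ IsStatIn T (sucOrd mu) ∧
          ∀ astar ∈ S, ∀ bstar ∈ T, astar < bstar → ∀ δ, δ < cofOrd mu →
            ∃ α β, α < β ∧ β < sucOrd mu ∧
              ∀ ξ ∈ t α, ∀ ζ ∈ t β, D (min ξ ζ) (max ξ ζ) = (astar, bstar, δ) := by
  obtain ⟨ν, hν⟩ := SingularColoring.exists_cofinalCards hsing.1 hsing.2
  obtain ⟨D, hD, h⟩ := SingularColoring.exists_coloring hν
  exact ⟨D, hD, fun t _ hsub hdisj hcard => h t ⟨hsub, hdisj, hcard⟩⟩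

end
end

section
/- Let μ be a singular cardinal. The following three statements are equivalent: (a) pr₁(μ⁺, μ⁺, μ⁺, cf(μ)) holds; (b) pr₁(μ⁺, μ⁺, μ, cf(μ)) holds; (c) for every cardinal θ₀ < μ there is a cardinal θ with θ₀ ≤ θ < μ such that pr₁(μ⁺, μ⁺, θ, cf(μ)) holds. -/
noncomputable section

open Set

/-- A union of at most `chi` sets of size at most `chi` has size at most `chi`. -/
theorem mk_iUnion_le_of_le {ι α : Type} {chi : Cardinal.{0}} (hchi : Cardinal.aleph0 ≤ chi)
    (hι : Cardinal.mk ι ≤ chi) (f : ι → Set α) (hf : ∀ i, Cardinal.mk (f i) ≤ chi) :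
    Cardinal.mk (⋃ i, f i) ≤ chi :=
  (Cardinal.mk_iUnion_le f).trans <|
    (mul_le_mul' hι (ciSup_le' hf)).trans (Cardinal.mul_eq_self hchi).le

theorem mk_prod_le_of_le {α β : Type} {chi : Cardinal.{0}} (hchi : Cardinal.aleph0 ≤ chi)
    (hα : Cardinal.mk α ≤ chi) (hβ : Cardinal.mk β ≤ chi) : Cardinal.mk (α × β) ≤ chi := by
  rw [Cardinal.mk_prod, Cardinal.lift_id, Cardinal.lift_id]
  exact (mul_le_mul' hα hβ).trans (Cardinal.mul_eq_self hchi).le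

/-- Transfinite recursion along `W` in a preorder where families indexed by proper initial
segments of `W` are bounded above. -/
theorem exists_rec_le {W P : Type*} [LinearOrder W] [WellFoundedLT W] [Preorder P]
    (hdir : ∀ (w : W) (f : Iio w → P), ∃ p, ∀ v, f v ≤ p) (F : P → P) :
    ∃ s : W → P, ∀ v w, v < w → F (s v) ≤ s w := by
  choose U hU using hdir
  let G : W → P :=
    WellFoundedLT.fix (motive := fun _ => P) fun w ih => U w fun v => F (ih v v.2)
  have hG : ∀ w, G w = U w fun v => F (G v) := fun w => WellFoundedLT.fix_eq _ w
  refine ⟨G, fun v w hvw => ?_⟩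
  rw [hG w]
  exact hU w (fun v => F (G v)) ⟨v, hvw⟩

/-- The set of points of `W` closed under `h`. -/
def closurePts {W : Type} [LinearOrder W] (h : W → W) : Set W := {x | ∀ y < x, h y < x}

/-- One step down from `x` along the ladder `e`, allowed only if `e x` has size at most `chi`:
move to a point `z` of `e x`, or to the largest closure point of `h` that is `≤ z`. -/
def LadderStep {W : Type} [LinearOrder W] (e : W → Set W) (h : W → W) (chi : Cardinal.{0})
    (x y : W) : Prop :=
  Cardinal.mk (e x) ≤ chi ∧ ∃ z ∈ e x, y = z ∨ IsGreatest (closurePts h ∩ Iic z) y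

/-- `y` can be reached from `x` by finitely many ladder steps. -/
def Reach {W : Type} [LinearOrder W] (e : W → Set W) (h : W → W) (chi : Cardinal.{0}) :
    W → W → Prop :=
  Relation.ReflTransGen (LadderStep e h chi)

/-- `c` takes the constant value `ε` on the pairs from `s × t`. -/
def HitsOn {W σ : Type*} [LinearOrder W] (c : W → W → σ) (ε : σ) (s t : Set W) : Prop :=
  ∀ ξ ∈ s, ∀ ζ ∈ t, c (min ξ ζ) (max ξ ζ) = ε

/-- Every disjoint `W`-sequence of sets of size `< kap` has a pair on which `c` is constantly
`ε`. -/
def Hits {W : Type} {σ : Type*} [LinearOrder W] (kap : Cardinal.{0}) (c : W → W → σ) (ε : σ) :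
    Prop :=
  ∀ t : W → Set W, Pairwise (Function.onFun Disjoint t) → (∀ a, Cardinal.mk (t a) < kap) →
    ∃ α β, α < β ∧ HitsOn c ε (t α) (t β)

/-- `W` is like the successor of `mu`, `chi` enumerates a `kap`-directed cofinal family of
cardinals below `mu`, and `e x` is a cofinal subset of `Iio x` of minimal size, which is less
than `mu`. -/
structure LadderSystem {W I : Type} [LinearOrder W] (mu kap : Cardinal.{0})
    (chi : I → Cardinal.{0}) (e : W → Set W) : Prop where
  mk_eq : Cardinal.mk W = Order.succ mu
  mk_Iio_le : ∀ w : W, Cardinal.mk (Iio w) ≤ mu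
  aleph0_le : Cardinal.aleph0 ≤ kap
  kap_lt : kap < mu
  mk_index_le : Cardinal.mk I ≤ kap
  kap_le : ∀ i, kap ≤ chi i
  chi_lt : ∀ i, chi i < mu
  dominate : ∀ {ι : Type} (f : ι → Cardinal.{0}), Cardinal.mk ι < kap → (∀ j, f j < mu) →
    ∃ i, ∀ j, f j ≤ chi i
  ladder_subset : ∀ x, e x ⊆ Iio x
  ladder_cofinal : ∀ x, ∀ y < x, ∃ z ∈ e x, y ≤ z
  ladder_lt : ∀ x, Cardinal.mk (e x) < mu
  ladder_bdd : ∀ x, ∀ s ⊆ Iio x, Cardinal.mk s < Cardinal.mk (e x) → ∃ y < x, ∀ z ∈ s, z < y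

theorem HitsOn.mono {W σ : Type*} [LinearOrder W] {c : W → W → σ} {ε : σ} {s s' t t' : Set W}
    (H : HitsOn c ε s t) (hs : s' ⊆ s) (ht : t' ⊆ t) : HitsOn c ε s' t' :=
  fun ξ hξ ζ hζ => H ξ (hs hξ) ζ (ht hζ)

/-- The point `x` is below `t` and reachable from all points of `t`, and all points below `x`
which are reachable from `t` are at most `η`. -/
def Lead {W : Type} [LinearOrder W] (e : W → Set W) (h : W → W) (chi : Cardinal.{0}) (t : Set W)
    (x η : W) : Prop :=
  η < x ∧ (∀ ζ ∈ t, x ≤ ζ) ∧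
    ∀ ζ ∈ t, Reach e h chi ζ x ∧ ∀ y, Reach e h chi ζ y → y < x → y ≤ η

section Closure

variable {W : Type} [LinearOrder W]

theorem closurePts_anti {h h' : W → W} (hh : h ≤ h') : closurePts h' ⊆ closurePts h :=
  fun _ hx y hy => (hh y).trans_lt (hx y hy)

theorem mem_closurePts_of_cofinal {h : W → W} {x : W}
    (hx : ∀ y < x, ∃ z ∈ closurePts h, y < z ∧ z ≤ x) : x ∈ closurePts h := fun y hy => by
  obtain ⟨z, hz, hyz, hzx⟩ := hx y hy
  exact (hz y hyz).trans_le hzx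

theorem exists_isGreatest_closurePts [WellFoundedLT W] (h : W → W) (z : W) :
    ∃ y, IsGreatest (closurePts h ∩ Iic z) y := by
  have hne : (upperBounds (closurePts h ∩ Iic z)).Nonempty := ⟨z, fun _ hx => hx.2⟩
  obtain ⟨b, hb, hmin⟩ := WellFounded.has_min (wellFounded_lt (α := W)) _ hne
  refine ⟨b, ⟨mem_closurePts_of_cofinal fun y hy => ?_, ?_⟩, hb⟩
  · by_contra! hcon
    exact hmin y (fun x hx => not_lt.1 fun hyx => (hcon x hx.1 hyx).not_ge (hb hx)) hy
  · exact not_lt.1 fun hzb => hmin z (fun x hx => hx.2) hzb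

theorem LadderStep.lt {e : W → Set W} (he : ∀ x, e x ⊆ Iio x) {h : W → W} {chi : Cardinal.{0}}
    {x y : W} (hxy : LadderStep e h chi x y) : y < x := by
  obtain ⟨-, z, hz, rfl | hy⟩ := hxy
  · exact he x hz
  · exact lt_of_le_of_lt hy.1.2 (he x hz)

theorem mk_ladderStep_le {e : W → Set W} {h : W → W} {chi : Cardinal.{0}}
    (hchi : Cardinal.aleph0 ≤ chi) (x : W) : Cardinal.mk {y | LadderStep e h chi x y} ≤ chi := by
  by_cases hx : Cardinal.mk (e x) ≤ chi
  · have hsub : {y | LadderStep e h chi x y} ⊆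
        ⋃ z : e x, ({z.1} ∪ {y | IsGreatest (closurePts h ∩ Iic z.1) y} : Set W) := by
      rintro y ⟨-, z, hz, hy⟩
      exact mem_iUnion.2 ⟨⟨z, hz⟩, hy⟩
    refine (Cardinal.mk_le_mk_of_subset hsub).trans (mk_iUnion_le_of_le hchi hx _ fun z => ?_)
    have hfin : ({z.1} ∪ {y | IsGreatest (closurePts h ∩ Iic z.1) y} : Set W).Finite :=
      (finite_singleton _).union (Subsingleton.finite fun _ ha _ hb => ha.unique hb)
    exact (hfin.lt_aleph0.le).trans hchi
  · have : {y | LadderStep e h chi x y} = ∅ := eq_empty_of_forall_notMem fun y hy => hx hy.1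
    simp [this]

theorem Reach.le {e : W → Set W} {h : W → W} {chi : Cardinal.{0}} {x y : W}
    (hxy : Reach e h chi x y) (he : ∀ x, e x ⊆ Iio x) : y ≤ x := by
  induction hxy with
  | refl => exact le_rfl
  | tail _ hbc ih => exact (hbc.lt he).le.trans ih

theorem mk_reach_le {e : W → Set W} {h : W → W} {chi : Cardinal.{0}}
    (hchi : Cardinal.aleph0 ≤ chi) (x : W) : Cardinal.mk {y | Reach e h chi x y} ≤ chi := by
  let B : ℕ → Set W := fun n =>
    Nat.rec (motive := fun _ => Set W) {x} (fun _ A => ⋃ a : A, {y | LadderStep e h chi a.1 y}) n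
  have hB : ∀ n, Cardinal.mk ↥(B n) ≤ chi := by
    intro n
    induction n with
    | zero => exact (finite_singleton x).lt_aleph0.le.trans hchi
    | succ n ih => exact mk_iUnion_le_of_le hchi ih _ fun a => mk_ladderStep_le hchi a.1
  refine (Cardinal.mk_le_mk_of_subset ?_).trans
    (mk_iUnion_le_of_le hchi (Cardinal.mk_nat.le.trans hchi) B hB)
  intro y hy
  induction hy with
  | refl => exact mem_iUnion.2 ⟨0, rfl⟩
  | tail _ hbc ih =>
    obtain ⟨n, hn⟩ := mem_iUnion.1 ih
    exact mem_iUnion.2 ⟨n + 1, mem_iUnion.2 ⟨⟨_, hn⟩, hbc⟩⟩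

end Closure

namespace LadderSystem

variable {W I : Type} [LinearOrder W] {mu kap : Cardinal.{0}} {chi : I → Cardinal.{0}}
  {e : W → Set W}

theorem aleph0_le_mu (S : LadderSystem mu kap chi e) : Cardinal.aleph0 ≤ mu :=
  S.aleph0_le.trans S.kap_lt.le

theorem aleph0_le_chi (S : LadderSystem mu kap chi e) (i : I) : Cardinal.aleph0 ≤ chi i :=
  S.aleph0_le.trans (S.kap_le i)

theorem mk_Iic_le (S : LadderSystem mu kap chi e) (w : W) : Cardinal.mk (Iic w) ≤ mu := by
  rw [← Iio_union_right]
  exact (Cardinal.mk_union_le _ _).trans (Cardinal.add_le_of_le S.aleph0_le_mu (S.mk_Iio_le w)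
    ((finite_singleton w).lt_aleph0.le.trans S.aleph0_le_mu))

theorem exists_gt_of_index (S : LadderSystem mu kap chi e) {ι : Type} (hι : Cardinal.mk ι ≤ mu)
    (f : ι → W) : ∃ b, ∀ i, f i < b := by
  by_contra! hcon
  have hun : (⋃ i, Iic (f i)) = univ := eq_univ_of_forall fun b => mem_iUnion.2 (hcon b)
  have hle := mk_iUnion_le_of_le S.aleph0_le_mu hι (fun i => Iic (f i)) fun i => S.mk_Iic_le _
  rw [hun, Cardinal.mk_univ, S.mk_eq] at hle
  exact (Order.lt_succ mu).not_ge hle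

theorem exists_gt_of_set (S : LadderSystem mu kap chi e) {s : Set W} (hs : Cardinal.mk s ≤ mu) :
    ∃ b, ∀ x ∈ s, x < b := by
  obtain ⟨b, hb⟩ := S.exists_gt_of_index hs Subtype.val
  exact ⟨b, fun x hx => hb ⟨x, hx⟩⟩

theorem exists_gt (S : LadderSystem mu kap chi e) (w : W) : ∃ b, w < b := by
  obtain ⟨b, hb⟩ := S.exists_gt_of_index (ι := Unit)
    ((Cardinal.mk_le_aleph0).trans S.aleph0_le_mu) fun _ => w
  exact ⟨b, hb ()⟩

theorem exists_forall_subset_Ici (S : LadderSystem mu kap chi e) {t : W → Set W}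
    (htd : Pairwise (Function.onFun Disjoint t)) (d : W) : ∃ b, ∀ β, b ≤ β → t β ⊆ Ici d := by
  have : ∀ y : Iio d, ∃ b, ∀ β, b ≤ β → y.1 ∉ t β := fun y => by
    by_cases hy : ∃ β, y.1 ∈ t β
    · obtain ⟨β, hβ⟩ := hy
      obtain ⟨b, hb⟩ := S.exists_gt β
      exact ⟨b, fun β' hβ' hy' =>
        disjoint_left.1 (htd (hb.trans_le hβ').ne) hβ hy'⟩
    · exact ⟨d, fun β _ hβ => hy ⟨β, hβ⟩⟩
  choose B hB using this
  obtain ⟨b, hb⟩ := S.exists_gt_of_index (S.mk_Iio_le d) B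
  exact ⟨b, fun β hβ y hy => not_lt.1 fun hyd =>
    hB ⟨y, hyd⟩ β ((hb _).le.trans hβ) hy⟩

theorem mk_Ioi (S : LadderSystem mu kap chi e) (w : W) : mu < Cardinal.mk (Ioi w) := by
  by_contra! hle
  obtain ⟨b, hb⟩ := S.exists_gt_of_set hle
  obtain ⟨d, hd⟩ := S.exists_gt_of_index (ι := Bool)
    ((Cardinal.mk_le_aleph0).trans S.aleph0_le_mu) (fun x => cond x w b)
  exact (hb d (hd true)).not_gt (hd false)

variable [WellFoundedLT W]

theorem exists_rec (S : LadderSystem mu kap chi e) (F : W → W) :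
    ∃ s : W → W, ∀ v w, v < w → F (s v) ≤ s w :=
  exists_rec_le (fun w f => by
    obtain ⟨b, hb⟩ := S.exists_gt_of_index (S.mk_Iio_le w) f
    exact ⟨b, fun v => (hb v).le⟩) F

theorem exists_bound_of_hits (S : LadderSystem mu kap chi e) {σ : Type*} {c : W → W → σ} {ε : σ}
    (hc : Hits kap c ε) {t : W → Set W} (htd : Pairwise (Function.onFun Disjoint t))
    (htk : ∀ a, Cardinal.mk (t a) < kap) {X : Set W} (hX : IsCofinal X) :
    ∃ a b, ∀ β, b ≤ β → ∃ α ∈ X, α < a ∧ HitsOn c ε (t α) (t β) := by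
  by_contra! hcon
  choose y hby hy using hcon
  choose x hxX hx using hX
  choose g hg using S.exists_gt
  let z : W → W := fun w => y w (max w (g (x w)))
  obtain ⟨s, hs⟩ := S.exists_rec fun w => g (max (x w) (z w))
  have hz : ∀ w, w ≤ z w := fun w => (le_max_left _ _).trans (hby _ _)
  have hxz : ∀ w, x w < z w := fun w => (hg _).trans_le ((le_max_right _ _).trans (hby _ _))
  have hlt : ∀ v w, v < w → z (s v) < s w := fun v w hvw =>
    ((le_max_right _ _).trans_lt (hg _)).trans_le (hs v w hvw)
  have hdisj : ∀ v w, v < w →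
      Disjoint (t (x (s v)) ∪ t (z (s v))) (t (x (s w)) ∪ t (z (s w))) := fun v w hvw => by
    have h1 := hlt v w hvw
    have h2 := hxz (s v)
    have h3 := hx (s w)
    have h4 := hxz (s w)
    simp only [disjoint_union_left, disjoint_union_right]
    exact ⟨⟨htd (h2.trans (h1.trans_le h3)).ne, htd (h1.trans_le h3).ne⟩,
      ⟨htd (h2.trans (h1.trans_le (h3.trans h4.le))).ne, htd (h1.trans_le (h3.trans h4.le)).ne⟩⟩
  obtain ⟨v, w, hvw, H⟩ := hc (fun v => t (x (s v)) ∪ t (z (s v)))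
    (fun v w hvw => hvw.lt_or_gt.elim (hdisj v w) fun hwv => (hdisj w v hwv).symm)
    fun v => (Cardinal.mk_union_le _ _).trans_lt
      (Cardinal.add_lt_of_lt S.aleph0_le (htk _) (htk _))
  exact hy (s w) _ (x (s v)) (hxX _) ((hxz _).trans (hlt v w hvw))
    (H.mono subset_union_left subset_union_right)

theorem exists_closurePts_gt (S : LadderSystem mu kap chi e) (h : W → W) (y : W) :
    ∃ x ∈ closurePts h, y < x := by
  have hg : ∀ v : W, ∃ b, v < b ∧ ∀ u ≤ v, h u < b := fun v => by
    obtain ⟨b, hb⟩ := S.exists_gt_of_set (s := Iic v ∪ h '' Iic v)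
      ((Cardinal.mk_union_le _ _).trans (Cardinal.add_le_of_le S.aleph0_le_mu (S.mk_Iic_le v)
        (Cardinal.mk_image_le.trans (S.mk_Iic_le v))))
    exact ⟨b, hb v (Or.inl le_rfl), fun u hu => hb _ (Or.inr ⟨u, hu, rfl⟩)⟩
  choose g hg1 hg2 using hg
  obtain ⟨b, hb⟩ := S.exists_gt_of_index (Cardinal.mk_nat.le.trans S.aleph0_le_mu)
    fun n : ℕ => g^[n] y
  obtain ⟨x, hx, hmin⟩ := WellFounded.has_min (wellFounded_lt (α := W))
    {x | ∀ n : ℕ, g^[n] y ≤ x} ⟨b, fun n => (hb n).le⟩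
  refine ⟨x, fun u hu => ?_, (hg1 y).trans_le (hx 1)⟩
  have hu' : ∃ n : ℕ, u < g^[n] y := by
    by_contra! hcon
    exact hmin u hcon hu
  obtain ⟨n, hn⟩ := hu'
  refine (hg2 _ u hn.le).trans_le ?_
  rw [← Function.iterate_succ_apply' g n y]
  exact hx (n + 1)

theorem exists_closurePts_ladder_gt (S : LadderSystem mu kap chi e) (h : W → W)
    {th : Cardinal.{0}} (hth : Cardinal.aleph0 ≤ th) (hlt : th < mu) :
    ∃ x ∈ closurePts h, th < Cardinal.mk (e x) := by
  have hex : ∃ x, th < Cardinal.mk ↑(closurePts h ∩ Iio x) := by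
    by_contra! hcon
    have hle : Cardinal.mk (closurePts h) ≤ mu := by
      by_contra! hgt
      obtain ⟨s, hs, hs'⟩ := (Cardinal.le_mk_iff_exists_subset).1 hgt.le
      obtain ⟨b, hb⟩ := S.exists_gt_of_set hs'.le
      refine ((hcon b).trans_lt hlt).not_ge ?_
      rw [← hs']
      exact Cardinal.mk_le_mk_of_subset fun x hx => ⟨hs hx, hb x hx⟩
    obtain ⟨b, hb⟩ := S.exists_gt_of_set hle
    obtain ⟨x, hx, hbx⟩ := S.exists_closurePts_gt h b
    exact (hb x hx).not_gt hbx
  obtain ⟨x, hx, hmin⟩ := WellFounded.has_min (wellFounded_lt (α := W))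
    {x | th < Cardinal.mk ↑(closurePts h ∩ Iio x)} hex
  have hIic : ∀ y < x, Cardinal.mk ↑(closurePts h ∩ Iic y) ≤ th := fun y hy => by
    have hy' : Cardinal.mk ↑(closurePts h ∩ Iio y) ≤ th := not_lt.1 fun hcon => hmin y hcon hy
    have hsub : closurePts h ∩ Iic y ⊆ (closurePts h ∩ Iio y) ∪ {y} := fun z hz =>
      (lt_or_eq_of_le hz.2).imp (fun hzy => ⟨hz.1, hzy⟩) id
    exact (Cardinal.mk_le_mk_of_subset hsub).trans ((Cardinal.mk_union_le _ _).trans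
      (Cardinal.add_le_of_le hth hy' ((finite_singleton y).lt_aleph0.le.trans hth)))
  refine ⟨x, mem_closurePts_of_cofinal fun y hy => ?_, ?_⟩
  · by_contra! hcon
    have hsub : closurePts h ∩ Iio x ⊆ closurePts h ∩ Iic y := fun z hz =>
      ⟨hz.1, not_lt.1 fun hyz => (hcon z hz.1 hyz).not_gt hz.2⟩
    exact ((Cardinal.mk_le_mk_of_subset hsub).trans (hIic y hy)).not_gt hx
  · by_contra! hcon
    have hsub : closurePts h ∩ Iio x ⊆ ⋃ z : e x, closurePts h ∩ Iic z.1 := fun y hy => by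
      obtain ⟨z, hz, hyz⟩ := S.ladder_cofinal x y hy.2
      exact mem_iUnion.2 ⟨⟨z, hz⟩, hy.1, hyz⟩
    exact ((Cardinal.mk_le_mk_of_subset hsub).trans (mk_iUnion_le_of_le hth hcon _ fun z =>
      hIic z.1 (S.ladder_subset x z.2))).not_gt hx

theorem exists_reach_of_le (S : LadderSystem mu kap chi e) {x z : W} (hxz : x ≤ z) :
    ∃ th < mu, ∀ ch, th ≤ ch → ∀ h, Reach e h ch z x := by
  induction z using WellFoundedLT.induction with
  | ind z ih =>
    rcases hxz.eq_or_lt with rfl | hlt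
    · exact ⟨0, (Cardinal.aleph0_pos).trans_le S.aleph0_le_mu, fun _ _ _ => .refl⟩
    · obtain ⟨y, hy, hxy⟩ := S.ladder_cofinal z x hlt
      obtain ⟨th, hth, H⟩ := ih y (S.ladder_subset z hy) hxy
      refine ⟨max th (Cardinal.mk (e z)), max_lt hth (S.ladder_lt z), fun ch hch h => ?_⟩
      exact .head ⟨(le_max_right _ _).trans hch, y, hy, Or.inl rfl⟩
        (H ch ((le_max_left _ _).trans hch) h)

/-- Along an increasing family of functions, the descent from `x` towards a point `b` of large
cofinality eventually stabilizes at a point of large cofinality that is closed under all the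
functions of the family. -/
theorem exists_stable_reach (S : LadderSystem mu kap chi e) {w : W} {h : W → W → W}
    (hmono : ∀ v v', v ≤ v' → v' < w → h v ≤ h v') (hw : ∃ v, v < w) {ch : Cardinal.{0}} {b : W}
    (hb : ∀ v < w, b ∈ closurePts (h v)) (hbch : ch < Cardinal.mk (e b)) {x : W} (hbx : b ≤ x)
    (hx : (∀ v < w, x ∈ closurePts (h v)) ∨ Cardinal.mk (e x) ≤ ch) :
    ∃ v < w, ∃ y, (∀ u < w, y ∈ closurePts (h u)) ∧ ch < Cardinal.mk (e y) ∧
      ∀ u, v ≤ u → u < w → Reach e (h u) ch x y := by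
  induction x using WellFoundedLT.induction with
  | ind x ih =>
    by_cases hxch : Cardinal.mk (e x) ≤ ch
    · have hne : b ≠ x := by
        rintro rfl
        exact hbch.not_ge hxch
      obtain ⟨z, hz, hbz⟩ := S.ladder_cofinal x b (lt_of_le_of_ne hbx hne)
      obtain ⟨v₀, hv₀⟩ := hw
      obtain ⟨y₀, hy₀⟩ := exists_isGreatest_closurePts (h v₀) z
      obtain ⟨y, ⟨v, hv, hy⟩, hmin⟩ := WellFounded.has_min (wellFounded_lt (α := W))
        {y | ∃ v < w, IsGreatest (closurePts (h v) ∩ Iic z) y} ⟨y₀, v₀, hv₀, hy₀⟩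
      have hst : ∀ u, v ≤ u → u < w → IsGreatest (closurePts (h u) ∩ Iic z) y := by
        intro u hvu huw
        obtain ⟨y', hy'⟩ := exists_isGreatest_closurePts (h u) z
        have h1 : y ≤ y' := not_lt.1 fun hlt => hmin y' ⟨u, huw, hy'⟩ hlt
        have h2 : y' ≤ y := hy.2 ⟨closurePts_anti (hmono v u hvu huw) hy'.1.1, hy'.1.2⟩
        rwa [le_antisymm h1 h2]
      have hycl : ∀ u < w, y ∈ closurePts (h u) := fun u huw => by
        rcases le_total v u with hvu | huv
        · exact (hst u hvu huw).1.1
        · exact closurePts_anti (hmono u v huv hv) hy.1.1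
      obtain ⟨v', hv', y', hy'cl, hy'ch, hr⟩ := ih y
        (lt_of_le_of_lt hy.1.2 (S.ladder_subset x hz)) (hy.2 ⟨hb v hv, hbz⟩) (Or.inl hycl)
      refine ⟨max v v', max_lt hv hv', y', hy'cl, hy'ch, fun u hu huw => ?_⟩
      exact .head ⟨hxch, z, hz, Or.inr (hst u ((le_max_left _ _).trans hu) huw)⟩
        (hr u ((le_max_right _ _).trans hu) huw)
    · obtain ⟨v₀, hv₀⟩ := hw
      exact ⟨v₀, hv₀, x, hx.resolve_right hxch, not_le.1 hxch, fun _ _ _ => .refl⟩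

/-- A form of club guessing: for a suitable `h`, every club contains, for some `x` and all `i`,
a point of cofinality greater than `chi i` reachable from `x`. -/
theorem exists_guess (S : LadderSystem mu kap chi e) :
    ∃ h : W → W, ∀ h' : W → W, ∃ x, ∀ i, ∃ y ∈ closurePts h',
      Reach e h (chi i) x y ∧ chi i < Cardinal.mk (e y) := by
  by_contra! hcon
  choose Φ hΦ using hcon
  obtain ⟨h, hh⟩ := exists_rec_le (W := W) (P := W → W) (fun w f => by
    have : ∀ y, ∃ b, ∀ v, f v y < b := fun y => S.exists_gt_of_index (S.mk_Iio_le w) _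
    choose b hb using this
    exact ⟨b, fun v y => (hb y v).le⟩) fun g => g ⊔ Φ g
  have hmono : Monotone h := fun v v' hvv' => by
    rcases hvv'.eq_or_lt with rfl | hlt
    · exact le_rfl
    · exact le_sup_left.trans (hh v v' hlt)
  obtain ⟨w, -, hw⟩ := S.exists_closurePts_ladder_gt id S.aleph0_le S.kap_lt
  have hw0 : ∃ v, v < w := by
    obtain ⟨y, hy, -⟩ := S.ladder_bdd w ∅ (empty_subset _)
      (by simpa using (zero_le).trans_lt hw)
    exact ⟨y, hy⟩
  have hb : ∀ i, ∃ b ∈ closurePts (h w), chi i < Cardinal.mk (e b) := fun i =>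
    S.exists_closurePts_ladder_gt (h w) (S.aleph0_le_chi i) (S.chi_lt i)
  choose b hbcl hbch using hb
  have hI : Cardinal.mk I ≤ mu := S.mk_index_le.trans S.kap_lt.le
  obtain ⟨x₀, hx₀⟩ := S.exists_gt_of_index hI b
  obtain ⟨x, ⟨hx₀x, hxmin⟩⟩ : ∃ x, x₀ < x ∧ ∀ y < x, y ≤ x₀ := by
    obtain ⟨x₁, hx₁⟩ := S.exists_gt_of_index (ι := Unit)
      ((Cardinal.mk_le_aleph0).trans S.aleph0_le_mu) fun _ => x₀
    obtain ⟨x, hx, hmin⟩ := WellFounded.has_min (wellFounded_lt (α := W)) (Ioi x₀) ⟨x₁, hx₁ ()⟩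
    exact ⟨x, hx, fun y hy => not_lt.1 fun hlt => hmin y hlt hy⟩
  have hxe : ∀ i, Cardinal.mk (e x) ≤ chi i := fun i => by
    by_contra! hlt
    obtain ⟨y, hy, hy'⟩ := S.ladder_bdd x {x₀} (by simpa using hx₀x)
      (((finite_singleton x₀).lt_aleph0.trans_le (S.aleph0_le_chi i)).trans hlt)
    exact (hxmin y hy).not_gt (hy' x₀ rfl)
  have hstab : ∀ i, ∃ v < w, ∃ y, (∀ u < w, y ∈ closurePts (h u)) ∧ chi i < Cardinal.mk (e y) ∧
      ∀ u, v ≤ u → u < w → Reach e (h u) (chi i) x y := fun i =>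
    S.exists_stable_reach (fun v v' hvv' _ => hmono hvv') hw0
      (fun v hv => closurePts_anti (hmono hv.le) (hbcl i)) (hbch i)
      ((hx₀ i).trans hx₀x).le (Or.inr (hxe i))
  choose v hvw y hycl hych hreach using hstab
  have hbdd : ∀ s ⊆ Iio w, Cardinal.mk s ≤ kap → ∃ u < w, ∀ z ∈ s, z < u := fun s hs hs' =>
    S.ladder_bdd w s hs (hs'.trans_lt hw)
  obtain ⟨u, huw, hu⟩ := hbdd (range v) (by rintro _ ⟨i, rfl⟩; exact hvw i)
    (Cardinal.mk_range_le.trans S.mk_index_le)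
  obtain ⟨u', hu'w, hu'⟩ := hbdd {u} (by simpa using huw)
    ((finite_singleton u).lt_aleph0.le.trans S.aleph0_le)
  obtain ⟨i, hi⟩ := hΦ (h u) x
  exact (hi (y i) (closurePts_anti (le_sup_right.trans (hh u u' (hu' u rfl))) (hycl i u' hu'w))
    (hreach i u (hu _ ⟨i, rfl⟩).le huw)).not_gt (hych i)

theorem exists_unbounded_lead (S : LadderSystem mu kap chi e) {h : W → W}
    (hh : ∀ h' : W → W, ∃ x, ∀ i, ∃ y ∈ closurePts h',
      Reach e h (chi i) x y ∧ chi i < Cardinal.mk (e y))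
    {t : W → Set W} (htd : Pairwise (Function.onFun Disjoint t))
    (htk : ∀ a, Cardinal.mk (t a) < kap) (h' : W → W) :
    ∃ x ∈ closurePts h', ∃ i η, IsCofinal {β | Lead e h (chi i) (t β) x η} := by
  obtain ⟨d, hd⟩ := hh h'
  obtain ⟨b₀, hb₀⟩ := S.exists_forall_subset_Ici htd d
  by_contra! hcon
  have hbd : ∀ p : Iic d × I × Iic d, ∃ b, ∀ β, b ≤ β → p.1.1 ∈ closurePts h' →
      ¬ Lead e h (chi p.2.1) (t β) p.1 p.2.2 := fun p => by
    by_cases hp : p.1.1 ∈ closurePts h'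
    · have := hcon p.1 hp p.2.1 p.2.2
      simp only [IsCofinal, not_forall, not_exists, not_and, mem_ofPred_eq] at this
      obtain ⟨b, hb⟩ := this
      exact ⟨b, fun β hβ _ hl => hb β hl hβ⟩
    · exact ⟨d, fun _ _ hp' => absurd hp' hp⟩
  choose B hB using hbd
  obtain ⟨b, hb⟩ := S.exists_gt_of_index (mk_prod_le_of_le S.aleph0_le_mu (S.mk_Iic_le d)
    (mk_prod_le_of_le S.aleph0_le_mu (S.mk_index_le.trans S.kap_lt.le) (S.mk_Iic_le d))) B
  have hge : ∀ ζ : t (max b b₀), d ≤ ζ.1 := fun ζ => hb₀ _ (le_max_right _ _) ζ.2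
  choose th hth hreach using fun ζ => S.exists_reach_of_le (hge ζ)
  obtain ⟨i, hi⟩ := S.dominate th (htk _) hth
  obtain ⟨x, hx, hdx, hxe⟩ := hd i
  have hxd : x ≤ d := hdx.le S.ladder_subset
  obtain ⟨η, hη, hbelow⟩ := S.ladder_bdd x
    (⋃ ζ : t (max b b₀), {y | Reach e h (chi i) ζ y} ∩ Iio x)
    (iUnion_subset fun ζ => inter_subset_right)
    ((mk_iUnion_le_of_le (S.aleph0_le_chi i) ((htk _).le.trans (S.kap_le i)) _ fun ζ =>
      (Cardinal.mk_le_mk_of_subset inter_subset_left).trans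
        (mk_reach_le (S.aleph0_le_chi i) _)).trans_lt hxe)
  refine hB (⟨x, hxd⟩, i, ⟨η, hη.le.trans hxd⟩) (max b b₀) ((hb _).le.trans (le_max_left _ _)) hx
    ⟨hη, fun ζ hζ => hxd.trans (hge ⟨ζ, hζ⟩), fun ζ hζ =>
      ⟨(hreach ⟨ζ, hζ⟩ _ (hi _) h).trans hdx, fun y hy hyx => ?_⟩⟩
  exact (hbelow y (mem_iUnion.2 ⟨⟨ζ, hζ⟩, hy, hyx⟩)).le

theorem exists_stationary_lead (S : LadderSystem mu kap chi e) {h : W → W}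
    (hh : ∀ h' : W → W, ∃ x, ∀ i, ∃ y ∈ closurePts h',
      Reach e h (chi i) x y ∧ chi i < Cardinal.mk (e y))
    {t : W → Set W} (htd : Pairwise (Function.onFun Disjoint t))
    (htk : ∀ a, Cardinal.mk (t a) < kap) {M : Type} (hM : Cardinal.mk M ≤ mu) {r : W → M → W}
    (hr : ∀ x, ∀ y < x, ∃ m, r x m = y) (ε : W) :
    ∃ i η m, ∀ h' : W → W, ∃ x ∈ closurePts h', r x m = ε ∧
      IsCofinal {β | Lead e h (chi i) (t β) x η} := by
  by_contra! hcon
  choose H hH using hcon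
  have hg : ∀ v, ∃ b, (∀ p : I × Iic v × M × Iic v, H p.1 p.2.1.1 p.2.2.1 p.2.2.2.1 < b) ∧ ε < b :=
    fun v => by
      obtain ⟨b, hb⟩ := S.exists_gt_of_index
        (mk_prod_le_of_le S.aleph0_le_mu (S.mk_index_le.trans S.kap_lt.le)
          (mk_prod_le_of_le S.aleph0_le_mu (S.mk_Iic_le v)
            (mk_prod_le_of_le S.aleph0_le_mu hM (S.mk_Iic_le v))))
        fun p : I × Iic v × M × Iic v => H p.1 p.2.1.1 p.2.2.1 p.2.2.2.1
      obtain ⟨b', hb'⟩ := S.exists_gt ε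
      exact ⟨max b b', fun p => (hb p).trans_le (le_max_left _ _),
        hb'.trans_le (le_max_right _ _)⟩
  choose g hg hgε using hg
  obtain ⟨x, hx, i, η, hcof⟩ := S.exists_unbounded_lead hh htd htk g
  obtain ⟨β, hβ, -⟩ := hcof ε
  have hηx : η < x := hβ.1
  obtain ⟨m, hm⟩ := hr x ε ((hgε η).trans (hx η hηx))
  refine hH i η m x (fun v hv => ?_) hm hcof
  exact (hg (max η v) (i, ⟨η, le_max_left _ _⟩, m, ⟨v, le_max_right _ _⟩)).trans
    (hx _ (max_lt hηx hv))

end LadderSystem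

section Coloring

variable {W I K M : Type} [LinearOrder W]

/-- The least point above `ξ` reachable from `ζ`. -/
def upperPt (e : W → Set W) (h : W → W) (chi : Cardinal.{0}) (ξ ζ : W) : W :=
  @Classical.epsilon W ⟨ξ⟩ fun y => IsLeast {y | Reach e h chi ζ y ∧ ξ ≤ y} y

/-- The least point `y` reachable from `ξ` such that no point of `e b` lies in `[y, ξ)`. -/
def lowerPt (e : W → Set W) (h : W → W) (chi : Cardinal.{0}) (b ξ : W) : W :=
  @Classical.epsilon W ⟨ξ⟩ fun y =>
    IsLeast {y | Reach e h chi ξ y ∧ ∀ x ∈ e b, y ≤ x → ξ ≤ x} y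

theorem upperPt_eq {e : W → Set W} {h : W → W} {chi : Cardinal.{0}} {ξ ζ y : W}
    (hy : IsLeast {y | Reach e h chi ζ y ∧ ξ ≤ y} y) : upperPt e h chi ξ ζ = y :=
  (Classical.epsilon_spec ⟨y, hy⟩).unique hy

theorem lowerPt_eq {e : W → Set W} {h : W → W} {chi : Cardinal.{0}} {b ξ y : W}
    (hy : IsLeast {y | Reach e h chi ξ y ∧ ∀ x ∈ e b, y ≤ x → ξ ≤ x} y) :
    lowerPt e h chi b ξ = y :=
  (Classical.epsilon_spec ⟨y, hy⟩).unique hy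

/-- The coloring obtained from `c₀ : [W]² → I × K` and `c k : [W]² → M`: the color `(i, k)` of
`c₀` tells which points to descend to and which `c k` to apply to them, and the resulting `m : M`
is decoded by means of `r : W → M → W`. -/
def steppedUp (chi : I → Cardinal.{0}) (e : W → Set W) (h : W → W) (c₀ : W → W → I × K)
    (c : K → W → W → M) (r : W → M → W) (ξ ζ : W) : W :=
  let ch := chi (c₀ ξ ζ).1
  let b := upperPt e h ch ξ ζ
  r b (c (c₀ ξ ζ).2 (lowerPt e h ch b ξ) b)

theorem steppedUp_eq {chi : I → Cardinal.{0}} {e : W → Set W} {h : W → W} {c₀ : W → W → I × K}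
    {c : K → W → W → M} {r : W → M → W} {ξ ζ a b η x₀ : W} {s t : Set W} {i : I} {k : K}
    (hξ : ξ ∈ s) (hζ : ζ ∈ t) (hs : Lead e h (chi i) s a η) (ht : Lead e h (chi i) t b η)
    (hc₀ : c₀ ξ ζ = (i, k)) (hx₀ : x₀ ∈ e b) (hηx₀ : η < x₀) (hx₀a : x₀ < a) (hξb : ξ < b)
    (he : ∀ x ∈ e b, a ≤ x → ξ ≤ x) : steppedUp chi e h c₀ c r ξ ζ = r b (c k a b) := by
  have hb : upperPt e h (chi i) ξ ζ = b := by
    refine upperPt_eq ⟨⟨(ht.2.2 ζ hζ).1, hξb.le⟩, fun y hy => not_lt.1 fun hyb => ?_⟩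
    have h1 := (ht.2.2 ζ hζ).2 y hy.1 hyb
    exact ((h1.trans_lt hs.1).trans_le ((hs.2.1 ξ hξ))).not_ge hy.2
  have ha : lowerPt e h (chi i) b ξ = a := by
    refine lowerPt_eq ⟨⟨(hs.2.2 ξ hξ).1, he⟩, fun y hy => not_lt.1 fun hya => ?_⟩
    have h1 := (hs.2.2 ξ hξ).2 y hy.1 hya
    exact (hx₀a.trans_le (hs.2.1 ξ hξ)).not_ge (hy.2 x₀ hx₀ (h1.trans hηx₀.le))
  simp only [steppedUp, hc₀, hb, ha]

theorem LadderSystem.hits_steppedUp [WellFoundedLT W] {mu kap : Cardinal.{0}}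
    {chi : I → Cardinal.{0}} {e : W → Set W} (S : LadderSystem mu kap chi e) {h : W → W}
    (hh : ∀ h' : W → W, ∃ x, ∀ i, ∃ y ∈ closurePts h',
      Reach e h (chi i) x y ∧ chi i < Cardinal.mk (e y))
    {c₀ : W → W → I × K} (hc₀ : ∀ p, Hits kap c₀ p) {c : K → W → W → M}
    (hc : ∀ m, ∃ k, Hits kap (c k) m) (hM : Cardinal.mk M ≤ mu) {r : W → M → W}
    (hr : ∀ x, ∀ y < x, ∃ m, r x m = y) (ε : W) : Hits kap (steppedUp chi e h c₀ c r) ε := by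
  intro t htd htk
  obtain ⟨i, η, m, hst⟩ := S.exists_stationary_lead hh htd htk hM hr ε
  obtain ⟨k, hk⟩ := hc m
  let X : W → Set W := fun x => {β | Lead e h (chi i) (t β) x η}
  let T : Set W := {x | r x m = ε ∧ IsCofinal (X x)}
  have hηT : ∀ x ∈ T, η < x := fun x hx => by
    obtain ⟨β, hβ, -⟩ := hx.2 η
    exact hβ.1
  have hT : IsCofinal T := fun b => by
    obtain ⟨x, hx, hxT⟩ := hst fun _ => b
    exact ⟨x, hxT, (hx η (hηT x hxT)).le⟩
  have hA : ∀ x, ∃ a b a', x ∈ T →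
      (∀ β, b ≤ β → ∃ α ∈ X x, α < a ∧ HitsOn c₀ (i, k) (t α) (t β)) ∧
        x < a' ∧ ∀ α < a, ∀ ξ ∈ t α, ξ < a' := fun x => by
    by_cases hx : x ∈ T
    · obtain ⟨a, b, hab⟩ := S.exists_bound_of_hits (hc₀ (i, k)) htd htk hx.2
      obtain ⟨y, hy⟩ := S.exists_gt_of_set (mk_iUnion_le_of_le S.aleph0_le_mu (S.mk_Iio_le a)
        (fun α => t α.1) fun α => (htk _).le.trans S.kap_lt.le)
      obtain ⟨z, hz⟩ := S.exists_gt x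
      exact ⟨a, b, max y z, fun _ => ⟨hab, hz.trans_le (le_max_right _ _), fun α hα ξ hξ =>
        (hy ξ (mem_iUnion.2 ⟨⟨α, hα⟩, hξ⟩)).trans_le (le_max_left _ _)⟩⟩
    · exact ⟨x, x, x, fun hx' => absurd hx' hx⟩
  choose a b a' hA using hA
  have hB : ∀ w, ∃ p q, ∀ β, q ≤ β →
      ∃ α ∈ T ∩ Ici w, α < p ∧ HitsOn (c k) m {α} {β} := fun w => by
    refine S.exists_bound_of_hits (t := fun x => {x}) hk
      (fun x y hxy => disjoint_singleton.2 hxy)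
      (fun x => (finite_singleton x).lt_aleph0.trans_le S.aleph0_le) fun x => ?_
    obtain ⟨y, hy, hxy⟩ := hT (max x w)
    exact ⟨y, ⟨hy, (le_max_right _ _).trans hxy⟩, (le_max_left _ _).trans hxy⟩
  choose p q hpq using hB
  have hF : ∀ w, ∃ f, w < f ∧ q w < f ∧ ∀ x < p w, a' x < f := fun w => by
    obtain ⟨y, hy⟩ := S.exists_gt_of_index (S.mk_Iio_le (p w)) fun x => a' x.1
    obtain ⟨z, hz⟩ := S.exists_gt (max w (q w))
    exact ⟨max y z, ((le_max_left _ _).trans_lt hz).trans_le (le_max_right _ _),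
      ((le_max_right _ _).trans_lt hz).trans_le (le_max_right _ _),
      fun x hx => (hy ⟨x, hx⟩).trans_le (le_max_left _ _)⟩
  choose F hF hqF ha'F using hF
  obtain ⟨s, hs⟩ := S.exists_rec F
  have hmono : StrictMono s := fun v w hvw => (hF _).trans_le (hs v w hvw)
  have hU : ∀ v : W, ∃ U ⊆ Ioi v, Cardinal.mk U = mu := fun v =>
    Cardinal.le_mk_iff_exists_subset.1 (S.mk_Ioi v).le
  choose U hUv hU using hU
  have hH : ∀ v, ∃ y, v < y ∧ ∀ u ∈ U v, F (s u) < y := fun v => by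
    obtain ⟨y, hy⟩ := S.exists_gt_of_index (hU v).le fun u => F (s u.1)
    obtain ⟨z, hz⟩ := S.exists_gt v
    exact ⟨max y z, hz.trans_le (le_max_right _ _),
      fun u hu => (hy ⟨u, hu⟩).trans_le (le_max_left _ _)⟩
  choose H hvH hH using hH
  obtain ⟨y, hyH, hyT⟩ := hst H
  have hyT' : y ∈ T := hyT
  obtain ⟨x₀, hx₀, hηx₀⟩ := S.ladder_cofinal y (H η) (hyH η (hηT y hyT))
  have hx₀y : x₀ < y := S.ladder_subset y hx₀
  have hFy : ∀ u : U x₀, F (s u) < y := fun u => (hH x₀ u u.2).trans (hyH x₀ hx₀y)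
  choose z hzT hzp hzc using fun u : U x₀ => hpq (s u) y ((hqF _).trans (hFy u)).le
  obtain ⟨u, hu⟩ : ∃ u : U x₀, ∀ x ∈ e y, z u ≤ x → a' (z u) ≤ x := by
    by_contra! hcon
    choose x hxe hzx hxa using hcon
    have hx : StrictMono x := fun u v huv =>
      (hxa u).trans (((ha'F _ _ (hzp u)).trans_le (hs u v huv)).trans_le
        ((hzT v).2.trans (hzx v)))
    have hinj : Function.Injective fun u => (⟨x u, hxe u⟩ : e y) := fun u v huv =>
      hx.injective (congrArg Subtype.val huv)
    have := Cardinal.mk_le_of_injective hinj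
    rw [hU] at this
    exact (S.ladder_lt y).not_ge this
  have hx₀z : x₀ < z u := (hUv x₀ u.2).trans_le ((hmono.le_apply).trans (hzT u).2)
  have ha'y : a' (z u) < y := (ha'F _ _ (hzp u)).trans (hFy u)
  obtain ⟨hab, -, ha'⟩ := hA (z u) (hzT u).1
  obtain ⟨β, hβX, hβ⟩ := hyT.2 (max (a (z u)) (b (z u)))
  obtain ⟨α, hαX, hαa, hαβ⟩ := hab β ((le_max_right _ _).trans hβ)
  refine ⟨α, β, hαa.trans_le ((le_max_left _ _).trans hβ), fun ξ hξ ζ hζ => ?_⟩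
  have hξa := ha' α hαa ξ hξ
  have hξζ : ξ < ζ := (hξa.trans ha'y).trans_le (hβX.2.1 ζ hζ)
  have hcξ := hαβ ξ hξ ζ hζ
  have hcz := hzc u _ rfl _ rfl
  rw [min_eq_left hξζ.le, max_eq_right hξζ.le] at hcξ ⊢
  rw [min_eq_left ((hξa.trans ha'y).trans_le' (hαX.2.1 ξ hξ)).le,
    max_eq_right ((hξa.trans ha'y).trans_le' (hαX.2.1 ξ hξ)).le] at hcz
  rw [steppedUp_eq hξ hζ hαX hβX hcξ hx₀ ((hvH η).trans_le hηx₀) hx₀z (hξa.trans ha'y)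
    fun x hx hzx => hξa.le.trans (hu x hx hzx), hcz]
  exact hyT.1

end Coloring

section OrdinalToType

variable {o : Ordinal.{0}}

/-- The ordinal below `o` corresponding to a point of `o.ToType`. -/
def toOrdinal (x : o.ToType) : Ordinal := (Ordinal.ToType.mk.symm x).1

theorem toOrdinal_lt (x : o.ToType) : toOrdinal x < o := (Ordinal.ToType.mk.symm x).2

theorem toOrdinal_strictMono : StrictMono (toOrdinal (o := o)) := fun _ _ hxy =>
  Ordinal.ToType.mk.symm.strictMono hxy

theorem exists_toOrdinal_eq {a : Ordinal} (ha : a < o) : ∃ x : o.ToType, toOrdinal x = a :=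
  ⟨Ordinal.ToType.mk ⟨a, ha⟩, by simp [toOrdinal]⟩

theorem exists_ordinal_decoding {X : Type} [Nonempty X] {th : Cardinal.{0}}
    (hX : Cardinal.mk X ≤ th) : ∃ g : Ordinal → X, ∀ x, ∃ τ < th.ord, g τ = x := by
  rw [← Cardinal.mk_ord_toType th] at hX
  obtain ⟨f⟩ := hX
  have hinj : Function.Injective fun x => toOrdinal (f x) :=
    toOrdinal_strictMono.injective.comp f.injective
  exact ⟨Function.invFun fun x => toOrdinal (f x),
    fun x => ⟨_, toOrdinal_lt (f x), Function.leftInverse_invFun hinj x⟩⟩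

end OrdinalToType

theorem IsSingular.aleph0_le_cof {mu : Cardinal.{0}} (hmu : IsSingular mu) :
    Cardinal.aleph0 ≤ Ordinal.cof mu.ord :=
  Ordinal.aleph0_le_cof_iff.2 (Ordinal.one_lt_cof_iff.2 (Cardinal.isSuccLimit_ord hmu.1))

theorem IsSingular.succ_lt {mu th : Cardinal.{0}} (hmu : IsSingular mu) (hth : th < mu) :
    Order.succ th < mu := by
  have hlt : max th (Ordinal.cof mu.ord) < mu := max_lt hth hmu.2
  have hreg := Cardinal.isRegular_succ (hmu.aleph0_le_cof.trans (le_max_right th _))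
  refine (Order.succ_le_succ (le_max_left th (Ordinal.cof mu.ord))).trans_lt
    ((Order.succ_le_of_lt hlt).lt_of_ne fun heq => ?_)
  rw [heq] at hreg
  exact hmu.2.ne hreg.cof_ord

theorem IsSingular.exists_ladderSystem {mu : Cardinal.{0}} (hmu : IsSingular mu) :
    ∃ (I : Type) (chi : I → Cardinal.{0}) (e : (sucOrd mu).ToType → Set (sucOrd mu).ToType),
      LadderSystem mu (Ordinal.cof mu.ord) chi e := by
  have hW : Cardinal.mk (sucOrd mu).ToType = Order.succ mu := Cardinal.mk_ord_toType _
  have hIio : ∀ x : (sucOrd mu).ToType, Cardinal.mk (Iio x) ≤ mu := fun x => by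
    have hlt := Cardinal.mk_Iio_lt x (by rw [hW, Ordinal.type_toType, sucOrd])
    rwa [hW, Order.lt_succ_iff] at hlt
  obtain ⟨I, hI, hIcard⟩ := Order.exists_cof_eq mu.ord.ToType
  rw [Ordinal.cof_toType] at hIcard
  choose s hs hscard using fun x : (sucOrd mu).ToType => Order.exists_cof_eq (Iio x)
  have hcard : ∀ x, Cardinal.mk (Subtype.val '' s x : Set (sucOrd mu).ToType) =
      Order.cof (Iio x) := fun x => by
    rw [Cardinal.mk_image_eq Subtype.val_injective, hscard]
  refine ⟨I, fun i => max (Ordinal.cof mu.ord) (toOrdinal i.1).card, fun x => Subtype.val '' s x,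
    ⟨hW, hIio, hmu.aleph0_le_cof, hmu.2, hIcard.le, fun i => le_max_left _ _,
      fun i => max_lt hmu.2 (Cardinal.lt_ord.1 (toOrdinal_lt _)), fun f hf hfmu => ?_, ?_, ?_, ?_,
      ?_⟩⟩
  · have hsup : ⨆ j, f j < mu := Cardinal.iSup_lt_of_lt_cof_ord hf hfmu
    obtain ⟨x, hx⟩ := exists_toOrdinal_eq (Cardinal.ord_lt_ord.2 hsup)
    obtain ⟨i, hi, hxi⟩ := hI x
    refine ⟨⟨i, hi⟩, fun j => le_max_of_le_right ?_⟩
    refine (le_ciSup Cardinal.bddAbove_of_small j).trans (Cardinal.ord_le.1 ?_)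
    rw [← hx]
    exact toOrdinal_strictMono.monotone hxi
  · rintro x _ ⟨y, -, rfl⟩
    exact y.2
  · intro x y hy
    obtain ⟨z, hz, hyz⟩ := hs x ⟨y, hy⟩
    exact ⟨z, ⟨z, hz, rfl⟩, hyz⟩
  · intro x
    rw [hcard]
    refine ((Order.cof_le_cardinalMk _).trans (hIio x)).lt_of_ne fun heq => ?_
    have := Order.cof_ord_cof (Iio x)
    rw [heq] at this
    exact hmu.2.ne this
  · intro x A hA hAcard
    rw [hcard] at hAcard
    by_contra! hcon
    have hcof : IsCofinal (Subtype.val ⁻¹' A : Set (Iio x)) := fun y => by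
      obtain ⟨z, hz, hyz⟩ := hcon y y.2
      exact ⟨⟨z, hA hz⟩, hz, hyz⟩
    exact (((Order.cof_le hcof).trans
      (Cardinal.mk_preimage_of_injective _ _ Subtype.val_injective)).trans_lt hAcard).false

theorem Pr1With.hits {mu th : Cardinal.{0}} {c : Ordinal → Ordinal → Ordinal}
    (hc : Pr1With mu th c) {σ : Type*} (g : Ordinal → σ) {τ : Ordinal} (hτ : τ < th.ord) :
    Hits (Ordinal.cof mu.ord)
      (fun x y : (sucOrd mu).ToType => g (c (toOrdinal x) (toOrdinal y))) (g τ) := by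
  intro t htd htk
  let T : Ordinal → Set Ordinal := fun a => {o | ∃ x, toOrdinal x = a ∧ o ∈ toOrdinal '' t x}
  have hT : ∀ x, T (toOrdinal x) = toOrdinal '' t x := fun x => by
    ext o
    constructor
    · rintro ⟨y, hy, ho⟩
      rwa [← toOrdinal_strictMono.injective hy]
    · exact fun ho => ⟨x, rfl, ho⟩
  have hTsub : ∀ a, a < sucOrd mu → T a ⊆ Iio (sucOrd mu) := by
    rintro a - _ ⟨x, -, y, -, rfl⟩
    exact toOrdinal_lt y
  have hTd : ∀ a b, a < sucOrd mu → b < sucOrd mu → a ≠ b → Disjoint (T a) (T b) := by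
    intro a b ha hb hab
    obtain ⟨x, rfl⟩ := exists_toOrdinal_eq ha
    obtain ⟨y, rfl⟩ := exists_toOrdinal_eq hb
    rw [hT, hT, disjoint_image_iff toOrdinal_strictMono.injective]
    exact htd fun hxy => hab (congrArg _ hxy)
  have hTk : ∀ a, a < sucOrd mu → CardLT (T a) (Ordinal.cof mu.ord) := by
    intro a ha
    obtain ⟨x, rfl⟩ := exists_toOrdinal_eq ha
    rw [hT, CardLT]
    have hle : Cardinal.lift.{0} (Cardinal.mk (toOrdinal '' t x)) ≤
      Cardinal.lift.{1} (Cardinal.mk (t x)) := Cardinal.mk_image_le_lift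
    rw [Cardinal.lift_uzero] at hle
    exact hle.trans_lt (Cardinal.lift_lt.2 (htk x))
  obtain ⟨a, b, hab, hb, H⟩ := hc.2 T hTsub hTd hTk τ hτ
  obtain ⟨x, rfl⟩ := exists_toOrdinal_eq (hab.trans hb)
  obtain ⟨y, rfl⟩ := exists_toOrdinal_eq hb
  refine ⟨x, y, toOrdinal_strictMono.lt_iff_lt.1 hab, fun ξ hξ ζ hζ => ?_⟩
  dsimp only
  rw [toOrdinal_strictMono.monotone.map_min, toOrdinal_strictMono.monotone.map_max,
    H _ (by rw [hT]; exact ⟨ξ, hξ, rfl⟩) _ (by rw [hT]; exact ⟨ζ, hζ, rfl⟩)]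

theorem pr1_succ_of_hits {mu : Cardinal.{0}}
    {d : (sucOrd mu).ToType → (sucOrd mu).ToType → (sucOrd mu).ToType}
    (hd : ∀ ε, Hits (Ordinal.cof mu.ord) d ε) : Pr1 mu (Order.succ mu) := by
  have hpos : 0 < sucOrd mu := Cardinal.ord_pos.2 ((zero_le).trans_lt (Order.lt_succ mu))
  have : Nonempty (sucOrd mu).ToType := ⟨(exists_toOrdinal_eq hpos).choose⟩
  let p : Ordinal → (sucOrd mu).ToType := Function.invFun toOrdinal
  have hp : ∀ x, p (toOrdinal x) = x :=
    Function.leftInverse_invFun toOrdinal_strictMono.injective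
  refine ⟨fun a b => toOrdinal (d (p a) (p b)), fun a b _ _ => toOrdinal_lt _,
    fun t ht htd htk τ hτ => ?_⟩
  obtain ⟨ε, rfl⟩ := exists_toOrdinal_eq (o := sucOrd mu) hτ
  have htk' : ∀ x, Cardinal.mk (toOrdinal ⁻¹' t (toOrdinal x) : Set (sucOrd mu).ToType) <
      Ordinal.cof mu.ord := fun x => by
    have hlt := htk _ (toOrdinal_lt x)
    have hle : Cardinal.lift.{1} (Cardinal.mk (toOrdinal ⁻¹' t (toOrdinal x) :
          Set (sucOrd mu).ToType)) ≤ Cardinal.lift.{0} (Cardinal.mk (t (toOrdinal x))) :=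
      Cardinal.mk_preimage_of_injective_lift _ _ toOrdinal_strictMono.injective
    rw [Cardinal.lift_uzero] at hle
    exact Cardinal.lift_lt.1 (hle.trans_lt hlt)
  obtain ⟨x, y, hxy, H⟩ := hd ε (fun x => toOrdinal ⁻¹' t (toOrdinal x))
    (fun x y hxy => (htd _ _ (toOrdinal_lt x) (toOrdinal_lt y)
      (toOrdinal_strictMono.injective.ne hxy)).preimage _) htk'
  refine ⟨toOrdinal x, toOrdinal y, toOrdinal_strictMono hxy, toOrdinal_lt y,
    fun ξ hξ ζ hζ => ?_⟩
  obtain ⟨u, rfl⟩ := exists_toOrdinal_eq (ht _ (toOrdinal_lt x) hξ)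
  obtain ⟨v, rfl⟩ := exists_toOrdinal_eq (ht _ (toOrdinal_lt y) hζ)
  dsimp only
  rw [← toOrdinal_strictMono.monotone.map_min, ← toOrdinal_strictMono.monotone.map_max, hp, hp,
    H u hξ v hζ]

/-- The stepping up theorem: from arbitrarily large `θ < μ` colors to `μ⁺` colors. -/
theorem pr1_succ_of_forall_lt {mu : Cardinal.{0}} (hmu : IsSingular mu)
    (H : ∀ θ₀ : Cardinal.{0}, θ₀ < mu → ∃ θ : Cardinal.{0}, θ₀ ≤ θ ∧ θ < mu ∧ Pr1 mu θ) :
    Pr1 mu (Order.succ mu) := by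
  obtain ⟨I, chi, e, S⟩ := hmu.exists_ladderSystem
  obtain ⟨h, hh⟩ := S.exists_guess
  have : Nonempty I := by
    obtain ⟨i, -⟩ := S.dominate (ι := Empty) (fun _ => 0)
      (by simpa using Cardinal.aleph0_pos.trans_le S.aleph0_le) (fun j => j.elim)
    exact ⟨i⟩
  have : Nonempty mu.ord.ToType :=
    ⟨(exists_toOrdinal_eq
      (Cardinal.ord_pos.2 (Cardinal.aleph0_pos.trans_le S.aleph0_le_mu))).choose⟩
  obtain ⟨th₀, hth₀, -, c₀, hc₀⟩ := H _ S.kap_lt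
  obtain ⟨g, hg⟩ := exists_ordinal_decoding (X := I × I)
    ((mk_prod_le_of_le S.aleph0_le S.mk_index_le S.mk_index_le).trans hth₀)
  obtain ⟨g', hg'⟩ := exists_ordinal_decoding (X := mu.ord.ToType)
    (Cardinal.mk_ord_toType mu).le
  choose th hth _ c hc using fun i => H (chi i) (S.chi_lt i)
  have hr : ∀ x : (sucOrd mu).ToType, ∃ r : mu.ord.ToType → (sucOrd mu).ToType,
      ∀ y < x, ∃ m, r m = y := fun x => by
    obtain ⟨f⟩ := (S.mk_Iio_le x).trans (Cardinal.mk_ord_toType mu).ge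
    exact ⟨Function.extend f Subtype.val fun _ => x,
      fun y hy => ⟨f ⟨y, hy⟩, f.injective.extend_apply _ _ _⟩⟩
  choose r hr using hr
  refine pr1_succ_of_hits (S.hits_steppedUp hh
    (c₀ := fun x y => g (c₀ (toOrdinal x) (toOrdinal y)))
    (c := fun k x y => g' (c k (toOrdinal x) (toOrdinal y))) (fun p => ?_) (fun m => ?_)
    (Cardinal.mk_ord_toType mu).le hr)
  · obtain ⟨τ, hτ, rfl⟩ := hg p
    exact hc₀.hits g hτ
  · obtain ⟨τ, hτ, rfl⟩ := hg' m
    obtain ⟨k, hk⟩ := S.dominate (ι := Unit) (fun _ => Order.succ τ.card)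
      (by simpa using Cardinal.one_lt_aleph0.trans_le S.aleph0_le)
      fun _ => hmu.succ_lt (Cardinal.lt_ord.1 hτ)
    exact ⟨k, (hc k).hits g' (Cardinal.lt_ord.2
      ((Order.lt_succ _).trans_le ((hk ()).trans (hth k))))⟩

theorem Pr1.mono {mu σ σ' : Cardinal.{0}} (hpr : Pr1 mu σ) (h0 : 0 < σ') (hle : σ' ≤ σ) :
    Pr1 mu σ' := by
  obtain ⟨c, -, hc⟩ := hpr
  refine ⟨fun a b => if c a b < σ'.ord then c a b else 0, fun a b _ _ => ?_,
    fun t ht htd htk τ hτ => ?_⟩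
  · dsimp only
    split_ifs with hab
    · exact hab
    · exact Cardinal.ord_pos.2 h0
  · obtain ⟨a, b, hab, hb, H⟩ := hc t ht htd htk τ (hτ.trans_le (Cardinal.ord_le_ord.2 hle))
    refine ⟨a, b, hab, hb, fun ξ hξ ζ hζ => ?_⟩
    simp only [H ξ hξ ζ hζ, if_pos hτ]

/-- For singular `μ`, the principles `pr₁(μ⁺,μ⁺,μ⁺,cf μ)`, `pr₁(μ⁺,μ⁺,μ,cf μ)`, and
"`pr₁(μ⁺,μ⁺,θ,cf μ)` for arbitrarily large `θ < μ`" are all equivalent. -/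
theorem stmt1 (mu : Cardinal) (hsing : IsSingular mu) :
    (Pr1 mu (Order.succ mu) ↔ Pr1 mu mu) ∧
    (Pr1 mu mu ↔
      ∀ θ₀ : Cardinal, θ₀ < mu → ∃ θ : Cardinal, θ₀ ≤ θ ∧ θ < mu ∧ Pr1 mu θ) := by
  have hab : Pr1 mu (Order.succ mu) → Pr1 mu mu := fun h =>
    h.mono (Cardinal.aleph0_pos.trans_le hsing.1) (Order.le_succ mu)
  have hbc : Pr1 mu mu → ∀ θ₀ : Cardinal, θ₀ < mu → ∃ θ : Cardinal, θ₀ ≤ θ ∧ θ < mu ∧ Pr1 mu θ :=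
    fun h θ₀ hθ₀ =>
      have hlt : max θ₀ 1 < mu := max_lt hθ₀ (Cardinal.one_lt_aleph0.trans_le hsing.1)
      ⟨max θ₀ 1, le_max_left _ _, hlt,
        h.mono (zero_lt_one.trans_le (le_max_right _ _)) hlt.le⟩
  exact ⟨⟨hab, fun h => pr1_succ_of_forall_lt hsing (hbc h)⟩,
    ⟨hbc, fun h => hab (pr1_succ_of_forall_lt hsing h)⟩⟩

end
end
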